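/- arXiv:1402.3736 — 3 statements merged into one kernel-verified Lean document; each statement's English description precedes it below -/
import Mathlib

section
/- For every d ≥ 3, n ≥ 3 and n' ≥ 3, every graph homomorphism f: L(G_{n,d}) → L(G_{n',d}) maps special nodes to special nodes, where the special nodes are the vertices of the line graph corresponding to the edges joining the copies of the d-dragon to the middle vertices c of the indicator copies. -/
open SimpleGraph

/-- The edge relation of the `d`-dragon on vertex indices `0,…,d+1`:
vertices `0,…,d` are pairwise adjacent except `0` and `d`, and vertex `d+1`
is adjacent exactly to `0` and `d`. -/
def dragonRel (d : ℕ) (u v : ℕ) : Prop :=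
  (u < d + 1 ∧ v < d + 1 ∧ ¬(u = 0 ∧ v = d) ∧ ¬(u = d ∧ v = 0)) ∨
  (u = d + 1 ∧ (v = 0 ∨ v = d))

/-- The `d`-dragon `D_d`: `K_{d+1}` with one edge replaced by a path on 3 vertices. -/
def dragon (d : ℕ) : SimpleGraph (Fin (d + 2)) :=
  SimpleGraph.fromRel (fun u v => dragonRel d u.val v.val)

/-- The `n`-sunlet: a cycle `C_n` (`Sum.inl` vertices) with a pendant vertex
(`Sum.inr`) attached to each cycle vertex. -/
def sunlet (n : ℕ) : SimpleGraph (Fin n ⊕ Fin n) :=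
  SimpleGraph.fromRel (fun u v =>
    match u, v with
    | Sum.inl i, Sum.inl j => j.val = (i.val + 1) % n
    | Sum.inl i, Sum.inr j => i = j
    | _, _ => False)

/-- The internal part of the indicator `I_d(a,b)` on indices `0,…,d+2`:
indices `0,…,d+1` form the dragon `D_d`, and index `d+2` is the middle vertex `c`,
joined to the degree-2 vertex `d+1` of the dragon. -/
def indicatorInternalRel (d k l : ℕ) : Prop :=
  dragonRel d k l ∨ (k = d + 2 ∧ l = d + 1)

/-- The graph `G_{n,d} = S_n * I_d(a,b)`: every edge `{x,y}` of the sunlet `S_n` is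
replaced by a fresh copy of the indicator `I_d(a,b)` with `a,b` identified with `x,y`.
Sunlet vertices are `Sum.inl`; the copy of the indicator sitting on the cycle edge
`{i, i+1}` is indexed by `(i,0)`, the copy on the pendant edge `{i, pendant i}` is
indexed by `(i,1)`; in each copy, index `d+2` is the middle vertex `c`, adjacent to
the two endpoints of the corresponding sunlet edge, and indices `0,…,d+1` form the dragon. -/
def sunletIndicator (n d : ℕ) :
    SimpleGraph ((Fin n ⊕ Fin n) ⊕ ((Fin n × Fin 2) × Fin (d + 3))) :=
  SimpleGraph.fromRel (fun u v =>
    match u, v with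
    | Sum.inr (e, k), Sum.inr (e', l) => e = e' ∧ indicatorInternalRel d k.val l.val
    | Sum.inl x, Sum.inr (e, k) =>
        k.val = d + 2 ∧
        (x = Sum.inl e.1 ∨
         (e.2.val = 0 ∧ ∃ j : Fin n, j.val = (e.1.val + 1) % n ∧ x = Sum.inl j) ∨
         (e.2.val = 1 ∧ x = Sum.inr e.1))
    | _, _ => False)

/-- Disjoint union of an indexed family of simple graphs. -/
def sigmaGraph {ι : Type*} {V : ι → Type*} (G : ∀ i, SimpleGraph (V i)) :
    SimpleGraph (Σ i, V i) :=
  SimpleGraph.fromRel (fun x y =>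
    ∃ (i : ι) (u v : V i), (G i).Adj u v ∧ x = ⟨i, u⟩ ∧ y = ⟨i, v⟩)

/-- A special node of `L(G_{n,d})`: a vertex of the line graph corresponding to an
edge joining the degree-2 vertex (index `d+1`) of a copy of the dragon to the middle
vertex `c` (index `d+2`) of the same indicator copy. -/
def IsSpecialNode (n d : ℕ) (x : (sunletIndicator n d).edgeSet) : Prop :=
  ∃ e : Fin n × Fin 2,
    (x : Sym2 ((Fin n ⊕ Fin n) ⊕ ((Fin n × Fin 2) × Fin (d + 3)))) =
      s(Sum.inr (e, ⟨d + 1, by omega⟩), Sum.inr (e, ⟨d + 2, by omega⟩))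


theorem adj_dd {n d : ℕ} (e e' : Fin n × Fin 2) (k l : Fin (d+3)) :
    (sunletIndicator n d).Adj (Sum.inr (e,k)) (Sum.inr (e',l)) ↔
      e = e' ∧ k.val ≠ l.val ∧
        (indicatorInternalRel d k.val l.val ∨ indicatorInternalRel d l.val k.val) := by
  simp only [sunletIndicator, SimpleGraph.fromRel_adj, ne_eq, Sum.inr.injEq, Prod.mk.injEq, Fin.ext_iff (a := k)]
  constructor
  · rintro ⟨h, ⟨rfl, h'⟩ | ⟨rfl, h'⟩⟩ <;> simp_all
  · rintro ⟨rfl, h, h' | h'⟩ <;> simp_all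

/-- outer relation -/
def outerRel (n : ℕ) (x : Fin n ⊕ Fin n) (e : Fin n × Fin 2) : Prop :=
  (x = Sum.inl e.1 ∨
         (e.2.val = 0 ∧ ∃ j : Fin n, j.val = (e.1.val + 1) % n ∧ x = Sum.inl j) ∨
         (e.2.val = 1 ∧ x = Sum.inr e.1))

theorem adj_od {n d : ℕ} (x) (e' : Fin n × Fin 2) (l : Fin (d+3)) :
    (sunletIndicator n d).Adj (Sum.inl x) (Sum.inr (e',l)) ↔
      l.val = d + 2 ∧ outerRel n x e' := by
  simp [sunletIndicator, SimpleGraph.fromRel_adj, outerRel]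

theorem adj_oo {n d : ℕ} (x y) :
    ¬ (sunletIndicator n d).Adj (Sum.inl x) (Sum.inl y) := by
  simp [sunletIndicator, SimpleGraph.fromRel_adj]

theorem parity_aux (d : ℕ) (hd : 3 ≤ d) (w : Fin (d+1)) (ψ : Fin (d+1) → Fin (d+1) → Fin (d+1))
    (h1 : ∀ u v, u ≠ v → ψ u v ≠ w)
    (h2 : ∀ u v v', u ≠ v → u ≠ v' → ψ u v = ψ u v' → v = v')
    (h3 : ∀ u v, u ≠ v → ¬ (u = 0 ∧ v = Fin.last d) → ¬ (u = Fin.last d ∧ v = 0) → ψ u v = ψ v u)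
    (h4 : ψ 0 (Fin.last d) ≠ ψ (Fin.last d) 0) : False := by
  have h0l : (0 : Fin (d+1)) ≠ Fin.last d := by
    intro h; have := congrArg Fin.val h; simp at this; omega
  -- surjectivity
  have hs : ∀ u γ, γ ≠ w → ∃ v, u ≠ v ∧ ψ u v = γ := by
    intro u γ hγ
    have hinj : Function.Injective (fun v => if v = u then w else ψ u v) := by
      intro a b hab
      dsimp only at hab
      split_ifs at hab with ha hb hb
      · rw [ha, hb]
      · exact absurd hab.symm (h1 u b (Ne.symm hb))
      · exact absurd hab (h1 u a (Ne.symm ha))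
      · exact h2 u a b (Ne.symm ha) (Ne.symm hb) hab
    obtain ⟨v, hv⟩ := (Finite.injective_iff_surjective.mp hinj) γ
    dsimp only at hv
    split_ifs at hv with h
    · exact absurd hv.symm hγ
    · exact ⟨v, Ne.symm h, hv⟩
  have key : ∀ γ, γ ≠ w → ∃ τ : Fin (d+1) → Fin (d+1), Function.Involutive τ ∧
      ∀ u, τ u = u ↔ (u = 0 ∧ ψ 0 (Fin.last d) = γ) ∨ (u = Fin.last d ∧ ψ (Fin.last d) 0 = γ) := by
    intro γ hγ
    choose σ hσ1 hσ2 using fun u => hs u γ hγ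
    have hu : ∀ u v, u ≠ v → ψ u v = γ → σ u = v := fun u v huv h =>
      h2 u _ _ (hσ1 u) huv ((hσ2 u).trans h.symm)
    let τ : Fin (d+1) → Fin (d+1) := fun u =>
      if (u = 0 ∧ σ u = Fin.last d) ∨ (u = Fin.last d ∧ σ u = 0) then u else σ u
    refine ⟨τ, ?_, ?_⟩
    · intro u
      by_cases hb : (u = 0 ∧ σ u = Fin.last d) ∨ (u = Fin.last d ∧ σ u = 0)
      · have : τ u = u := if_pos hb
        rw [this, this]
      · have ht : τ u = σ u := if_neg hb
        have hss : σ (σ u) = u := by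
          apply hu _ _ (hσ1 u).symm
          rw [← hσ2 u]
          symm
          apply h3 _ _ (hσ1 u) <;> tauto
        rw [ht]
        have : τ (σ u) = σ (σ u) := by
          apply if_neg
          rw [hss]; tauto
        rw [this, hss]
    · intro u
      constructor
      · intro h
        by_cases hb : (u = 0 ∧ σ u = Fin.last d) ∨ (u = Fin.last d ∧ σ u = 0)
        · rcases hb with ⟨rfl, hb⟩ | ⟨rfl, hb⟩
          · left; exact ⟨rfl, by rw [← hb]; exact hσ2 _⟩
          · right; refine ⟨rfl, ?_⟩
            have := hσ2 (Fin.last d); rwa [hb] at this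
        · have ht : τ u = σ u := if_neg hb
          exact absurd (ht ▸ h).symm (hσ1 u)
      · rintro (⟨rfl, hb⟩ | ⟨rfl, hb⟩)
        · exact if_pos (Or.inl ⟨rfl, hu _ _ h0l hb⟩)
        · exact if_pos (Or.inr ⟨rfl, hu _ _ h0l.symm hb⟩)
  have par : ∀ τ : Fin (d+1) → Fin (d+1), Function.Involutive τ →
      (Finset.univ.filter (fun u => τ u = u)).card % 2 = (d + 1) % 2 := by
    intro τ hτ
    have hp : (show Function.End (Fin (d+1)) from τ) ^ (2 ^ 1) = 1 := by
      rw [pow_one, sq]; funext x; exact hτ x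
    have := Equiv.Perm.card_fixedPoints_modEq (p := 2) (n := 1) hp
    rw [Fintype.card_fin, Fintype.card_subtype] at this
    exact this.symm
  obtain ⟨τ1, hi1, hf1⟩ := key (ψ 0 (Fin.last d)) (h1 _ _ h0l)
  have hγ : ∃ γ, γ ≠ w ∧ γ ≠ ψ 0 (Fin.last d) ∧ γ ≠ ψ (Fin.last d) 0 := by
    by_contra hcon
    have : (Finset.univ : Finset (Fin (d+1))) ⊆ {w, ψ 0 (Fin.last d), ψ (Fin.last d) 0} := by
      intro γ _
      simp only [Finset.mem_insert, Finset.mem_singleton]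
      by_contra h
      exact hcon ⟨γ, by tauto⟩
    have := (Finset.card_le_card this).trans Finset.card_le_three
    simp at this; omega
  obtain ⟨γ, hγ1, hγ2, hγ3⟩ := hγ
  obtain ⟨τ2, hi2, hf2⟩ := key γ hγ1
  have p1 := par τ1 hi1
  have p2 := par τ2 hi2
  have e1 : (Finset.univ.filter (fun u => τ1 u = u)) = {0} := by
    ext u; simp [hf1, h4.symm]
  have e2 : (Finset.univ.filter (fun u => τ2 u = u)) = ∅ := by
    ext u; simp [hf2, hγ2.symm, hγ3.symm]
  rw [e1] at p1; rw [e2] at p2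
  simp at p1 p2; omega

def ta : Fin 7 → Fin (3+3) := ![0,0,1,1,2,0,3]
def tb : Fin 7 → Fin (3+3) := ![1,2,2,3,3,4,4]

def shareT (i j : Fin 7) : Bool :=
  decide (i ≠ j) && (decide (ta i = ta j) || decide (ta i = tb j) || decide (tb i = ta j)
    || decide (tb i = tb j))

/-- Codes: dragon edges, special edges (by copy type), outer edges (by colour). -/
inductive Code where
  | dr (i : Fin 7)
  | sp (c : Fin 3)
  | ou (c : Fin 3)

def Code.adj : Code → Code → Bool
  | .dr i, .dr j => shareT i j
  | .dr i, .sp _ => decide (5 ≤ i)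
  | .sp _, .dr i => decide (5 ≤ i)
  | .dr _, .ou _ => false
  | .ou _, .dr _ => false
  | .sp _, .sp _ => false
  | .sp c, .ou c' => decide (c ≠ c')
  | .ou c, .sp c' => decide (c ≠ c')
  | .ou c, .ou c' => decide (c ≠ c')

inductive HasCode (n : ℕ) : Sym2 ((Fin n ⊕ Fin n) ⊕ ((Fin n × Fin 2) × Fin (3 + 3))) → Code → Prop
  | dr (e) (i : Fin 7) : HasCode n s(Sum.inr (e, ta i), Sum.inr (e, tb i)) (.dr i)
  | sp0 (e) : HasCode n s(Sum.inr ((e, 0), 4), Sum.inr ((e, 0), 5)) (.sp 0)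
  | sp1 (e) : HasCode n s(Sum.inr ((e, 1), 4), Sum.inr ((e, 1), 5)) (.sp 2)
  | o1 (e) : HasCode n s(Sum.inl (Sum.inl e), Sum.inr ((e, 0), 5)) (.ou 1)
  | o2 (e) (j : Fin n) (h : j.val = (e.val + 1) % n) :
      HasCode n s(Sum.inl (Sum.inl j), Sum.inr ((e, 0), 5)) (.ou 2)
  | o3 (e) : HasCode n s(Sum.inl (Sum.inl e), Sum.inr ((e, 1), 5)) (.ou 0)
  | o4 (e) : HasCode n s(Sum.inl (Sum.inr e), Sum.inr ((e, 1), 5)) (.ou 1)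

theorem ta_ne : ∀ i, ta i ≠ 5 ∧ tb i ≠ 5 ∧ ta i ≠ 4 ∧ (tb i = 4 → 5 ≤ i) := by decide

theorem succ_inj_mod {n : ℕ} (a b : Fin n) (h : (a.val + 1) % n = (b.val + 1) % n) : a = b := by
  have h1 : a.val ≡ b.val [MOD n] := Nat.ModEq.add_right_cancel' 1 h
  have := Nat.ModEq.eq_of_lt_of_lt h1 a.2 b.2
  exact Fin.ext this

theorem hasCode_adj {n : ℕ} {x y} {a b : Code} (hx : HasCode n x a) (hy : HasCode n y b)
    (hne : x ≠ y) (v) (hvx : v ∈ x) (hvy : v ∈ y) : a.adj b = true := by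
  have h1 := ta_ne
  have h2 := fun e e' => succ_inj_mod (n := n) e e'
  cases hx <;> cases hy <;> rw [Sym2.mem_iff] at hvx hvy <;>
   rcases hvx with rfl | rfl <;> simp [Code.adj, shareT] at hvy hne ⊢ <;> grind

theorem hasCode_exists {n : ℕ} (x) (hx : x ∈ (sunletIndicator n 3).edgeSet) :
    ∃ a, HasCode n x a := by
  have key1 : ∀ k l : Fin (3+3), k.val ≠ l.val → indicatorInternalRel 3 k.val l.val →
      (∃ i, (k = ta i ∧ l = tb i) ∨ (l = ta i ∧ k = tb i)) ∨ (k = 5 ∧ l = 4) := by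
    unfold indicatorInternalRel dragonRel; decide
  have key2 : ∀ (e : Fin n × Fin 2) (k l : Fin (3+3)), k.val ≠ l.val →
      indicatorInternalRel 3 k.val l.val → 
      ∃ a, HasCode n s(Sum.inr (e,k), Sum.inr (e,l)) a := by
    intro e k l h1 h2
    rcases key1 k l h1 h2 with ⟨i, ⟨rfl, rfl⟩ | ⟨rfl, rfl⟩⟩ | ⟨rfl, rfl⟩
    · exact ⟨_, .dr e i⟩
    · rw [Sym2.eq_swap]; exact ⟨_, .dr e i⟩
    · rw [Sym2.eq_swap]
      obtain ⟨e, c⟩ := e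
      fin_cases c
      · exact ⟨_, .sp0 e⟩
      · exact ⟨_, .sp1 e⟩
  have key3 : ∀ (z) (e : Fin n × Fin 2) (l : Fin (3+3)), l.val = 3 + 2 → outerRel n z e →
      ∃ a, HasCode n s(Sum.inl z, Sum.inr (e,l)) a := by
    intro z ⟨e, c⟩ l hl h
    have : l = 5 := Fin.ext hl
    subst this
    rcases h with rfl | ⟨h, j, hj, rfl⟩ | ⟨h, rfl⟩
    · fin_cases c
      · exact ⟨_, .o1 e⟩
      · exact ⟨_, .o3 e⟩
    · have : c = 0 := Fin.ext h
      subst this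
      exact ⟨_, .o2 e j hj⟩
    · have : c = 1 := Fin.ext h
      subst this
      exact ⟨_, .o4 e⟩
  induction x using Sym2.ind with
  | _ p q =>
    rw [SimpleGraph.mem_edgeSet] at hx
    rcases p with p | ⟨e, k⟩ <;> rcases q with q | ⟨e', l⟩
    · exact absurd hx (adj_oo _ _)
    · rw [adj_od] at hx; exact key3 _ _ _ hx.1 hx.2
    · rw [SimpleGraph.adj_comm, adj_od] at hx; rw [Sym2.eq_swap]; exact key3 _ _ _ hx.1 hx.2
    · rw [adj_dd] at hx
      obtain ⟨rfl, h1, h2 | h2⟩ := hx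
      · exact key2 _ _ _ h1 h2
      · rw [Sym2.eq_swap]; exact key2 _ _ _ h1.symm h2

def codeN (i : Fin 13) : Code :=
  if h : i.val < 7 then .dr ⟨i.val, h⟩ else if i.val < 10 then .sp (Fin.ofNat 3 (i.val - 7))
  else .ou (Fin.ofNat 3 (i.val - 10))

theorem codeN_surj (c : Code) : ∃ i, codeN i = c := by
  rcases c with i | i | i
  · revert i; simp only [codeN]; intro i; exact ⟨⟨i.val, by omega⟩, by simp⟩
  · fin_cases i
    exacts [⟨7, rfl⟩, ⟨8, rfl⟩, ⟨9, rfl⟩]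
  · fin_cases i
    exacts [⟨10, rfl⟩, ⟨11, rfl⟩, ⟨12, rfl⟩]

def adjN (i j : Fin 13) : Bool := (codeN i).adj (codeN j)

theorem finite_check : ∀ C A, adjN C A = true → ∀ B, adjN A B = true → adjN C B = true →
    ∀ P, adjN A P = true → adjN B P = true → 
    ∀ D, adjN A D = true → adjN C D = true → 
    ∀ E, adjN B E = true → adjN C E = true → adjN D E = true →
    ∀ Q, adjN D Q = true → adjN E Q = true → adjN P Q = true →
    ∀ S, adjN S P = true → adjN S Q = true → (7 ≤ S.val ∧ S.val < 10) := by
  decide +kernel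

theorem case_three (n n' : ℕ)
    (f : (sunletIndicator n 3).lineGraph →g (sunletIndicator n' 3).lineGraph)
    (x : (sunletIndicator n 3).edgeSet) (hx : IsSpecialNode n 3 x) :
    IsSpecialNode n' 3 (f x) := by
  obtain ⟨e, he⟩ := hx
  have hmem : ∀ i : Fin 7, s(Sum.inr (e, ta i), Sum.inr (e, tb i)) ∈ (sunletIndicator n 3).edgeSet := by
    intro i
    rw [SimpleGraph.mem_edgeSet, adj_dd]
    refine ⟨rfl, ?_⟩
    revert i
    unfold indicatorInternalRel dragonRel; decide
  let X : Fin 7 → (sunletIndicator n 3).edgeSet := fun i => ⟨_, hmem i⟩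
  have hX : ∀ i j, shareT i j = true → (sunletIndicator n 3).lineGraph.Adj (X i) (X j) := by
    intro i j hij
    rw [lineGraph_adj_iff_exists]
    have hne : ∀ i j, shareT i j = true → ¬ (ta i = ta j ∧ tb i = tb j) ∧
      ¬ (ta i = tb j ∧ tb i = ta j) := by decide
    have := hne i j hij
    constructor
    · intro h
      have := congrArg Subtype.val h
      simp [X] at this; tauto
    · simp [shareT] at hij
      simp only [X, Sym2.mem_iff]
      rcases hij with ⟨_, ((h | h) | h) | h⟩
      · exact ⟨_, Or.inl rfl, Or.inl (by rw [h])⟩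
      · exact ⟨_, Or.inl rfl, Or.inr (by rw [h])⟩
      · exact ⟨_, Or.inr rfl, Or.inl (by rw [h])⟩
      · exact ⟨_, Or.inr rfl, Or.inr (by rw [h])⟩
  have hXs : ∀ i, 5 ≤ i → (sunletIndicator n 3).lineGraph.Adj x (X i) := by
    intro i hi
    rw [lineGraph_adj_iff_exists]
    have h4 : ∀ i, 5 ≤ i → tb i = 4 ∧ ta i ≠ 5 ∧ ta i ≠ 4:= by decide
    obtain ⟨h4, h5, h6⟩ := h4 i hi
    constructor
    · intro h
      have := congrArg Subtype.val h
      rw [he] at this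
      change s(_, _) = s(_, _) at this
      simp [h4] at this
      exact h5 this.symm
    · rw [he]
      exact ⟨_, by rw [Sym2.mem_iff]; exact Or.inl rfl, by simp only [X, Sym2.mem_iff, h4]; right; rfl⟩
  have hc : ∀ y : (sunletIndicator n' 3).edgeSet, ∃ i, HasCode n' y (codeN i) := by
    intro y
    obtain ⟨a, ha⟩ := hasCode_exists y.1 y.2
    obtain ⟨i, rfl⟩ := codeN_surj a
    exact ⟨i, ha⟩
  choose cd hcd using hc
  have had : ∀ y z, (sunletIndicator n 3).lineGraph.Adj y z → adjN (cd (f y)) (cd (f z)) = true := by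
    intro y z h
    have := f.map_adj h
    rw [lineGraph_adj_iff_exists] at this
    obtain ⟨h1, v, h2, h3⟩ := this
    exact hasCode_adj (hcd _) (hcd _) (fun h => h1 (Subtype.ext h)) v h2 h3
  have hXX := fun i j (h : shareT i j = true) => had _ _ (hX i j h)
  have hfin := finite_check (cd (f (X 2))) (cd (f (X 0))) (hXX _ _ (by decide)) (cd (f (X 1)))
    (hXX _ _ (by decide)) (hXX _ _ (by decide)) (cd (f (X 5)))
    (hXX _ _ (by decide)) (hXX _ _ (by decide)) (cd (f (X 3)))
    (hXX _ _ (by decide)) (hXX _ _ (by decide)) (cd (f (X 4)))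
    (hXX _ _ (by decide)) (hXX _ _ (by decide)) (hXX _ _ (by decide)) (cd (f (X 6)))
    (hXX _ _ (by decide)) (hXX _ _ (by decide)) (hXX _ _ (by decide)) (cd (f x))
    (had _ _ (hXs _ (by decide))) (had _ _ (hXs _ (by decide)))
  have hfx := hcd (f x)
  have : ∃ c, codeN (cd (f x)) = .sp c := by
    refine ⟨Fin.ofNat 3 ((cd (f x)).val - 7), ?_⟩
    · simp only [codeN]; rw [dif_neg (by omega), if_pos hfin.2]
  obtain ⟨c, hc⟩ := this
  rw [hc] at hfx
  unfold IsSpecialNode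
  generalize (f x).val = y at hfx
  generalize hcc : Code.sp c = cc at hfx
  cases hfx with
  | dr e i => cases hcc
  | o1 e => cases hcc
  | o2 e j h => cases hcc
  | o3 e => cases hcc
  | o4 e => cases hcc
  | sp0 e => exact ⟨(e,0), rfl⟩
  | sp1 e => exact ⟨(e,1), rfl⟩

def bad {d : ℕ} (u v : Fin (d+1)) : Prop :=
  (u = 0 ∧ v = Fin.last d) ∨ (u = Fin.last d ∧ v = 0)

instance {d : ℕ} (u v : Fin (d+1)) : Decidable (bad u v) := by unfold bad; infer_instance

theorem bad_symm {d : ℕ} {u v : Fin (d+1)} (h : bad u v) : bad v u := by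
  unfold bad at *; tauto

theorem bad_val {d : ℕ} {u v : Fin (d+1)} :
    bad u v ↔ (u.val = 0 ∧ v.val = d) ∨ (u.val = d ∧ v.val = 0) := by
  simp only [bad, Fin.ext_iff, Fin.val_last, Fin.val_zero]

def up {d : ℕ} (u : Fin (d+1)) : Fin (d+3) := ⟨u.val, by omega⟩

def nb {d : ℕ} (u v : Fin (d+1)) : Fin (d+3) :=
  if bad u v then ⟨d+1, by omega⟩ else up v

abbrev VV (n d : ℕ) := (Fin n ⊕ Fin n) ⊕ ((Fin n × Fin 2) × Fin (d + 3))

def TT {n d : ℕ} (e : Fin n × Fin 2) (u v : Fin (d+1)) : Sym2 (VV n d) :=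
  s(Sum.inr (e, up u), Sum.inr (e, nb u v))

theorem TT_adj {n d : ℕ} (hd : 3 ≤ d) (e : Fin n × Fin 2) (u v : Fin (d+1)) (h : u ≠ v) :
    TT e u v ∈ (sunletIndicator n d).edgeSet := by
  unfold TT
  rw [SimpleGraph.mem_edgeSet, adj_dd]
  refine ⟨rfl, ?_⟩
  have h' : u.val ≠ v.val := fun h'' => h (Fin.ext h'')
  unfold nb indicatorInternalRel dragonRel
  have hu := u.2
  have hv := v.2
  split_ifs with hb <;> rw [bad_val] at hb <;> simp only [up]
  · exact ⟨by omega, Or.inr (Or.inl (Or.inr ⟨trivial, by omega⟩))⟩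
  · omega

theorem TT_of_mem {n d : ℕ} (hd : 3 ≤ d) (e : Fin n × Fin 2) (u : Fin (d+1)) (x : Sym2 (VV n d))
    (hx : x ∈ (sunletIndicator n d).edgeSet) (hm : Sum.inr (e, up u) ∈ x) :
    ∃ v, u ≠ v ∧ x = TT e u v := by
  obtain ⟨y, rfl⟩ := hm
  rw [SimpleGraph.mem_edgeSet] at hx
  have hu := u.2
  rcases y with y | ⟨e', l⟩
  · rw [SimpleGraph.adj_comm, adj_od] at hx
    have := hx.1
    simp only [up] at this; omega
  · rw [adj_dd] at hx
    obtain ⟨rfl, h1, h2⟩ := hx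
    unfold indicatorInternalRel dragonRel at h2
    simp only [up] at h1 h2
    by_cases hl : l.val < d + 1
    · refine ⟨⟨l.val, hl⟩, fun h => h1 (congrArg Fin.val h), ?_⟩
      have : ¬ bad u ⟨l.val, hl⟩ := by rw [bad_val]; simp only []; omega
      simp [TT, nb, this, up]
    · have hl' : l.val = d + 1 := by omega
      have hu' : u.val = 0 ∨ u.val = d := by omega
      rcases hu' with hu' | hu'
      · have : bad u (Fin.last d) := by rw [bad_val]; simp [hu']
        refine ⟨Fin.last d, fun h => ?_, ?_⟩
        · have := congrArg Fin.val h; simp only [Fin.val_last, Fin.val_zero] at this; omega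
        · simp only [TT, nb, this, if_true]; congr; exact Fin.ext hl'
      · have : bad u 0 := by rw [bad_val]; simp [hu']
        refine ⟨0, fun h => ?_, ?_⟩
        · have := congrArg Fin.val h; simp only [Fin.val_last, Fin.val_zero] at this; omega
        · simp only [TT, nb, this, if_true]; congr; exact Fin.ext hl'

theorem nb_inj {d : ℕ} (hd : 3 ≤ d) {u v v' : Fin (d+1)} (h : nb u v = nb u v') : v = v' := by
  have := congrArg Fin.val h
  have hu := u.2
  have hv := v.2
  have hv' := v'.2
  unfold nb at this
  split_ifs at this with h1 h2 h2 <;> rw [bad_val] at h1 h2 <;> apply Fin.ext <;>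
    simp only [up] at this <;> omega

theorem TT_inj {n d : ℕ} (hd : 3 ≤ d) {e : Fin n × Fin 2} {u v v' : Fin (d+1)}
    (h : TT e u v = TT e u v') : v = v' := by
  unfold TT at h
  rw [Sym2.congr_right] at h
  simp only [Sum.inr.injEq, Prod.mk.injEq, true_and] at h
  exact nb_inj hd h

theorem TT_swap {n d : ℕ} {e : Fin n × Fin 2} {u v : Fin (d+1)} (h : ¬ bad u v) :
    TT e u v = TT e v u := by
  have h' : ¬ bad v u := fun h' => h (bad_symm h')
  simp only [TT, nb, h, h', if_false]
  exact Sym2.eq_swap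

theorem up_inj {d : ℕ} {u v : Fin (d+1)} (h : up u = up v) : u = v := by
  have := congrArg Fin.val h
  exact Fin.ext this

theorem mem_TT {n d : ℕ} {e e' : Fin n × Fin 2} {u v u' : Fin (d+1)}
    (h : Sum.inr (e', up u') ∈ TT e u v) : e' = e ∧ (u' = u ∨ (u' = v ∧ ¬ bad u v)) := by
  unfold TT at h
  rw [Sym2.mem_iff] at h
  simp only [Sum.inr.injEq, Prod.mk.injEq] at h
  rcases h with ⟨h, h'⟩ | ⟨h, h'⟩
  · exact ⟨h, Or.inl (up_inj h')⟩
  · refine ⟨h, Or.inr ?_⟩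
    unfold nb at h'
    split_ifs at h' with hb
    · have := congrArg Fin.val h'
      have h2 := u'.2
      simp only [up] at this; omega
    · exact ⟨up_inj h', hb⟩

theorem TT_eq {n d : ℕ} (hd : 3 ≤ d) {e e' : Fin n × Fin 2} {u v u' v' : Fin (d+1)}
    (h : TT e u v = TT e' u' v') :
    e = e' ∧ ((u = u' ∧ v = v') ∨ (u ≠ u' ∧ u' = v ∧ v' = u ∧ ¬ bad u u')) := by
  have h1 : Sum.inr (e', up u') ∈ TT e u v := by rw [h]; exact Sym2.mem_mk_left _ _
  have h2 : Sum.inr (e, up u) ∈ TT e' u' v' := by rw [← h]; exact Sym2.mem_mk_left _ _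
  obtain ⟨rfl, h3⟩ := mem_TT h1
  obtain ⟨_, h4⟩ := mem_TT h2
  clear h1 h2
  refine ⟨rfl, ?_⟩
  by_cases huu : u = u'
  · subst huu; exact Or.inl ⟨rfl, TT_inj hd h⟩
  · right
    rcases h3 with h1 | ⟨rfl, h1⟩
    · exact absurd h1.symm huu
    · rcases h4 with h2 | ⟨rfl, h2⟩
      · exact absurd h2 huu
      · exact ⟨huu, rfl, rfl, h1⟩

theorem bad_zl {d : ℕ} : bad (0 : Fin (d+1)) (Fin.last d) := Or.inl ⟨rfl, rfl⟩

theorem common_special {n d : ℕ} (hd : 3 ≤ d) (e : Fin n × Fin 2) (x : Sym2 (VV n d))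
    (hx : x ∈ (sunletIndicator n d).edgeSet)
    (h1 : x ≠ TT e 0 (Fin.last d)) (h2 : x ≠ TT e (Fin.last d) 0)
    (h3 : ∃ v, v ∈ x ∧ v ∈ TT e 0 (Fin.last d)) (h4 : ∃ v, v ∈ x ∧ v ∈ TT e (Fin.last d) 0) :
    x = s(Sum.inr (e, ⟨d + 1, by omega⟩), Sum.inr (e, ⟨d + 2, by omega⟩)) := by
  have hb := bad_zl (d := d)
  have hb' := bad_symm hb
  simp only [TT, nb, hb, hb', if_true, Sym2.mem_iff] at h1 h2 h3 h4
  by_cases hm : Sum.inr (e, (⟨d+1, by omega⟩ : Fin (d+3))) ∈ x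
  · obtain ⟨y, rfl⟩ := hm
    rw [SimpleGraph.mem_edgeSet] at hx
    rcases y with y | ⟨e', l⟩
    · rw [SimpleGraph.adj_comm, adj_od] at hx
      have := hx.1
      simp only [] at this; omega
    · rw [adj_dd] at hx
      obtain ⟨rfl, h5, h6⟩ := hx
      unfold indicatorInternalRel dragonRel at h6
      simp only [] at h5 h6
      have h7 : l.val = d + 2 ∨ l.val = 0 ∨ l.val = d := by omega
      rcases h7 with h7 | h7 | h7
      · congr; exact Fin.ext h7
      · exfalso; apply h1; rw [Sym2.eq_swap]
        have : l = up 0 := Fin.ext h7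
        rw [this]
      · exfalso; apply h2; rw [Sym2.eq_swap]
        have : l = up (Fin.last d) := Fin.ext h7
        rw [this]
  · exfalso
    have m1 : Sum.inr (e, up 0) ∈ x := by
      obtain ⟨v, hv, rfl | rfl⟩ := h3
      · exact hv
      · exact absurd hv hm
    have m2 : Sum.inr (e, up (Fin.last d)) ∈ x := by
      obtain ⟨v, hv, rfl | rfl⟩ := h4
      · exact hv
      · exact absurd hv hm
    obtain ⟨v, hv, rfl⟩ := TT_of_mem hd e 0 x hx m1
    obtain ⟨_, h5 | ⟨h5, h6⟩⟩ := mem_TT m2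
    · have := congrArg Fin.val h5; simp at this; omega
    · subst h5; exact h6 hb

/-- vertices with more than three neighbours are dragon vertices -/
theorem few_nbrs {n d : ℕ} (w : VV n d)
    (hw : ∀ (e : Fin n × Fin 2) (u : Fin (d+1)), w ≠ Sum.inr (e, up u)) :
    ∃ a b c, ∀ y, (sunletIndicator n d).Adj w y → y = a ∨ y = b ∨ y = c := by
  rcases w with x | ⟨e, k⟩
  · by_cases hp : ∃ i : Fin n, ∃ j : Fin n, x = Sum.inl i ∧ i.val = (j.val + 1) % n
    · obtain ⟨i, j, rfl, hj⟩ := hp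
      refine ⟨Sum.inr ((i,0), ⟨d+2, by omega⟩), Sum.inr ((i,1), ⟨d+2, by omega⟩),
        Sum.inr ((j,0), ⟨d+2, by omega⟩), ?_⟩
      rintro (y | ⟨⟨e, c⟩, l⟩) hy
      · exact absurd hy (adj_oo _ _)
      · rw [adj_od] at hy
        obtain ⟨hl, h⟩ := hy
        have : l = ⟨d+2, Nat.lt_succ_self _⟩ := Fin.ext hl
        subst this
        rcases h with h | ⟨h, j', hj', h'⟩ | ⟨h, h'⟩
        · obtain rfl := Sum.inl.inj h
          fin_cases c <;> simp
        · obtain rfl := Sum.inl.inj h'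
          have : c = 0 := Fin.ext h
          subst this
          have := succ_inj_mod j e (hj.symm.trans hj')
          simp [this]
        · cases h'
    · rcases x with i | i
      · refine ⟨Sum.inr ((i,0), ⟨d+2, by omega⟩), Sum.inr ((i,1), ⟨d+2, by omega⟩),
          Sum.inr ((i,0), ⟨d+2, by omega⟩), ?_⟩
        rintro (y | ⟨⟨e, c⟩, l⟩) hy
        · exact absurd hy (adj_oo _ _)
        · rw [adj_od] at hy
          obtain ⟨hl, h⟩ := hy
          have : l = ⟨d+2, Nat.lt_succ_self _⟩ := Fin.ext hl
          subst this
          rcases h with h | ⟨h, j', hj', h'⟩ | ⟨h, h'⟩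
          · obtain rfl := Sum.inl.inj h
            fin_cases c <;> simp
          · obtain rfl := Sum.inl.inj h'
            exact absurd ⟨i, e, rfl, hj'⟩ hp
          · cases h'
      · refine ⟨Sum.inr ((i,1), ⟨d+2, by omega⟩), Sum.inr ((i,1), ⟨d+2, by omega⟩),
          Sum.inr ((i,1), ⟨d+2, by omega⟩), ?_⟩
        rintro (y | ⟨⟨e, c⟩, l⟩) hy
        · exact absurd hy (adj_oo _ _)
        · rw [adj_od] at hy
          obtain ⟨hl, h⟩ := hy
          have : l = ⟨d+2, Nat.lt_succ_self _⟩ := Fin.ext hl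
          subst this
          rcases h with h | ⟨h, j', hj', h'⟩ | ⟨h, h'⟩
          · cases h
          · cases h'
          · obtain rfl := Sum.inr.inj h'
            have : c = 1 := Fin.ext h
            subst this
            simp
  · have hk : d + 1 ≤ k.val := by
      by_contra hk
      exact hw e ⟨k.val, by omega⟩ rfl
    have hk2 := k.2
    by_cases hk1 : k.val = d + 1
    · refine ⟨Sum.inr (e, ⟨0, by omega⟩), Sum.inr (e, ⟨d, by omega⟩),
          Sum.inr (e, ⟨d+2, by omega⟩), ?_⟩
      rintro (y | ⟨e', l⟩) hy
      · rw [SimpleGraph.adj_comm, adj_od] at hy; omega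
      · rw [adj_dd] at hy
        obtain ⟨rfl, h1, h2⟩ := hy
        unfold indicatorInternalRel dragonRel at h2
        simp only [Sum.inr.injEq, Prod.mk.injEq, true_and, Fin.ext_iff]
        omega
    · obtain ⟨i, c⟩ := e
      refine ⟨Sum.inr ((i, c), ⟨d+1, by omega⟩), Sum.inl (Sum.inl i),
        Sum.inl (if c.val = 0 then Sum.inl ⟨(i.val + 1) % n, Nat.mod_lt _ i.pos⟩ else Sum.inr i), ?_⟩
      rintro (y | ⟨e', l⟩) hy
      · rw [SimpleGraph.adj_comm, adj_od] at hy
        rcases hy.2 with h | ⟨h, j', hj', h'⟩ | ⟨h, h'⟩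
        · subst h; simp
        · subst h'
          right; right
          simp only [] at h hj'
          rw [if_pos h]; congr; exact Fin.ext hj'
        · subst h'
          right; right
          simp only [] at h
          rw [if_neg (by omega)]
      · rw [adj_dd] at hy
        obtain ⟨rfl, h1, h2⟩ := hy
        unfold indicatorInternalRel dragonRel at h2
        simp only [Sum.inr.injEq, Prod.mk.injEq, true_and, Fin.ext_iff]
        omega

theorem exists_fresh {d : ℕ} (hd : 4 ≤ d) (u i j k : Fin (d+1)) :
    ∃ l, u ≠ l ∧ l ≠ i ∧ l ≠ j ∧ l ≠ k := by
  have h : ({u, i, j, k} : Finset (Fin (d+1))).card < (Finset.univ : Finset (Fin (d+1))).card := by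
    have := Finset.card_le_four (a := u) (b := i) (c := j) (d := k)
    rw [Finset.card_univ, Fintype.card_fin]; omega
  obtain ⟨l, _, hl⟩ := Finset.exists_mem_notMem_of_card_lt_card h
  simp only [Finset.mem_insert, Finset.mem_singleton, not_or] at hl
  exact ⟨l, fun h => hl.1 h.symm, hl.2⟩

theorem clique_star {V ι : Type*} (P : ι → Prop) (g : ι → Sym2 V)
    (hf : ∀ i j k, ∃ l, P l ∧ l ≠ i ∧ l ≠ j ∧ l ≠ k)
    (hne : ∀ i j, P i → P j → i ≠ j → g i ≠ g j)
    (hi : ∀ i j, P i → P j → i ≠ j → ∃ v, v ∈ g i ∧ v ∈ g j)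
    (i₀ : ι) : ∃ w, ∀ i, P i → w ∈ g i := by
  obtain ⟨i, pi, -⟩ := hf i₀ i₀ i₀
  obtain ⟨j, pj, hij, -⟩ := hf i i i
  obtain ⟨a, hai, haj⟩ := hi i j pi pj hij.symm
  refine ⟨a, ?_⟩
  by_contra hcon
  push Not at hcon
  obtain ⟨k, pk, hak⟩ := hcon
  obtain ⟨l, pl, h1, h2, h3⟩ := hf i j k
  have hki : k ≠ i := by rintro rfl; exact hak hai
  have hkj : k ≠ j := by rintro rfl; exact hak haj
  have n1 := hne _ _ pi pj hij.symm
  have n2 := hne _ _ pl pi h1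
  have n3 := hne _ _ pl pj h2
  have n4 := hne _ _ pl pk h3
  obtain ⟨x1, hx1, hx1'⟩ := hi _ _ pl pi h1
  obtain ⟨x2, hx2, hx2'⟩ := hi _ _ pl pj h2
  obtain ⟨x3, hx3, hx3'⟩ := hi _ _ pl pk h3
  obtain ⟨x4, hx4, hx4'⟩ := hi _ _ pk pi hki
  obtain ⟨x5, hx5, hx5'⟩ := hi _ _ pk pj hkj
  obtain ⟨b, hb⟩ := hai
  obtain ⟨c, hc⟩ := haj
  rw [hb] at hx1' hx4' n1 n2
  rw [hc] at hx2' hx5' n1 n3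
  have hbc : b ≠ c := by rintro rfl; exact n1 rfl
  rw [Sym2.mem_iff] at hx4' hx5' hx1' hx2'
  have e4 : x4 = b := by
    rcases hx4' with rfl | h
    · exact absurd hx4 hak
    · exact h
  have e5 : x5 = c := by
    rcases hx5' with rfl | h
    · exact absurd hx5 hak
    · exact h
  subst e4 e5
  have e6 : g k = s(x4, x5) := ((Sym2.mem_and_mem_iff hbc).1 ⟨hx4, hx5⟩)
  rw [e6] at hx3' hak n4
  rw [Sym2.mem_iff] at hx3' hak
  push Not at hak
  have q1 : ¬ (a ∈ g l ∧ x4 ∈ g l) := fun h => n2 ((Sym2.mem_and_mem_iff hak.1).1 h)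
  have q2 : ¬ (a ∈ g l ∧ x5 ∈ g l) := fun h => n3 ((Sym2.mem_and_mem_iff hak.2).1 h)
  have q3 : ¬ (x4 ∈ g l ∧ x5 ∈ g l) := fun h => n4 ((Sym2.mem_and_mem_iff hbc).1 h)
  rcases hx1' with rfl | rfl <;> rcases hx2' with rfl | rfl <;> rcases hx3' with rfl | rfl <;> tauto

theorem star_image {n' d : ℕ} (hd : 4 ≤ d) (u : Fin (d+1)) (g : Fin (d+1) → Sym2 (VV n' d))
    (hg : ∀ v, u ≠ v → g v ∈ (sunletIndicator n' d).edgeSet)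
    (hadj : ∀ i j, u ≠ i → u ≠ j → i ≠ j → g i ≠ g j ∧ ∃ v, v ∈ g i ∧ v ∈ g j) :
    ∃ (e' : Fin n' × Fin 2) (p : Fin (d+1)) (q : Fin (d+1) → Fin (d+1)),
      ∀ v, u ≠ v → p ≠ q v ∧ g v = TT e' p (q v) := by
  obtain ⟨w, hw⟩ := clique_star (fun v => u ≠ v) g (exists_fresh hd u)
    (fun i j a b c => (hadj i j a b c).1) (fun i j a b c => (hadj i j a b c).2) u
  by_cases hp : ∃ (e : Fin n' × Fin 2) (p : Fin (d+1)), w = Sum.inr (e, up p)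
  · obtain ⟨e, p, rfl⟩ := hp
    have : ∀ v, ∃ q, u ≠ v → p ≠ q ∧ g v = TT e p q := by
      intro v
      by_cases h : u = v
      · exact ⟨u, fun h' => absurd h h'⟩
      · obtain ⟨q, hq⟩ := TT_of_mem (by omega) e p (g v) (hg v h) (hw v h)
        exact ⟨q, fun _ => hq⟩
    choose q hq using this
    exact ⟨e, p, q, hq⟩
  · exfalso
    push Not at hp
    obtain ⟨a, b, c, habc⟩ := few_nbrs w hp
    have key : ∀ v, u ≠ v → g v = s(w, a) ∨ g v = s(w, b) ∨ g v = s(w, c) := by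
      intro v hv
      obtain ⟨y, hy⟩ := hw v hv
      have := hg v hv
      rw [hy, SimpleGraph.mem_edgeSet] at this
      rw [hy]
      rcases habc y this with rfl | rfl | rfl <;> simp
    obtain ⟨v1, p1, -⟩ := exists_fresh hd u u u u
    obtain ⟨v2, p2, h21, -⟩ := exists_fresh hd u v1 v1 v1
    obtain ⟨v3, p3, h31, h32, -⟩ := exists_fresh hd u v1 v2 v2
    obtain ⟨v4, p4, h41, h42, h43⟩ := exists_fresh hd u v1 v2 v3
    have a1 := (hadj _ _ p2 p1 h21).1
    have a2 := (hadj _ _ p3 p1 h31).1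
    have a3 := (hadj _ _ p3 p2 h32).1
    have a4 := (hadj _ _ p4 p1 h41).1
    have a5 := (hadj _ _ p4 p2 h42).1
    have a6 := (hadj _ _ p4 p3 h43).1
    have k1 := key _ p1
    have k2 := key _ p2
    have k3 := key _ p3
    have k4 := key _ p4
    generalize g v1 = g1 at *
    generalize g v2 = g2 at *
    generalize g v3 = g3 at *
    generalize g v4 = g4 at *
    clear hw key habc hadj hg
    rcases k1 with rfl | rfl | rfl <;> rcases k2 with rfl | rfl | rfl <;>
      first
      | exact a1 rfl
      | (rcases k3 with rfl | rfl | rfl <;>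
          first
          | exact a2 rfl
          | exact a3 rfl
          | (rcases k4 with h | h | h <;> first | exact a4 h | exact a5 h | exact a6 h))

theorem case_big (d n n' : ℕ) (hd : 4 ≤ d)
    (f : (sunletIndicator n d).lineGraph →g (sunletIndicator n' d).lineGraph)
    (x : (sunletIndicator n d).edgeSet) (hx : IsSpecialNode n d x) :
    IsSpecialNode n' d (f x) := by
  have hd3 : 3 ≤ d := by omega
  obtain ⟨e, hx⟩ := hx
  have hadj : ∀ y z : (sunletIndicator n d).edgeSet, y.1 ≠ z.1 → (∃ v, v ∈ y.1 ∧ v ∈ z.1) →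
      (f y).1 ≠ (f z).1 ∧ ∃ v, v ∈ (f y).1 ∧ v ∈ (f z).1 := by
    intro y z h1 h2
    have : (sunletIndicator n d).lineGraph.Adj y z := by
      rw [lineGraph_adj_iff_exists]
      exact ⟨fun h => h1 (congrArg _ h), h2⟩
    have := f.map_adj this
    rw [lineGraph_adj_iff_exists] at this
    exact ⟨fun h => this.1 (Subtype.ext h), this.2⟩
  let F : Fin (d+1) → Fin (d+1) → Sym2 (VV n' d) := fun u v =>
    if h : u ≠ v then (f ⟨TT e u v, TT_adj hd3 e u v h⟩).1 else (f x).1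
  have hF : ∀ u v (h : u ≠ v), F u v = (f ⟨TT e u v, TT_adj hd3 e u v h⟩).1 := by
    intro u v h; simp only [F]; rw [dif_pos h]
  have hst : ∀ u, ∃ (e' : Fin n' × Fin 2) (p : Fin (d+1)) (q : Fin (d+1) → Fin (d+1)),
      ∀ v, u ≠ v → p ≠ q v ∧ F u v = TT e' p (q v) := by
    intro u
    apply star_image hd
    · intro v h; rw [hF u v h]; exact Subtype.coe_prop _
    · intro i j hi hj hij
      rw [hF _ _ hi, hF _ _ hj]
      apply hadj
      · exact fun h => hij (TT_inj hd3 h)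
      · exact ⟨_, Sym2.mem_mk_left _ _, Sym2.mem_mk_left _ _⟩
  choose E p q hpq using hst
  have hqi : ∀ u v v', u ≠ v → u ≠ v' → q u v = q u v' → v = v' := by
    intro u v v' h h' hq
    by_contra hvv
    have := hadj ⟨TT e u v, TT_adj hd3 e u v h⟩ ⟨TT e u v', TT_adj hd3 e u v' h'⟩
      (fun h => hvv (TT_inj hd3 h)) ⟨_, Sym2.mem_mk_left _ _, Sym2.mem_mk_left _ _⟩
    apply this.1
    rw [← hF _ _ h, ← hF _ _ h', (hpq u v h).2, (hpq u v' h').2, hq]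
  have hsw : ∀ u v, u ≠ v → ¬ bad u v → E u = E v ∧ ((p u = p v ∧ q u v = q v u) ∨
      (p u ≠ p v ∧ p v = q u v ∧ q v u = p u ∧ ¬ bad (p u) (p v))) := by
    intro u v h hb
    apply TT_eq hd3
    rw [← (hpq u v h).2, ← (hpq v u h.symm).2, hF u v h, hF v u h.symm]
    exact congrArg (fun y => (f y).1) (Subtype.ext (TT_swap hb))
  have z0 : (0 : Fin (d+1)).val = 0 := rfl
  have zl : (Fin.last d).val = d := rfl
  obtain ⟨one, hone⟩ : ∃ i : Fin (d+1), i.val = 1 := ⟨⟨1, by omega⟩, rfl⟩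
  obtain ⟨two, htwo⟩ : ∃ i : Fin (d+1), i.val = 2 := ⟨⟨2, by omega⟩, rfl⟩
  have b1 : ∀ u, ¬ bad u one := by intro u; rw [bad_val]; omega
  have b2 : ∀ u, ¬ bad u two := by intro u; rw [bad_val]; omega
  have h12 : one ≠ two := by intro h; rw [h] at hone; omega
  have hE : ∀ u, E u = E one := by
    intro u
    by_cases h : u = one
    · rw [h]
    · exact (hsw u one h (b1 u)).1
  have hlt : (0 : Fin (d+1)) ≠ Fin.last d := by
    intro h; have := congrArg Fin.val h; simp only [zl, z0] at this; omega
  have hK : ∀ u v z, u ≠ v → u ≠ z → v ≠ z → ¬ bad u z → ¬ bad v z → p u = p v → p z = p u := by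
    intro u v z h1 h2 h3 h4 h5 h6
    rcases (hsw u z h2 h4).2 with h | h
    · exact h.1.symm
    · rcases (hsw v z h3 h5).2 with h' | h'
      · rw [h6]; exact h'.1.symm
      · exfalso
        apply h1
        apply hqi z u v h2.symm h3.symm
        rw [h.2.2.1, h'.2.2.1, h6]
  have hm0 : TT (n := n) e 0 (Fin.last d) ≠ TT e (Fin.last d) 0 := by
    intro h
    rcases (TT_eq hd3 h).2 with h | h
    · exact hlt h.1
    · exact h.2.2.2 bad_zl
  have hm1 : (Sum.inr (e, ⟨d+1, by omega⟩) : VV n d) ∈ TT e 0 (Fin.last d) := by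
    simp [TT, nb, bad_zl]
  have hm2 : (Sum.inr (e, ⟨d+1, by omega⟩) : VV n d) ∈ TT e (Fin.last d) 0 := by
    simp [TT, nb, bad_symm bad_zl]
  have hm3 : (Sum.inr (e, ⟨d+1, by omega⟩) : VV n d) ∈ x.1 := by
    rw [hx]; exact Sym2.mem_mk_left _ _
  have hF0 : F 0 (Fin.last d) ≠ F (Fin.last d) 0 := by
    rw [hF _ _ hlt, hF _ _ hlt.symm]
    exact (hadj ⟨TT e 0 (Fin.last d), TT_adj hd3 e _ _ hlt⟩
      ⟨TT e (Fin.last d) 0, TT_adj hd3 e _ _ hlt.symm⟩ hm0 ⟨_, hm1, hm2⟩).1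
  have hx1 : ∀ u v, x.1 ≠ TT e u v := by
    intro u v h
    have : Sum.inr (e, up u) ∈ x.1 := by rw [h]; exact Sym2.mem_mk_left _ _
    rw [hx, Sym2.mem_iff] at this
    simp only [Sum.inr.injEq, Prod.mk.injEq, true_and, up, Fin.mk.injEq] at this
    have := u.2
    omega
  have hy1 := hadj x ⟨TT e 0 (Fin.last d), TT_adj hd3 e _ _ hlt⟩ (hx1 _ _) ⟨_, hm3, hm1⟩
  have hy2 := hadj x ⟨TT e (Fin.last d) 0, TT_adj hd3 e _ _ hlt.symm⟩ (hx1 _ _) ⟨_, hm3, hm2⟩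
  rw [← hF _ _ hlt] at hy1
  rw [← hF _ _ hlt.symm] at hy2
  rw [(hpq _ _ hlt).2, (hpq _ _ hlt.symm).2, hE 0, hE (Fin.last d)] at hF0
  rw [(hpq _ _ hlt).2, hE 0] at hy1
  rw [(hpq _ _ hlt.symm).2, hE (Fin.last d)] at hy2
  by_cases hc : p one = p two
  · exfalso
    have hconst : ∀ u, p u = p one := by
      intro u
      by_cases h1 : u = one
      · rw [h1]
      · by_cases h2 : u = two
        · rw [h2, hc]
        · exact hK one two u h12 (Ne.symm h1) (Ne.symm h2) (fun h => b1 _ (bad_symm h))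
            (fun h => b2 _ (bad_symm h)) hc
    apply parity_aux d hd3 (p one) q
    · intro u v h; have := (hpq u v h).1; rw [hconst u] at this; exact this.symm
    · exact hqi
    · intro u v h h1 h2
      have hb : ¬ bad u v := by rintro (h | h) <;> tauto
      rcases (hsw u v h hb).2 with h | h
      · exact h.2
      · exact absurd ((hconst u).trans (hconst v).symm) h.1
    · intro h
      apply hF0
      rw [h, hconst, hconst (Fin.last d)]
  · have hnb : ∀ u v, u ≠ v → ¬ bad u v → p u ≠ p v := by
      intro u v h hb hp
      apply hc
      have k1 : p one = p u := by
        by_cases h1 : one = u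
        · rw [h1]
        · by_cases h2 : one = v
          · rw [h2, hp]
          · exact hK u v one h (Ne.symm h1) (Ne.symm h2) (b1 _) (b1 _) hp
      have k2 : p two = p u := by
        by_cases h1 : two = u
        · rw [h1]
        · by_cases h2 : two = v
          · rw [h2, hp]
          · exact hK u v two h (Ne.symm h1) (Ne.symm h2) (b2 _) (b2 _) hp
      rw [k1, k2]
    have hq : ∀ u v, u ≠ v → ¬ bad u v → q u v = p v ∧ ¬ bad (p u) (p v) := by
      intro u v h hb
      rcases (hsw u v h hb).2 with h' | h'
      · exact absurd h'.1 (hnb u v h hb)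
      · exact ⟨h'.2.1.symm, h'.2.2.2⟩
    have h01 : one ≠ 0 := by intro h; rw [h] at hone; omega
    have hl1 : one ≠ Fin.last d := by intro h; rw [h] at hone; omega
    have hp0l : p 0 ≠ p (Fin.last d) := by
      intro h
      apply hlt
      apply hqi one _ _ h01 hl1
      rw [(hq one 0 h01 (fun h => b1 _ (bad_symm h))).1,
        (hq one _ hl1 (fun h => b1 _ (bad_symm h))).1, h]
    have hinj : Function.Injective p := by
      intro u v h
      by_contra huv
      by_cases hb : bad u v
      · rcases hb with ⟨rfl, rfl⟩ | ⟨rfl, rfl⟩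
        · exact hp0l h
        · exact hp0l h.symm
      · exact hnb u v huv hb h
    have hsur : Function.Surjective p := Finite.surjective_of_injective hinj
    obtain ⟨s, hs⟩ := hsur 0
    obtain ⟨t, ht⟩ := hsur (Fin.last d)
    have hst : s ≠ t := by rintro rfl; exact hlt (hs.symm.trans ht)
    have hb : bad s t := by
      by_contra hb
      apply (hq s t hst hb).2
      rw [hs, ht]; exact bad_zl
    have hqq : ∀ u w, bad u w → u ≠ w → q u w = p w := by
      intro u w hb huw
      obtain ⟨v, hv⟩ := hsur (q u w)
      by_cases hvw : v = w
      · rw [← hv, hvw]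
      · exfalso
        have hvu : u ≠ v := by
          rintro rfl
          exact (hpq u w huw).1 hv
        have hbv : ¬ bad u v := by
          intro h
          apply hvw
          rcases h with ⟨h, h'⟩ | ⟨h, h'⟩ <;> rcases hb with ⟨g, g'⟩ | ⟨g, g'⟩
          · rw [h', g']
          · exact absurd (h.symm.trans g) hlt
          · exact absurd (g.symm.trans h) hlt
          · rw [h', g']
        apply hvw
        apply hqi u v w hvu huw
        rw [(hq u v hvu hbv).1, hv]
    rw [hqq _ _ bad_zl hlt] at hy1
    rw [hqq _ _ (bad_symm bad_zl) hlt.symm] at hy2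
    refine ⟨E one, ?_⟩
    rcases hb with ⟨rfl, rfl⟩ | ⟨rfl, rfl⟩
    · rw [hs, ht] at hy1 hy2
      exact common_special hd3 _ _ (Subtype.coe_prop _) hy1.1 hy2.1 hy1.2 hy2.2
    · rw [hs, ht] at hy1 hy2
      exact common_special hd3 _ _ (Subtype.coe_prop _) hy2.1 hy1.1 hy2.2 hy1.2

/-- **Special nodes map to special nodes.** For `d, n, n' ≥ 3`, every graph
homomorphism `L(G_{n,d}) → L(G_{n',d})` maps special nodes to special nodes. -/
theorem hom_maps_special_to_special (d n n' : ℕ)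
    (hd : 3 ≤ d) (hn : 3 ≤ n) (hn' : 3 ≤ n')
    (f : (sunletIndicator n d).lineGraph →g (sunletIndicator n' d).lineGraph)
    (x : (sunletIndicator n d).edgeSet) (hx : IsSpecialNode n d x) :
    IsSpecialNode n' d (f x) := by
  rcases Nat.lt_or_ge 3 d with h | h
  · exact case_big d n n' h f x hx
  · obtain rfl : d = 3 := by omega
    exact case_three n n' f x hx
end

section
/- For every d ≥ 3, n ≥ 3 and n' ≥ 3, every graph homomorphism f: L(G_{n,d}) → L(G_{n',d}) maps connecting triangles to connecting triangles, where a connecting triangle of L(G_{n,d}) is a triangle whose three vertices correspond to the three edges of G_{n,d} incident to a common vertex that was a cycle vertex (degree-3 vertex) of the original sunlet S_n. -/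
open SimpleGraph

/-- The connecting triangle of `L(G_{n,d})` at the cycle vertex `i` of the original
sunlet: the set of vertices of the line graph corresponding to the three edges of
`G_{n,d}` incident to that (degree-3) vertex. -/
def connTriangle (n d : ℕ) (i : Fin n) : Set (sunletIndicator n d).edgeSet :=
  {x | Sum.inl (Sum.inl i) ∈
    (x : Sym2 ((Fin n ⊕ Fin n) ⊕ ((Fin n × Fin 2) × Fin (d + 3))))}

def IA (d k l : ℕ) : Prop :=
  (k ≤ d ∧ l ≤ d ∧ k ≠ l ∧ ¬(k = 0 ∧ l = d) ∧ ¬(k = d ∧ l = 0)) ∨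
  (k = d + 1 ∧ (l = 0 ∨ l = d)) ∨ (l = d + 1 ∧ (k = 0 ∨ k = d)) ∨
  (k = d + 2 ∧ l = d + 1) ∨ (k = d + 1 ∧ l = d + 2)

theorem adj_rr {n d : ℕ} (e e' : Fin n × Fin 2) (k l : Fin (d + 3)) :
    (sunletIndicator n d).Adj (Sum.inr (e, k)) (Sum.inr (e', l)) ↔ e = e' ∧ IA d k l := by
  simp only [sunletIndicator, SimpleGraph.fromRel_adj, indicatorInternalRel, dragonRel, IA, ne_eq,
    Sum.inr.injEq, Prod.mk.injEq, Fin.ext_iff (a := k)]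
  constructor
  · rintro ⟨h, ⟨rfl, h2⟩ | ⟨rfl, h2⟩⟩
    · simp only [true_and] at h ⊢; omega
    · simp only [true_and] at h ⊢; omega
  · rintro ⟨rfl, h⟩
    simp only [true_and]; omega

def LR {n : ℕ} (x : Fin n ⊕ Fin n) (e : Fin n × Fin 2) : Prop :=
  (x = Sum.inl e.1 ∨
         (e.2.val = 0 ∧ ∃ j : Fin n, j.val = (e.1.val + 1) % n ∧ x = Sum.inl j) ∨
         (e.2.val = 1 ∧ x = Sum.inr e.1))

theorem adj_lr {n d : ℕ} (x : Fin n ⊕ Fin n) (e : Fin n × Fin 2) (k : Fin (d + 3)) :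
    (sunletIndicator n d).Adj (Sum.inl x) (Sum.inr (e, k)) ↔ k.val = d + 2 ∧ LR x e := by
  simp [sunletIndicator, SimpleGraph.fromRel_adj, LR]

theorem adj_rl {n d : ℕ} (x : Fin n ⊕ Fin n) (e : Fin n × Fin 2) (k : Fin (d + 3)) :
    (sunletIndicator n d).Adj (Sum.inr (e, k)) (Sum.inl x) ↔ k.val = d + 2 ∧ LR x e := by
  rw [SimpleGraph.adj_comm, adj_lr]

theorem adj_ll {n d : ℕ} (x y : Fin n ⊕ Fin n) :
    ¬ (sunletIndicator n d).Adj (Sum.inl x) (Sum.inl y) := by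
  simp [sunletIndicator, SimpleGraph.fromRel_adj]

/-- at most two sunlet vertices around an indicator -/
theorem LR_two {n : ℕ} (e : Fin n × Fin 2) : ∃ a b, ∀ x, LR x e → x = a ∨ x = b := by
  obtain ⟨i, t⟩ := e
  have hi := i.2
  have hm : (i.val + 1) % n < n := Nat.mod_lt _ (by omega)
  refine ⟨Sum.inl i, if t.val = 0 then Sum.inl ⟨_, hm⟩ else Sum.inr i, ?_⟩
  rintro x (h | ⟨h, j, hj, rfl⟩ | ⟨h, rfl⟩)
  · exact Or.inl h
  · right; simp only at h hj; simp [h, Fin.ext_iff, hj]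
  · right; simp only at h; simp [h]

theorem succ_mod_inj {n a b : ℕ} (ha : a < n) (hb : b < n) (h : (a + 1) % n = (b + 1) % n) :
    a = b := by
  rcases Nat.lt_or_ge (a + 1) n with h1 | h1 <;> rcases Nat.lt_or_ge (b + 1) n with h2 | h2
  · rw [Nat.mod_eq_of_lt h1, Nat.mod_eq_of_lt h2] at h; omega
  · have : b + 1 = n := by omega
    rw [Nat.mod_eq_of_lt h1, this, Nat.mod_self] at h; omega
  · have : a + 1 = n := by omega
    rw [Nat.mod_eq_of_lt h2, this, Nat.mod_self] at h; omega
  · omega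

theorem LR_three {n : ℕ} (i : Fin n) : ∃ a b c : Fin n × Fin 2, a ≠ b ∧ (2 ≤ n → a ≠ c) ∧ b ≠ c ∧
    ∀ e, LR (Sum.inl i) e ↔ e = a ∨ e = b ∨ e = c := by
  have hi := i.2
  obtain ⟨j, hj⟩ : ∃ j : Fin n, i.val = (j.val + 1) % n := by
    rcases Nat.eq_zero_or_pos i.val with h | h
    · refine ⟨⟨n - 1, by omega⟩, ?_⟩
      have : n - 1 + 1 = n := by omega
      simp [this, h]
    · refine ⟨⟨i.val - 1, by omega⟩, ?_⟩
      have : i.val - 1 + 1 = i.val := by omega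
      simp only [this]
      rw [Nat.mod_eq_of_lt hi]
  refine ⟨(i, 0), (i, 1), (j, 0), by simp, ?_, by simp, ?_⟩
  · intro h2 h
    simp only [Prod.mk.injEq, and_true] at h
    subst h
    rcases Nat.lt_or_ge (i.val + 1) n with h1 | h1
    · rw [Nat.mod_eq_of_lt h1] at hj; omega
    · have : i.val + 1 = n := by omega
      rw [this, Nat.mod_self] at hj; omega
  · rintro ⟨k, t⟩
    constructor
    · rintro (h | ⟨h, l, hl, h3⟩ | ⟨h, h3⟩)
      · simp only [Sum.inl.injEq] at h; subst h
        fin_cases t <;> simp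
      · simp only [Sum.inl.injEq] at h3 h hl; subst h3
        right; right
        simp only [Prod.mk.injEq, Fin.ext_iff, h]
        refine ⟨succ_mod_inj k.2 j.2 (by omega), rfl⟩
      · cases h3
    · rintro (h | h | h) <;> cases h
      · left; rfl
      · left; rfl
      · right; left; exact ⟨rfl, i, hj, rfl⟩

theorem LR_pend {n : ℕ} (i : Fin n) (e) (h : LR (Sum.inr i) e) : e = (i, 1) := by
  obtain ⟨k, t⟩ := e
  rcases h with h | ⟨_, j, _, h⟩ | ⟨h, h3⟩
  · cases h
  · cases h
  · simp only [Sum.inr.injEq] at h h3; subst h3; simp [Fin.ext_iff, h]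

/-- non-core vertices (or all vertices if `d = 3`) have at most three neighbours -/
theorem nbr_three {n d : ℕ} (v : VV n d)
    (hv : d = 3 ∨ ∀ e k, v = Sum.inr (e, k) → d < k.val) :
    ∃ a b c, ∀ y, (sunletIndicator n d).Adj v y → y = a ∨ y = b ∨ y = c := by
  rcases v with (i | i) | ⟨e, k⟩
  · obtain ⟨a, b, c, -, -, -, h⟩ := LR_three i
    refine ⟨Sum.inr (a, Fin.last _), Sum.inr (b, Fin.last _), Sum.inr (c, Fin.last _), ?_⟩
    rintro (y | ⟨e, k⟩) hy
    · exact absurd hy (adj_ll _ _)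
    · rw [adj_lr, h] at hy
      obtain ⟨hk, hy⟩ := hy
      have : k = Fin.last _ := Fin.ext (by simpa using hk)
      subst this
      simpa using hy
  · refine ⟨Sum.inr ((i, 1), Fin.last _), Sum.inr ((i, 1), Fin.last _),
      Sum.inr ((i, 1), Fin.last _), ?_⟩
    rintro (y | ⟨e, k⟩) hy
    · exact absurd hy (adj_ll _ _)
    · rw [adj_lr] at hy
      obtain ⟨hk, hy⟩ := hy
      have : k = Fin.last _ := Fin.ext (by simpa using hk)
      subst this
      have := LR_pend i e hy
      subst this
      simp
  · by_cases hk : k.val = d + 2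
    · obtain ⟨a, b, h⟩ := LR_two e
      refine ⟨Sum.inl a, Sum.inl b, Sum.inr (e, ⟨d + 1, by omega⟩), ?_⟩
      rintro (y | ⟨e', l⟩) hy
      · rw [adj_rl] at hy
        rcases h _ hy.2 with rfl | rfl <;> simp
      · rw [adj_rr] at hy
        obtain ⟨rfl, h⟩ := hy
        simp only [IA] at h
        right; right
        simp only [Sum.inr.injEq, Prod.mk.injEq, Fin.ext_iff, true_and]
        omega
    · have key : ∃ p q r : Fin (d + 3), ∀ l : Fin (d + 3), IA d k l → l = p ∨ l = q ∨ l = r := by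
        by_cases hk' : k.val = d + 1
        · refine ⟨⟨0, by omega⟩, ⟨d, by omega⟩, ⟨d + 2, by omega⟩, fun l hl => ?_⟩
          simp only [IA] at hl
          simp only [Fin.ext_iff]; omega
        · have : d = 3 := by
            rcases hv with h | h
            · exact h
            · have := h _ _ rfl; omega
          subst this
          have hk4 : k.val ≤ 3 := by omega
          rcases (show k.val = 0 ∨ k.val = 1 ∨ k.val = 2 ∨ k.val = 3 by omega) with h | h | h | h
          · refine ⟨1, 2, 4, fun l hl => ?_⟩
            unfold IA at hl
            rw [Fin.ext_iff, Fin.ext_iff, Fin.ext_iff]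
            change l.val = 1 ∨ l.val = 2 ∨ l.val = 4
            omega
          · refine ⟨0, 2, 3, fun l hl => ?_⟩
            unfold IA at hl
            rw [Fin.ext_iff, Fin.ext_iff, Fin.ext_iff]
            change l.val = 0 ∨ l.val = 2 ∨ l.val = 3
            omega
          · refine ⟨0, 1, 3, fun l hl => ?_⟩
            unfold IA at hl
            rw [Fin.ext_iff, Fin.ext_iff, Fin.ext_iff]
            change l.val = 0 ∨ l.val = 1 ∨ l.val = 3
            omega
          · refine ⟨1, 2, 4, fun l hl => ?_⟩
            unfold IA at hl
            rw [Fin.ext_iff, Fin.ext_iff, Fin.ext_iff]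
            change l.val = 1 ∨ l.val = 2 ∨ l.val = 4
            omega
      obtain ⟨p, q, r, h⟩ := key
      refine ⟨Sum.inr (e, p), Sum.inr (e, q), Sum.inr (e, r), ?_⟩
      rintro (y | ⟨e', l⟩) hy
      · rw [adj_rl] at hy; omega
      · rw [adj_rr] at hy
        obtain ⟨rfl, hy⟩ := hy
        rcases h l hy with rfl | rfl | rfl <;> simp

/-- line-graph adjacency on unordered pairs -/
def LA {V : Type*} (a b : Sym2 V) : Prop := a ≠ b ∧ ∃ v, v ∈ a ∧ v ∈ b

theorem LA.symm {V : Type*} {a b : Sym2 V} (h : LA a b) : LA b a :=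
  ⟨h.1.symm, h.2.imp fun _ h => h.symm⟩

theorem LA_form {V : Type*} {a b : Sym2 V} (h : LA a b) :
    ∃ v p q, p ≠ q ∧ a = s(v, p) ∧ b = s(v, q) := by
  obtain ⟨h1, v, ⟨p, rfl⟩, ⟨q, rfl⟩⟩ := h
  exact ⟨v, p, q, fun h => h1 (by rw [h]), rfl, rfl⟩

theorem LA_third {V : Type*} {v p q : V} {z : Sym2 V} (hpq : p ≠ q)
    (h1 : LA z s(v, p)) (h2 : LA z s(v, q)) : v ∈ z ∨ z = s(p, q) := by
  by_cases hv : v ∈ z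
  · exact Or.inl hv
  · right
    obtain ⟨-, u, hu, hu'⟩ := h1
    obtain ⟨-, w, hw, hw'⟩ := h2
    simp only [Sym2.mem_iff] at hu' hw'
    rcases hu' with rfl | rfl
    · exact absurd hu hv
    rcases hw' with rfl | rfl
    · exact absurd hw hv
    exact (Sym2.mem_and_mem_iff hpq).1 ⟨hu, hw⟩

abbrev ES (n d : ℕ) : Set (Sym2 (VV n d)) := (sunletIndicator n d).edgeSet

theorem four_nbr {n d : ℕ} (v : VV n d) (hv : d = 3 ∨ ∀ e k, v = Sum.inr (e, k) → d < k.val)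
    {a b c z : Sym2 (VV n d)} (ha : a ∈ ES n d) (hb : b ∈ ES n d) (hc : c ∈ ES n d)
    (hz : z ∈ ES n d) (va : v ∈ a) (vb : v ∈ b) (vc : v ∈ c) (vz : v ∈ z) (h1 : a ≠ b) (h2 : a ≠ c)
    (h3 : a ≠ z) (h4 : b ≠ c) (h5 : b ≠ z) (h6 : c ≠ z) : False := by
  obtain ⟨x, y, w, h⟩ := nbr_three v hv
  obtain ⟨a, rfl⟩ := va
  obtain ⟨b, rfl⟩ := vb
  obtain ⟨c, rfl⟩ := vc
  obtain ⟨z, rfl⟩ := vz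
  simp only [ES, SimpleGraph.mem_edgeSet] at ha hb hc hz
  have := h _ ha
  have := h _ hb
  have := h _ hc
  have := h _ hz
  grind

def Sp {d : ℕ} (x y : Fin (d + 1)) : Prop :=
  (x = 0 ∧ y = Fin.last d) ∨ (x = Fin.last d ∧ y = 0)

theorem Sp.symm {d : ℕ} {x y : Fin (d + 1)} (h : Sp x y) : Sp y x := by
  unfold Sp at *; tauto

set_option maxHeartbeats 1000000 in
open Classical in
theorem comb {d : ℕ} (hd : 3 ≤ d) {W : Type*} (E : Fin (d + 1) → Fin (d + 1) → W)
    (hE : ∀ x y x' y', x ≠ y → x' ≠ y' → E x y = E x' y' → (x = x' ∧ y = y') ∨ (x = y' ∧ y = x'))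
    (hEs : ∀ x y, ¬ Sp x y → E x y = E y x)
    (hE0 : E 0 (Fin.last d) ≠ E (Fin.last d) 0)
    (σ : Fin (d + 1) → Fin (d + 1) → Fin (d + 1)) (hσ : ∀ k, Function.Injective (σ k))
    (F : Fin (d + 1) → Fin (d + 1) → W) (hFE : ∀ k l, k ≠ l → F k l = E (σ k k) (σ k l))
    (hF : ∀ k l, k ≠ l → ¬ Sp k l → F k l = F l k)
    (hF0 : F 0 (Fin.last d) ≠ F (Fin.last d) 0) :
    (F 0 (Fin.last d) = E 0 (Fin.last d) ∧ F (Fin.last d) 0 = E (Fin.last d) 0) ∨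
    (F 0 (Fin.last d) = E (Fin.last d) 0 ∧ F (Fin.last d) 0 = E 0 (Fin.last d)) := by
  set L := Fin.last d with hL
  have h0L : (0 : Fin (d + 1)) ≠ L := by
    intro h; rw [Fin.ext_iff] at h; simp [L] at h; omega
  have hE0' : ∀ x y, Sp x y → E x y ≠ E y x := by
    rintro x y (⟨rfl, rfl⟩ | ⟨rfl, rfl⟩)
    · exact hE0
    · exact hE0.symm
  have huniq : ∀ k l l', k ≠ l → k ≠ l' → F k l = F k l' → l = l' := by
    intro k l l' h1 h2 h
    rw [hFE _ _ h1, hFE _ _ h2] at h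
    have i1 : σ k k ≠ σ k l := fun h => h1 (hσ k h)
    have i2 : σ k k ≠ σ k l' := fun h => h2 (hσ k h)
    rcases hE _ _ _ _ i1 i2 h with h | h
    · exact hσ k h.2
    · exact absurd h.1 i2
  let N : W → ZMod 2 := fun g => ∑ k, if ∃ l, k ≠ l ∧ F k l = g then 1 else 0
  let h : Fin (d + 1) → ZMod 2 := fun x => ∑ k, if σ k k = x then 1 else 0
  have hN : ∀ g, N g = (if F 0 L = g then 1 else 0) + (if F L 0 = g then 1 else 0) := by
    intro g
    have e1 : ∀ k, (if ∃ l, k ≠ l ∧ F k l = g then (1 : ZMod 2) else 0) =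
        (if ∃ l, k ≠ l ∧ ¬ Sp k l ∧ F k l = g then 1 else 0) +
        ((if k = 0 then (if F 0 L = g then 1 else 0) else 0) +
         (if k = L then (if F L 0 = g then 1 else 0) else 0)) := by
      intro k
      by_cases H : ∃ l, k ≠ l ∧ F k l = g
      · obtain ⟨l, hl, hg⟩ := H
        rw [if_pos ⟨l, hl, hg⟩]
        by_cases hs : Sp k l
        · rw [if_neg]
          · rcases hs with ⟨rfl, rfl⟩ | ⟨rfl, rfl⟩
            · rw [if_pos rfl, if_pos hg, if_neg h0L]; simp
            · rw [if_neg h0L.symm, if_pos rfl, if_pos hg]; simp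
          · rintro ⟨l', h1, h2, h3⟩
            have := huniq k l l' hl h1 (by rw [hg, h3])
            subst this
            exact h2 hs
        · rw [if_pos ⟨l, hl, hs, hg⟩]
          have n1 : ¬ (k = 0 ∧ F 0 L = g) := by
            rintro ⟨rfl, h3⟩
            have := huniq 0 l L hl h0L (by rw [hg, h3])
            exact hs (Or.inl ⟨rfl, this⟩)
          have n2 : ¬ (k = L ∧ F L 0 = g) := by
            rintro ⟨rfl, h3⟩
            have := huniq L l 0 hl h0L.symm (by rw [hg, h3])
            exact hs (Or.inr ⟨rfl, this⟩)
          rw [← ite_and, ← ite_and, if_neg n1, if_neg n2]; simp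
      · rw [if_neg H, if_neg]
        · have n1 : ¬ (k = 0 ∧ F 0 L = g) := by
            rintro ⟨rfl, h3⟩
            exact H ⟨L, h0L, h3⟩
          have n2 : ¬ (k = L ∧ F L 0 = g) := by
            rintro ⟨rfl, h3⟩
            exact H ⟨0, h0L.symm, h3⟩
          rw [← ite_and, ← ite_and, if_neg n1, if_neg n2]; simp
        · rintro ⟨l, h1, h2, h3⟩
          exact H ⟨l, h1, h3⟩
    have e2 : ∑ k, (if ∃ l, k ≠ l ∧ ¬ Sp k l ∧ F k l = g then (1 : ZMod 2) else 0) = 0 := by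
      rw [← Finset.sum_filter]
      have hT : ∀ k ∈ Finset.univ.filter (fun k => ∃ l, k ≠ l ∧ ¬ Sp k l ∧ F k l = g),
        ∃ l, k ≠ l ∧ ¬ Sp k l ∧ F k l = g := fun k hk => (Finset.mem_filter.1 hk).2
      choose! p hp using hT
      have hmem : ∀ k, (∃ l, k ≠ l ∧ ¬ Sp k l ∧ F k l = g) →
        k ∈ Finset.univ.filter (fun k => ∃ l, k ≠ l ∧ ¬ Sp k l ∧ F k l = g) :=
        fun k hk => Finset.mem_filter.2 ⟨Finset.mem_univ _, hk⟩
      have hpm : ∀ k, k ∈ Finset.univ.filter (fun k => ∃ l, k ≠ l ∧ ¬ Sp k l ∧ F k l = g) →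
          (p k ≠ k ∧ ¬ Sp (p k) k ∧ F (p k) k = g) := by
        intro k hk
        obtain ⟨h1, h2, h3⟩ := hp k hk
        exact ⟨h1.symm, fun h => h2 h.symm, by rw [← hF k _ h1 h2]; exact h3⟩
      refine Finset.sum_involution (fun k _ => p k) ?_ ?_ ?_ ?_
      · intro k hk; decide
      · intro k hk _; exact (hpm k hk).1
      · intro k hk; exact hmem _ ⟨k, hpm k hk⟩
      · intro k hk
        have h1 := hpm k hk
        have h2 := hp (p k) (hmem _ ⟨k, h1⟩)
        exact huniq (p k) _ _ h2.1 h1.1 (by rw [h2.2.2, h1.2.2])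
    simp only [N]
    rw [Finset.sum_congr rfl (fun k _ => e1 k), Finset.sum_add_distrib, e2,
      Finset.sum_add_distrib]
    simp
  have hsurj : ∀ k, Function.Surjective (σ k) := fun k => Finite.surjective_of_injective (hσ k)
  have hin : ∀ k x y, x ≠ y → σ k k = x → ∃ l, k ≠ l ∧ F k l = E x y := by
    intro k x y hxy hk
    obtain ⟨l, hl⟩ := hsurj k y
    have : k ≠ l := by rintro rfl; exact hxy (hk.symm.trans hl)
    exact ⟨l, this, by rw [hFE _ _ this, hk, hl]⟩
  have hout : ∀ k x y, x ≠ y → (∃ l, k ≠ l ∧ F k l = E x y) → σ k k = x ∨ (σ k k = y ∧ E x y = E y x) := by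
    rintro k x y hxy ⟨l, h1, h2⟩
    rw [hFE _ _ h1] at h2
    rcases hE _ _ _ _ (fun h => h1 (hσ k h)) hxy h2 with h | h
    · exact Or.inl h.1
    · right; refine ⟨h.1, ?_⟩
      rw [← h2, h.1, h.2]
  have hN1 : ∀ x y, x ≠ y → ¬ Sp x y → N (E x y) = h x + h y := by
    intro x y hxy hs
    simp only [N, h]
    rw [← Finset.sum_add_distrib]
    refine Finset.sum_congr rfl fun k _ => ?_
    by_cases h1 : σ k k = x
    · rw [if_pos (hin k x y hxy h1), if_pos h1, if_neg]; simp
      rw [h1]; exact hxy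
    · by_cases h2 : σ k k = y
      · rw [if_pos, if_neg h1, if_pos h2]; simp
        rw [hEs x y hs]; exact hin k y x hxy.symm h2
      · rw [if_neg, if_neg h1, if_neg h2]; simp
        intro H
        rcases hout k x y hxy H with h | h
        · exact h1 h
        · exact h2 h.1
  have hN2 : ∀ x y, Sp x y → N (E x y) = h x := by
    intro x y hs
    have hxy : x ≠ y := by rcases hs with ⟨rfl, rfl⟩ | ⟨rfl, rfl⟩; exacts [h0L, h0L.symm]
    simp only [N, h]
    refine Finset.sum_congr rfl fun k _ => ?_
    by_cases h1 : σ k k = x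
    · rw [if_pos (hin k x y hxy h1), if_pos h1]
    · rw [if_neg, if_neg h1]
      intro H
      rcases hout k x y hxy H with h | h
      · exact h1 h
      · exact hE0' _ _ hs h.2
  have hab : ∀ g, N g = 1 → F 0 L = g ∨ F L 0 = g := by
    intro g hg
    rw [hN] at hg
    by_contra hc
    rw [not_or] at hc
    rw [if_neg hc.1, if_neg hc.2] at hg
    revert hg; decide
  have hcut : ∀ x y, h x = 1 → h y = 0 → F 0 L = E x y ∨ F L 0 = E x y := by
    intro x y hx hy
    apply hab
    have hxy : x ≠ y := by rintro rfl; rw [hx] at hy; revert hy; decide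
    by_cases hs : Sp x y
    · rw [hN2 _ _ hs, hx]
    · rw [hN1 _ _ hxy hs, hx, hy]; rfl
  have h01 : ∀ x, h x = 0 ∨ h x = 1 := by
    intro x; generalize h x = t; revert t; decide
  by_cases hex : ∃ x y, h x = 1 ∧ h y = 0
  · exfalso
    obtain ⟨x, y, hx, hy⟩ := hex
    have hxy : x ≠ y := by rintro rfl; rw [hx] at hy; revert hy; decide
    have ext : ∀ s : Finset (Fin (d + 1)), s.card ≤ 3 → ∃ z, z ∉ s := by
      intro s hs
      by_contra hc
      push Not at hc
      have : s = Finset.univ := Finset.eq_univ_iff_forall.2 hc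
      rw [this, Finset.card_univ, Fintype.card_fin] at hs
      omega
    obtain ⟨z, hz⟩ := ext {x, y} (Finset.card_le_two.trans (by omega))
    obtain ⟨w, hw⟩ := ext {x, y, z} Finset.card_le_three
    simp only [Finset.mem_insert, Finset.mem_singleton, not_or] at hz hw
    have c1 := hcut x y hx hy
    have cz : ∃ p q, p ≠ q ∧ (F 0 L = E p q ∨ F L 0 = E p q) ∧ ((p = z ∧ q = y) ∨ (p = x ∧ q = z)) := by
      rcases h01 z with h | h
      · exact ⟨x, z, fun h => hz.1 h.symm, hcut _ _ hx h, Or.inr ⟨rfl, rfl⟩⟩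
      · exact ⟨z, y, hz.2, hcut _ _ h hy, Or.inl ⟨rfl, rfl⟩⟩
    have cw : ∃ p q, p ≠ q ∧ (F 0 L = E p q ∨ F L 0 = E p q) ∧ ((p = w ∧ q = y) ∨ (p = x ∧ q = w)) := by
      rcases h01 w with h | h
      · exact ⟨x, w, fun h => hw.1 h.symm, hcut _ _ hx h, Or.inr ⟨rfl, rfl⟩⟩
      · exact ⟨w, y, hw.2.1, hcut _ _ h hy, Or.inl ⟨rfl, rfl⟩⟩
    obtain ⟨p, q, hpq, c2, h2⟩ := cz
    obtain ⟨r, s, hrs, c3, h3⟩ := cw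
    have n1 : E x y ≠ E p q := by intro h; have := hE _ _ _ _ hxy hpq h; grind
    have n2 : E x y ≠ E r s := by intro h; have := hE _ _ _ _ hxy hrs h; grind
    have n3 : E p q ≠ E r s := by intro h; have := hE _ _ _ _ hpq hrs h; grind
    grind
  · push Not at hex
    rcases h01 0 with h00 | h00
    · exfalso
      have hall : ∀ x, h x = 0 := by
        intro x
        rcases h01 x with h1 | h1
        · exact h1
        · exact absurd h00 (hex x 0 h1)
      have i1 : σ 0 0 ≠ σ 0 L := fun h => h0L (hσ 0 h)
      have e1 := hFE 0 L h0L
      have e2 := hN (F 0 L)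
      rw [if_pos rfl, if_neg hF0.symm, e1] at e2
      by_cases hs : Sp (σ 0 0) (σ 0 L)
      · rw [hN2 _ _ hs, hall] at e2; revert e2; decide
      · rw [hN1 _ _ i1 hs, hall, hall] at e2; revert e2; decide
    · have hall : ∀ x, h x = 1 := by
        intro x
        rcases h01 x with h1 | h1
        · exact absurd h1 (hex 0 x h00)
        · exact h1
      have e1 := hab (E 0 L) (by rw [hN2 _ _ (Or.inl ⟨rfl, rfl⟩), hall])
      have e2 := hab (E L 0) (by rw [hN2 _ _ (Or.inr ⟨rfl, rfl⟩), hall])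
      grind

def tg {d : ℕ} (x y : Fin (d + 1)) : Fin (d + 3) :=
  if (x.val = 0 ∧ y.val = d) ∨ (x.val = d ∧ y.val = 0) then ⟨d + 1, by omega⟩
  else ⟨y.val, by omega⟩

def Es {n d : ℕ} (e : Fin n × Fin 2) (x y : Fin (d + 1)) : Sym2 (VV n d) :=
  s(Sum.inr (e, ⟨x.val, by omega⟩), Sum.inr (e, tg x y))

theorem Sp_iff {d : ℕ} (x y : Fin (d + 1)) :
    Sp x y ↔ (x.val = 0 ∧ y.val = d) ∨ (x.val = d ∧ y.val = 0) := by
  simp only [Sp, Fin.ext_iff, Fin.val_zero, Fin.val_last]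

theorem tg_cases {d : ℕ} (x y : Fin (d + 1)) :
    (Sp x y ∧ (tg x y).val = d + 1) ∨ (¬ Sp x y ∧ (tg x y).val = y.val) := by
  rw [Sp_iff]
  unfold tg
  split_ifs with h
  · exact Or.inl ⟨h, rfl⟩
  · exact Or.inr ⟨h, rfl⟩

theorem Es_mem {n d : ℕ} (e : Fin n × Fin 2) (x y : Fin (d + 1)) (h : x ≠ y) :
    Es e x y ∈ ES n d := by
  have := tg_cases x y
  rw [Sp_iff] at this
  rw [ne_eq, Fin.ext_iff] at h
  simp only [Es, ES, SimpleGraph.mem_edgeSet, adj_rr, IA, true_and]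
  omega

theorem Es_inj {n d : ℕ} (e e' : Fin n × Fin 2) (x y x' y' : Fin (d + 1)) (h : x ≠ y)
    (h' : x' ≠ y') (H : Es e x y = Es e' x' y') :
    e = e' ∧ ((x = x' ∧ y = y') ∨ (x = y' ∧ y = x')) := by
  have h1 := tg_cases x y
  have h2 := tg_cases x' y'
  rw [Sp_iff] at h1 h2
  simp only [ne_eq, Fin.ext_iff] at h h' ⊢
  simp only [Es, Sym2.eq_iff, Sum.inr.injEq, Prod.mk.injEq, Fin.ext_iff] at H
  rcases H with ⟨⟨h3, h4⟩, h5, h6⟩ | ⟨⟨h3, h4⟩, h5, h6⟩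
  · exact ⟨h3, by omega⟩
  · exact ⟨h3, by omega⟩

theorem Es_symm {n d : ℕ} (e : Fin n × Fin 2) (x y : Fin (d + 1)) (h : ¬ Sp x y) :
    Es e x y = Es e y x := by
  have h1 := tg_cases x y
  have h2 := tg_cases y x
  rw [Sp_iff] at h1 h2 h
  simp only [Es, Sym2.eq_iff, Sum.inr.injEq, Prod.mk.injEq, Fin.ext_iff, true_and]
  omega

theorem Es_ne {n d : ℕ} (hd : 3 ≤ d) (e : Fin n × Fin 2) :
    Es e (0 : Fin (d + 1)) (Fin.last d) ≠ Es e (Fin.last d) 0 := by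
  have h1 : (tg (0 : Fin (d + 1)) (Fin.last d)).val = d + 1 := by simp [tg]
  have h2 : (tg (Fin.last d) (0 : Fin (d + 1))).val = d + 1 := by simp [tg]
  simp only [Es, Sym2.eq_iff, Sum.inr.injEq, Prod.mk.injEq, Fin.ext_iff, true_and, ne_eq,
    Fin.val_zero, Fin.val_last]
  omega

theorem Es_LA {n d : ℕ} (e : Fin n × Fin 2) (x y y' : Fin (d + 1)) (h : x ≠ y) (h' : x ≠ y')
    (hy : y ≠ y') : LA (Es e x y) (Es e x y') := by
  refine ⟨fun H => ?_, _, Sym2.mem_mk_left _ _, Sym2.mem_mk_left _ _⟩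
  rcases (Es_inj e e x y x y' h h' H).2 with h1 | h1
  · exact hy h1.2
  · exact h' h1.1

theorem Es_LA0 {n d : ℕ} (hd : 3 ≤ d) (e : Fin n × Fin 2) :
    LA (Es e (0 : Fin (d + 1)) (Fin.last d)) (Es e (Fin.last d) 0) := by
  refine ⟨Es_ne hd e, Sum.inr (e, tg 0 (Fin.last d)), Sym2.mem_mk_right _ _, ?_⟩
  have : tg (0 : Fin (d + 1)) (Fin.last d) = tg (Fin.last d) 0 := by simp [tg]
  rw [this]
  exact Sym2.mem_mk_right _ _

theorem Es_of {n d : ℕ} (hd : 3 ≤ d) (e : Fin n × Fin 2) (k : Fin (d + 3)) (hk : k.val ≤ d)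
    (s : Sym2 (VV n d)) (hs : s ∈ ES n d) (hm : Sum.inr (e, k) ∈ s) :
    ∃ y, (⟨k.val, by omega⟩ : Fin (d + 1)) ≠ y ∧ s = Es e ⟨k.val, by omega⟩ y := by
  obtain ⟨v, rfl⟩ := hm
  simp only [ES, SimpleGraph.mem_edgeSet] at hs
  rcases v with x | ⟨e', l⟩
  · rw [adj_rl] at hs; omega
  · rw [adj_rr] at hs
    obtain ⟨rfl, hs⟩ := hs
    unfold IA at hs
    obtain ⟨m, hm, hml⟩ : ∃ m, m < d + 1 ∧
        ((l.val = d + 1 ∧ m = d - k.val) ∨ (l.val ≠ d + 1 ∧ m = l.val)) := by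
      by_cases h : l.val = d + 1
      · exact ⟨d - k.val, by omega, Or.inl ⟨h, rfl⟩⟩
      · exact ⟨l.val, by omega, Or.inr ⟨h, rfl⟩⟩
    refine ⟨⟨m, hm⟩, ?_, ?_⟩
    · rw [ne_eq, Fin.ext_iff]; simp only; omega
    · have h1 := tg_cases (⟨k.val, by omega⟩ : Fin (d + 1)) ⟨m, hm⟩
      rw [Sp_iff] at h1
      simp only at h1
      simp only [Es, Sym2.eq_iff, Sum.inr.injEq, Prod.mk.injEq, Fin.ext_iff, true_and]
      left
      omega

theorem fin_ext {d m : ℕ} (hm : m ≤ d) (s : Finset (Fin (d + 1))) (hs : s.card ≤ m) :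
    ∃ z, z ∉ s := by
  by_contra hc
  push Not at hc
  have : s = Finset.univ := Finset.eq_univ_iff_forall.2 hc
  rw [this, Finset.card_univ, Fintype.card_fin] at hs
  omega

theorem four_idx {d : ℕ} (hd : 4 ≤ d) (k a b c : Fin (d + 1)) :
    ∃ z, k ≠ z ∧ a ≠ z ∧ b ≠ z ∧ c ≠ z := by
  obtain ⟨z, hz⟩ := fin_ext hd {k, a, b, c} Finset.card_le_four
  simp only [Finset.mem_insert, Finset.mem_singleton, not_or] at hz
  exact ⟨z, fun h => hz.1 h.symm, fun h => hz.2.1 h.symm, fun h => hz.2.2.1 h.symm,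
    fun h => hz.2.2.2 h.symm⟩

theorem star_common {d : ℕ} (hd : 4 ≤ d) {V : Type*} (P : Fin (d + 1) → Sym2 V) (k : Fin (d + 1))
    (hP : ∀ l l', k ≠ l → k ≠ l' → l ≠ l' → LA (P l) (P l')) : ∃ v, ∀ l, k ≠ l → v ∈ P l := by
  by_contra hc
  push Not at hc
  obtain ⟨l1, k1, -⟩ := four_idx hd k k k k
  obtain ⟨l2, k2, h12, -⟩ := four_idx hd k l1 k k
  obtain ⟨v, p, q, hpq, e1, e2⟩ := LA_form (hP l1 l2 k1 k2 h12)
  obtain ⟨l3, k3, hv⟩ := hc v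
  have h13 : l3 ≠ l1 := by rintro rfl; exact hv (e1 ▸ Sym2.mem_mk_left _ _)
  have h23 : l3 ≠ l2 := by rintro rfl; exact hv (e2 ▸ Sym2.mem_mk_left _ _)
  have e3 : P l3 = s(p, q) :=
    (LA_third hpq (e1 ▸ hP l3 l1 k3 k1 h13) (e2 ▸ hP l3 l2 k3 k2 h23)).resolve_left hv
  obtain ⟨l4, k4, h14, h24, h34⟩ := four_idx hd k l1 l2 l3
  have a1 := hP l4 l1 k4 k1 h14.symm
  have a2 := hP l4 l2 k4 k2 h24.symm
  have a3 := hP l4 l3 k4 k3 h34.symm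
  rcases LA_third hpq (e1 ▸ a1) (e2 ▸ a2) with h | h
  · obtain ⟨ne, w, hw, hw'⟩ := a3
    have hvw : v ≠ w := by rintro rfl; exact hv hw'
    have e4 : P l4 = s(v, w) := (Sym2.mem_and_mem_iff hvw).1 ⟨h, hw⟩
    rw [e3, Sym2.mem_iff] at hw'
    rcases hw' with rfl | rfl
    · exact a1.1 (by rw [e4, e1])
    · exact a2.1 (by rw [e4, e2])
  · exact a3.1 (by rw [h, e3])

theorem dragon4 {n n' d : ℕ} (hd : 4 ≤ d) (g : Sym2 (VV n d) → Sym2 (VV n' d))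
    (hg1 : ∀ s ∈ ES n d, g s ∈ ES n' d)
    (hg2 : ∀ s ∈ ES n d, ∀ t ∈ ES n d, LA s t → LA (g s) (g t)) (e : Fin n × Fin 2) :
    ∃ e', (g (Es e 0 (Fin.last d)) = Es e' 0 (Fin.last d) ∧
        g (Es e (Fin.last d) 0) = Es e' (Fin.last d) 0) ∨
      (g (Es e 0 (Fin.last d)) = Es e' (Fin.last d) 0 ∧
        g (Es e (Fin.last d) 0) = Es e' 0 (Fin.last d)) := by
  have hd3 : 3 ≤ d := by omega
  have h0L : (0 : Fin (d + 1)) ≠ Fin.last d := by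
    intro h; rw [Fin.ext_iff] at h; simp at h; omega
  have stepA : ∀ k : Fin (d + 1), ∃ (c : Fin n' × Fin 2) (u : Fin (d + 1)), ∀ l, k ≠ l →
      ∃ y, u ≠ y ∧ g (Es e k l) = Es c u y := by
    intro k
    have hP : ∀ l l', k ≠ l → k ≠ l' → l ≠ l' → LA (g (Es e k l)) (g (Es e k l')) :=
      fun l l' h h' hl => hg2 _ (Es_mem _ _ _ h) _ (Es_mem _ _ _ h') (Es_LA e k l l' h h' hl)
    have hm : ∀ l, k ≠ l → g (Es e k l) ∈ ES n' d := fun l h => hg1 _ (Es_mem _ _ _ h)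
    obtain ⟨v, hv⟩ := star_common hd (fun l => g (Es e k l)) k hP
    by_cases hcore : ∀ c u, v = Sum.inr (c, u) → d < u.val
    · exfalso
      obtain ⟨l1, k1, -⟩ := four_idx hd k k k k
      obtain ⟨l2, k2, h12, -⟩ := four_idx hd k l1 k k
      obtain ⟨l3, k3, h13, h23, -⟩ := four_idx hd k l1 l2 k
      obtain ⟨l4, k4, h14, h24, h34⟩ := four_idx hd k l1 l2 l3
      exact four_nbr v (Or.inr hcore) (hm l1 k1) (hm l2 k2) (hm l3 k3) (hm l4 k4)
        (hv _ k1) (hv _ k2) (hv _ k3) (hv _ k4) (hP _ _ k1 k2 h12).1 (hP _ _ k1 k3 h13).1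
        (hP _ _ k1 k4 h14).1 (hP _ _ k2 k3 h23).1 (hP _ _ k2 k4 h24).1 (hP _ _ k3 k4 h34).1
    · push Not at hcore
      obtain ⟨c, u, rfl, hu⟩ := hcore
      exact ⟨c, ⟨u.val, by omega⟩, fun l hl => Es_of hd3 c u hu _ (hm l hl) (hv l hl)⟩
  choose c u y hy using stepA
  have hc : ∀ k l, k ≠ l → ¬ Sp k l → c k = c l := by
    intro k l hkl hs
    have h1 := hy k l hkl
    have h2 := hy l k hkl.symm
    rw [Es_symm e k l hs, h2.2] at h1
    exact (Es_inj _ _ _ _ _ _ h2.1 h1.1 h1.2).1.symm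
  have hc0 : ∀ k, c k = c 0 := by
    intro k
    by_cases hk : k = 0
    · rw [hk]
    by_cases hs : Sp k 0
    · have hkl : k = Fin.last d := by
        rcases hs with h | h
        · exact absurd h.1 hk
        · exact h.1
      let o : Fin (d + 1) := ⟨1, by omega⟩
      have h1 : k ≠ o := by rw [hkl, ne_eq, Fin.ext_iff]; simp [o]; omega
      have h2 : o ≠ 0 := by rw [ne_eq, Fin.ext_iff]; simp [o]
      rw [hc k o h1, hc o 0 h2]
      · rw [Sp_iff]; simp [o]; omega
      · rw [Sp_iff]; simp [o]; omega
    · exact hc k 0 hk hs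
  refine ⟨c 0, ?_⟩
  let σ : Fin (d + 1) → Fin (d + 1) → Fin (d + 1) := fun k l =>
    if h : k ≠ l then y k l h else u k
  have hσk : ∀ k, σ k k = u k := fun k => by simp [σ]
  have hσl : ∀ k l (h : k ≠ l), σ k l = y k l h := fun k l h => by simp [σ, h]
  have hFE : ∀ k l, k ≠ l → g (Es e k l) = Es (c 0) (σ k k) (σ k l) := by
    intro k l hkl
    rw [hσk, hσl k l hkl, ← hc0 k]
    exact (hy k l hkl).2
  refine comb hd3 (fun a b => Es (c 0) a b)
    (fun x y x' y' h h' H => (Es_inj _ _ _ _ _ _ h h' H).2) (fun x y h => Es_symm _ _ _ h)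
    (Es_ne hd3 _) σ ?_ (fun a b => g (Es e a b)) hFE
    (fun k l _ hs => by simp only [Es_symm e k l hs])
    (hg2 _ (Es_mem _ _ _ h0L) _ (Es_mem _ _ _ h0L.symm) (Es_LA0 hd3 e)).1
  intro k l l' hll
  by_cases h1 : k = l <;> by_cases h2 : k = l'
  · exact h1.symm.trans h2
  · subst h1
    rw [hσk, hσl _ _ h2] at hll
    exact absurd hll (hy k l' h2).1
  · subst h2
    rw [hσk, hσl _ _ h1] at hll
    exact absurd hll.symm (hy k l h1).1
  · by_contra hne
    refine (hg2 _ (Es_mem e _ _ h1) _ (Es_mem e _ _ h2) (Es_LA e k l l' h1 h2 hne)).1 ?_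
    rw [hFE _ _ h1, hFE _ _ h2, hll]

theorem tri_core {n d : ℕ} {v p q : VV n d} (h1 : (sunletIndicator n d).Adj v p)
    (h2 : (sunletIndicator n d).Adj v q) (h3 : (sunletIndicator n d).Adj p q) :
    ∃ e k l m, v = Sum.inr (e, k) ∧ p = Sum.inr (e, l) ∧ q = Sum.inr (e, m) ∧
      k.val ≤ d ∧ l.val ≤ d ∧ m.val ≤ d := by
  rcases v with v | ⟨e1, k⟩ <;> rcases p with p | ⟨e2, l⟩ <;> rcases q with q | ⟨e3, m⟩ <;>
    simp only [adj_rr, adj_lr, adj_rl, adj_ll, IA] at h1 h2 h3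
  · omega
  · omega
  · omega
  · obtain ⟨rfl, h1⟩ := h1
    obtain ⟨rfl, h2⟩ := h2
    exact ⟨_, _, _, _, rfl, rfl, rfl, by omega, by omega, by omega⟩

def InW {n : ℕ} (e : Fin n × Fin 2) (s : Sym2 (VV n 3)) : Prop :=
  ∀ v ∈ s, ∃ k : Fin 6, k.val ≤ 4 ∧ v = Sum.inr (e, k)

theorem InW_mk {n : ℕ} {e : Fin n × Fin 2} {k l : Fin 6} (hk : k.val ≤ 4) (hl : l.val ≤ 4) :
    InW e s(Sum.inr (e, k), Sum.inr (e, l)) := by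
  intro v hv
  rw [Sym2.mem_iff] at hv
  rcases hv with rfl | rfl
  exacts [⟨k, hk, rfl⟩, ⟨l, hl, rfl⟩]

theorem InW_of {n : ℕ} {e : Fin n × Fin 2} {k : Fin 6} (hk : k.val ≤ 3) {s : Sym2 (VV n 3)}
    (hs : s ∈ ES n 3) (hm : Sum.inr (e, k) ∈ s) : InW e s := by
  obtain ⟨v, rfl⟩ := hm
  simp only [ES, SimpleGraph.mem_edgeSet] at hs
  rcases v with x | ⟨e', l⟩
  · rw [adj_rl] at hs; omega
  · rw [adj_rr] at hs
    obtain ⟨rfl, hs⟩ := hs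
    unfold IA at hs
    exact InW_mk (by omega) (by omega)

theorem W_close {n : ℕ} {e : Fin n × Fin 2} {x y z w : Sym2 (VV n 3)} (hx : x ∈ ES n 3)
    (hy : y ∈ ES n 3) (hz : z ∈ ES n 3) (hw : w ∈ ES n 3) (wx : InW e x) (wy : InW e y)
    (wz : InW e z) (hxy : LA x y) (hzx : LA z x) (hzy : LA z y) (hwx : LA w x) (hwy : LA w y) :
    InW e w := by
  obtain ⟨v, p, q, hpq, rfl, rfl⟩ := LA_form hxy
  obtain ⟨k, hk, rfl⟩ := wx v (Sym2.mem_mk_left _ _)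
  obtain ⟨l, hl, rfl⟩ := wx p (Sym2.mem_mk_right _ _)
  obtain ⟨m, hm, rfl⟩ := wy q (Sym2.mem_mk_right _ _)
  rcases LA_third hpq hwx hwy with h | rfl
  · by_cases hk3 : k.val ≤ 3
    · exact InW_of hk3 hw h
    · exfalso
      simp only [ES, SimpleGraph.mem_edgeSet, adj_rr, true_and, IA] at hx hy
      have hlm : l.val ≠ m.val := fun h => hpq (by rw [Fin.ext h])
      rcases LA_third hpq hzx hzy with h | rfl
      · obtain ⟨r, rfl⟩ := h
        obtain ⟨r, hr, rfl⟩ := wz r (Sym2.mem_mk_right _ _)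
        simp only [ES, SimpleGraph.mem_edgeSet, adj_rr, true_and, IA] at hz
        have h1 : r ≠ l := fun h => hzx.1 (by rw [h])
        have h2 : r ≠ m := fun h => hzy.1 (by rw [h])
        rw [ne_eq, Fin.ext_iff] at h1 h2
        omega
      · simp only [ES, SimpleGraph.mem_edgeSet, adj_rr, true_and, IA] at hz
        omega
  · exact InW_mk hl hm

theorem W_start {n : ℕ} {x y z w : Sym2 (VV n 3)} (hx : x ∈ ES n 3)
    (hy : y ∈ ES n 3) (hz : z ∈ ES n 3) (hw : w ∈ ES n 3) 
    (hxy : LA x y) (hzx : LA z x) (hzy : LA z y) (hwx : LA w x) (hwy : LA w y) (hzw : z ≠ w) :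
    ∃ e, InW e x ∧ InW e y ∧ InW e z ∧ InW e w := by
  obtain ⟨v, p, q, hpq, rfl, rfl⟩ := LA_form hxy
  have a1 := LA_third hpq hzx hzy
  have a2 := LA_third hpq hwx hwy
  have key : s(p, q) ∈ ES n 3 := by
    rcases a1 with h | rfl
    · rcases a2 with h' | rfl
      · exact (four_nbr v (Or.inl rfl) hx hy hz hw (Sym2.mem_mk_left _ _) (Sym2.mem_mk_left _ _)
          h h' hxy.1 hzx.1.symm hwx.1.symm hzy.1.symm hwy.1.symm hzw).elim
      · exact hw
    · exact hz
  simp only [ES, SimpleGraph.mem_edgeSet] at hx hy key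
  obtain ⟨e, k, l, m, rfl, rfl, rfl, hk, hl, hm⟩ := tri_core hx hy key
  refine ⟨e, InW_mk (by omega) (by omega), InW_mk (by omega) (by omega), ?_, ?_⟩
  · rcases a1 with h | rfl
    · exact InW_of hk hz h
    · exact InW_mk (by omega) (by omega)
  · rcases a2 with h | rfl
    · exact InW_of hk hw h
    · exact InW_mk (by omega) (by omega)

def tA : Fin 7 → Fin 6 := ![0, 0, 1, 1, 2, 0, 3]
def tB : Fin 7 → Fin 6 := ![1, 2, 2, 3, 3, 4, 4]
def tAdj (i j : Fin 7) : Bool :=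
  i != j && (tA i == tA j || tA i == tB j || tB i == tA j || tB i == tB j)

theorem t_surj : ∀ k l : Fin 6, k.val ≤ 4 → l.val ≤ 4 → IA 3 k l →
    ∃ i, (tA i = k ∧ tB i = l) ∨ (tA i = l ∧ tB i = k) := by
  unfold IA; decide

def Pe {n : ℕ} (e : Fin n × Fin 2) (i : Fin 7) : Sym2 (VV n 3) :=
  s(Sum.inr (e, tA i), Sum.inr (e, tB i))

theorem InW_Pe {n : ℕ} {e : Fin n × Fin 2} {s : Sym2 (VV n 3)} (hs : s ∈ ES n 3)
    (h : InW e s) : ∃ i, s = Pe e i := by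
  induction s with | _ v w
  obtain ⟨k, hk, rfl⟩ := h v (Sym2.mem_mk_left _ _)
  obtain ⟨l, hl, rfl⟩ := h w (Sym2.mem_mk_right _ _)
  simp only [ES, SimpleGraph.mem_edgeSet, adj_rr, true_and] at hs
  obtain ⟨i, ⟨rfl, rfl⟩ | ⟨rfl, rfl⟩⟩ := t_surj k l hk hl hs
  · exact ⟨i, rfl⟩
  · exact ⟨i, Sym2.eq_swap⟩

theorem Pe_adj {n : ℕ} {e : Fin n × Fin 2} {i j : Fin 7} (h : LA (Pe e i) (Pe e j)) :
    tAdj i j = true := by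
  obtain ⟨h1, v, h2, h3⟩ := h
  have hij : i ≠ j := by rintro rfl; exact h1 rfl
  simp only [Pe, Sym2.mem_iff] at h2 h3
  simp only [tAdj, Bool.and_eq_true, bne_iff_ne, Bool.or_eq_true, beq_iff_eq]
  refine ⟨hij, ?_⟩
  rcases h2 with rfl | rfl <;> simp only [Sum.inr.injEq, Prod.mk.injEq, true_and] at h3 <;> tauto

set_option maxRecDepth 100000 in
theorem t_main : ∀ a b, tAdj a b = true → ∀ c, tAdj a c = true → tAdj b c = true →
    ∀ p, tAdj p a = true → tAdj p b = true → ∀ x, tAdj x a = true → tAdj x c = true →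
    ∀ y, tAdj y b = true → tAdj y c = true → tAdj x y = true →
    ∀ q, tAdj q x = true → tAdj q y = true → tAdj p q = true →
    (p = 5 ∧ q = 6) ∨ (p = 6 ∧ q = 5) := by
  decide

theorem dragon3 {n n' : ℕ} (g : Sym2 (VV n 3) → Sym2 (VV n' 3))
    (hg1 : ∀ s ∈ ES n 3, g s ∈ ES n' 3)
    (hg2 : ∀ s ∈ ES n 3, ∀ t ∈ ES n 3, LA s t → LA (g s) (g t)) (e : Fin n × Fin 2) :
    ∃ e', (g (Es e 0 (Fin.last 3)) = Es e' 0 (Fin.last 3) ∧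
        g (Es e (Fin.last 3) 0) = Es e' (Fin.last 3) 0) ∨
      (g (Es e 0 (Fin.last 3)) = Es e' (Fin.last 3) 0 ∧
        g (Es e (Fin.last 3) 0) = Es e' 0 (Fin.last 3)) := by
  have hm : ∀ i, Pe e i ∈ ES n 3 := by
    intro i
    simp only [Pe, ES, SimpleGraph.mem_edgeSet, adj_rr, true_and, IA]
    revert i; decide
  have hne : ∀ i j, i ≠ j → Pe e i ≠ Pe e j := by
    intro i j hij h
    simp only [Pe, Sym2.eq_iff, Sum.inr.injEq, Prod.mk.injEq, true_and] at h
    revert i j; decide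
  have hLA : ∀ i j, tAdj i j = true → LA (g (Pe e i)) (g (Pe e j)) := by
    intro i j hij
    refine hg2 _ (hm i) _ (hm j) ?_
    simp only [tAdj, Bool.and_eq_true, bne_iff_ne, Bool.or_eq_true, beq_iff_eq] at hij
    refine ⟨hne _ _ hij.1, ?_⟩
    simp only [Pe, Sym2.mem_iff]
    rcases hij.2 with ((h | h) | h) | h
    · exact ⟨_, Or.inl rfl, by rw [h]; exact Or.inl rfl⟩
    · exact ⟨_, Or.inl rfl, by rw [h]; exact Or.inr rfl⟩
    · exact ⟨_, Or.inr rfl, by rw [h]; exact Or.inl rfl⟩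
    · exact ⟨_, Or.inr rfl, by rw [h]; exact Or.inr rfl⟩
  have hM : ∀ i, g (Pe e i) ∈ ES n' 3 := fun i => hg1 _ (hm i)
  have hW : ∃ e', ∀ i, InW e' (g (Pe e i)) := by
    by_cases h : g (Pe e 2) = g (Pe e 5)
    · have h' : g (Pe e 2) ≠ g (Pe e 6) := fun h' => (hLA 5 6 rfl).1 (h.symm.trans h')
      obtain ⟨e', w3, w4, w2, w6⟩ := W_start (hM 3) (hM 4) (hM 2) (hM 6) (hLA 3 4 rfl)
        (hLA 2 3 rfl) (hLA 2 4 rfl) (hLA 6 3 rfl) (hLA 6 4 rfl) h'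
      have w0 := W_close (hM 3) (hM 2) (hM 4) (hM 0) w3 w2 w4 (hLA 3 2 rfl)
        (hLA 4 3 rfl) (hLA 4 2 rfl) (hLA 0 3 rfl) (hLA 0 2 rfl)
      have w1 := W_close (hM 4) (hM 2) (hM 3) (hM 1) w4 w2 w3 (hLA 4 2 rfl)
        (hLA 3 4 rfl) (hLA 3 2 rfl) (hLA 1 4 rfl) (hLA 1 2 rfl)
      refine ⟨e', fun i => ?_⟩
      fin_cases i
      exacts [w0, w1, w2, w3, w4, h ▸ w2, w6]
    · obtain ⟨e', w0, w1, w2, w5⟩ := W_start (hM 0) (hM 1) (hM 2) (hM 5) (hLA 0 1 rfl)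
        (hLA 2 0 rfl) (hLA 2 1 rfl) (hLA 5 0 rfl) (hLA 5 1 rfl) h
      have w3 := W_close (hM 0) (hM 2) (hM 1) (hM 3) w0 w2 w1 (hLA 0 2 rfl)
        (hLA 1 0 rfl) (hLA 1 2 rfl) (hLA 3 0 rfl) (hLA 3 2 rfl)
      have w4 := W_close (hM 1) (hM 2) (hM 0) (hM 4) w1 w2 w0 (hLA 1 2 rfl)
        (hLA 0 1 rfl) (hLA 0 2 rfl) (hLA 4 1 rfl) (hLA 4 2 rfl)
      have w6 := W_close (hM 3) (hM 4) (hM 2) (hM 6) w3 w4 w2 (hLA 3 4 rfl)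
        (hLA 2 3 rfl) (hLA 2 4 rfl) (hLA 6 3 rfl) (hLA 6 4 rfl)
      refine ⟨e', fun i => ?_⟩
      fin_cases i
      exacts [w0, w1, w2, w3, w4, w5, w6]
  obtain ⟨e', hW⟩ := hW
  choose t ht using fun i => InW_Pe (hM i) (hW i)
  have hT : ∀ i j, tAdj i j = true → tAdj (t i) (t j) = true := by
    intro i j h
    have := hLA i j h
    rw [ht i, ht j] at this
    exact Pe_adj this
  have := t_main (t 0) (t 1) (hT _ _ rfl) (t 2) (hT _ _ rfl) (hT _ _ rfl) (t 5) (hT _ _ rfl)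
    (hT _ _ rfl) (t 3) (hT _ _ rfl) (hT _ _ rfl) (t 4) (hT _ _ rfl) (hT _ _ rfl) (hT _ _ rfl)
    (t 6) (hT _ _ rfl) (hT _ _ rfl) (hT _ _ rfl)
  have e5 : ∀ {n : ℕ} (e : Fin n × Fin 2), Es e 0 (Fin.last 3) = Pe e 5 := fun _ => rfl
  have e6 : ∀ {n : ℕ} (e : Fin n × Fin 2), Es e (Fin.last 3) 0 = Pe e 6 := fun _ => rfl
  refine ⟨e', ?_⟩
  rw [e5, e6, e5, e6, ht 5, ht 6]
  rcases this with ⟨h1, h2⟩ | ⟨h1, h2⟩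
  · left; rw [h1, h2]; exact ⟨rfl, rfl⟩
  · right; rw [h1, h2]; exact ⟨rfl, rfl⟩

def cv {n d : ℕ} (e : Fin n × Fin 2) : VV n d := Sum.inr (e, ⟨d + 2, by omega⟩)
def bv {n d : ℕ} (e : Fin n × Fin 2) : VV n d := Sum.inr (e, ⟨d + 1, by omega⟩)

theorem Es_0L {n d : ℕ} (e : Fin n × Fin 2) :
    Es e (0 : Fin (d + 1)) (Fin.last d) = s(bv e, Sum.inr (e, ⟨0, by omega⟩)) := by
  have : tg (0 : Fin (d + 1)) (Fin.last d) = ⟨d + 1, by omega⟩ := by simp [tg]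
  rw [Es, this, Sym2.eq_swap]
  rfl

theorem Es_L0 {n d : ℕ} (e : Fin n × Fin 2) :
    Es e (Fin.last d) (0 : Fin (d + 1)) = s(bv e, Sum.inr (e, ⟨d, by omega⟩)) := by
  have : tg (Fin.last d) (0 : Fin (d + 1)) = ⟨d + 1, by omega⟩ := by simp [tg]
  rw [Es, this, Sym2.eq_swap]
  rfl

theorem p_map {n n' d : ℕ} (hd : 3 ≤ d) (g : Sym2 (VV n d) → Sym2 (VV n' d))
    (hg1 : ∀ s ∈ ES n d, g s ∈ ES n' d)
    (hg2 : ∀ s ∈ ES n d, ∀ t ∈ ES n d, LA s t → LA (g s) (g t)) (e : Fin n × Fin 2) :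
    ∃ e', g s(bv e, cv e) = s(bv e', cv e') := by
  have hdr : ∃ e', (g (Es e 0 (Fin.last d)) = Es e' 0 (Fin.last d) ∧
        g (Es e (Fin.last d) 0) = Es e' (Fin.last d) 0) ∨
      (g (Es e 0 (Fin.last d)) = Es e' (Fin.last d) 0 ∧
        g (Es e (Fin.last d) 0) = Es e' 0 (Fin.last d)) := by
    rcases Nat.lt_or_ge 3 d with h | h
    · exact dragon4 h g hg1 hg2 e
    · obtain rfl : d = 3 := by omega
      exact dragon3 g hg1 hg2 e
  obtain ⟨e', h⟩ := hdr
  have h0L : (0 : Fin (d + 1)) ≠ Fin.last d := by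
    intro h; rw [Fin.ext_iff] at h; simp at h; omega
  have m1 := Es_mem e _ _ h0L
  have m2 := Es_mem e _ _ h0L.symm
  have mp : s(bv e, cv e) ∈ ES n d := by
    simp only [ES, SimpleGraph.mem_edgeSet, bv, cv, adj_rr, IA, true_and]; simp
  have l1 : LA (s(bv e, cv e) : Sym2 (VV n d)) (Es e 0 (Fin.last d)) := by
    rw [Es_0L]
    refine ⟨?_, bv e, Sym2.mem_mk_left _ _, Sym2.mem_mk_left _ _⟩
    simp [bv, cv]
  have l2 : LA (s(bv e, cv e) : Sym2 (VV n d)) (Es e (Fin.last d) 0) := by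
    rw [Es_L0]
    refine ⟨?_, bv e, Sym2.mem_mk_left _ _, Sym2.mem_mk_left _ _⟩
    simp [bv, cv]
  have k1 := hg2 _ mp _ m1 l1
  have k2 := hg2 _ mp _ m2 l2
  have mg := hg1 _ mp
  generalize g s(bv e, cv e) = w at *
  have k : LA w s(bv e', Sum.inr (e', ⟨0, by omega⟩)) ∧
      LA w s(bv e', Sum.inr (e', ⟨d, by omega⟩)) := by
    rw [← Es_0L, ← Es_L0]
    rcases h with ⟨h1, h2⟩ | ⟨h1, h2⟩
    · rw [h1] at k1; rw [h2] at k2; exact ⟨k1, k2⟩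
    · rw [h1] at k1; rw [h2] at k2; exact ⟨k2, k1⟩
  refine ⟨e', ?_⟩
  rcases LA_third (by simp; omega) k.1 k.2 with h | h
  · obtain ⟨r, rfl⟩ := h
    simp only [ES, SimpleGraph.mem_edgeSet] at mg
    rcases r with r | ⟨c, l⟩
    · rw [bv, adj_rl] at mg; simp at mg
    · rw [bv, adj_rr] at mg
      obtain ⟨rfl, mg⟩ := mg
      have n1 : l.val ≠ 0 := fun h => k.1.1 (by congr; exact Fin.ext h)
      have n2 : l.val ≠ d := fun h => k.2.1 (by congr; exact Fin.ext h)
      simp only [IA] at mg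
      have : l = ⟨d + 2, by omega⟩ := Fin.ext (by simp only; omega)
      rw [this, cv]
  · rw [h] at mg
    rw [SimpleGraph.mem_edgeSet, adj_rr] at mg
    have mg := mg.2
    change IA d 0 d at mg
    unfold IA at mg
    omega

theorem q_map {n d : ℕ} (e : Fin n × Fin 2) (w : Sym2 (VV n d)) (hw : w ∈ ES n d)
    (h : LA w s(bv e, cv e)) : (∃ x, w = s(Sum.inl x, cv e)) ∨
      ∃ k : Fin (d + 3), (k.val = 0 ∨ k.val = d) ∧ w = s(bv e, Sum.inr (e, k)) := by
  obtain ⟨hne, v, hv, hv'⟩ := h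
  rw [Sym2.mem_iff] at hv'
  rcases hv' with rfl | rfl
  · right
    obtain ⟨r, rfl⟩ := hv
    simp only [ES, SimpleGraph.mem_edgeSet] at hw
    rcases r with r | ⟨c, l⟩
    · rw [bv, adj_rl] at hw; simp at hw
    · rw [bv, adj_rr] at hw
      obtain ⟨rfl, hw⟩ := hw
      have n1 : l.val ≠ d + 2 := fun h => hne (by rw [cv]; congr; exact Fin.ext h)
      simp only [IA] at hw
      exact ⟨l, by omega, rfl⟩
  · left
    obtain ⟨r, rfl⟩ := hv
    simp only [ES, SimpleGraph.mem_edgeSet] at hw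
    rcases r with r | ⟨c, l⟩
    · exact ⟨r, Sym2.eq_swap⟩
    · rw [cv, adj_rr] at hw
      obtain ⟨rfl, hw⟩ := hw
      exfalso
      have n1 : l.val ≠ d + 1 := fun h => hne (by
        rw [Sym2.eq_swap, bv]; congr; exact Fin.ext h)
      simp only [IA] at hw
      omega

def QT {n d : ℕ} (w : Sym2 (VV n d)) : Prop :=
  (∃ e x, w = s(Sum.inl x, cv e)) ∨
      ∃ e, ∃ k : Fin (d + 3), (k.val = 0 ∨ k.val = d) ∧ w = s(bv e, Sum.inr (e, k))

theorem QT_good {n d : ℕ} (hd : 3 ≤ d) {w1 w2 w3 : Sym2 (VV n d)} (h1 : QT w1) (h2 : QT w2)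
    (h3 : QT w3) (l12 : LA w1 w2) (l13 : LA w1 w3) (l23 : LA w2 w3) :
    ∃ e x, w1 = s(Sum.inl x, cv e) := by
  rcases h1 with h1 | ⟨e, k, hk, rfl⟩
  · exact h1
  exfalso
  have aux : ∀ w, QT w → LA s(bv e, Sum.inr (e, k)) w →
      ∃ l : Fin (d + 3), l.val = d - k.val ∧ w = s(bv e, Sum.inr (e, l)) := by
    rintro w (⟨e', x, rfl⟩ | ⟨e', l, hl, rfl⟩) ⟨hne, v, hv, hv'⟩
    · exfalso
      simp only [Sym2.mem_iff] at hv hv'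
      rcases hv with rfl | rfl <;> rcases hv' with h | h <;> simp [bv, cv, Fin.ext_iff] at h
      omega
    · simp only [Sym2.mem_iff] at hv hv'
      have : e = e' := by
        rcases hv with rfl | rfl <;> rcases hv' with h | h <;>
          simp only [bv, Sum.inr.injEq, Prod.mk.injEq] at h <;> exact h.1
      subst this
      refine ⟨l, ?_, rfl⟩
      have : k.val ≠ l.val := fun h => hne (by rw [Fin.ext h])
      omega
  obtain ⟨l, hl, rfl⟩ := aux _ h2 l12
  obtain ⟨m, hm, rfl⟩ := aux _ h3 l13
  exact l23.1 (by rw [Fin.ext (hl.trans hm.symm)])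

theorem image_tri {n d : ℕ} (hd : 3 ≤ d) {w1 w2 w3 : Sym2 (VV n d)} (h1 : QT w1) (h2 : QT w2)
    (h3 : QT w3) (m1 : w1 ∈ ES n d) (m2 : w2 ∈ ES n d) (m3 : w3 ∈ ES n d)
    (l12 : LA w1 w2) (l13 : LA w1 w3) (l23 : LA w2 w3) :
    ∃ j : Fin n, ∀ w, w ∈ ES n d → ((Sum.inl (Sum.inl j) ∈ w) ↔ w = w1 ∨ w = w2 ∨ w = w3) := by
  obtain ⟨e1, x1, rfl⟩ := QT_good hd h1 h2 h3 l12 l13 l23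
  obtain ⟨e2, x2, rfl⟩ := QT_good hd h2 h1 h3 l12.symm l23 l13
  obtain ⟨e3, x3, rfl⟩ := QT_good hd h3 h1 h2 l13.symm l23.symm l12
  have aux : ∀ (x y : Fin n ⊕ Fin n) (e e' : Fin n × Fin 2),
      LA (s(Sum.inl x, cv e) : Sym2 (VV n d)) s(Sum.inl y, cv e') →
      (x = y ∧ e ≠ e') ∨ (x ≠ y ∧ e = e') := by
    rintro x y e e' ⟨hne, v, hv, hv'⟩
    simp only [Sym2.mem_iff] at hv hv'
    by_cases hx : x = y
    · subst hx
      left; refine ⟨rfl, ?_⟩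
      rintro rfl
      exact hne rfl
    · right; refine ⟨hx, ?_⟩
      rcases hv with rfl | rfl <;> rcases hv' with h | h <;> simp [cv] at h
      · exact absurd h hx
      · exact h
  have a12 := aux _ _ _ _ l12
  have a13 := aux _ _ _ _ l13
  have a23 := aux _ _ _ _ l23
  simp only [ES, SimpleGraph.mem_edgeSet, cv, adj_lr, true_and] at m1 m2 m3
  have hx : x1 = x2 ∧ x1 = x3 ∧ e1 ≠ e2 ∧ e1 ≠ e3 ∧ e2 ≠ e3 := by
    obtain ⟨a, b, hab⟩ := LR_two e1
    have := hab x1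
    have := hab x2
    have := hab x3
    grind
  obtain ⟨rfl, rfl, n12, n13, n23⟩ := hx
  rcases x1 with j | j
  · refine ⟨j, fun w hw => ⟨?_, ?_⟩⟩
    · rintro ⟨r, rfl⟩
      simp only [ES, SimpleGraph.mem_edgeSet] at hw
      rcases r with r | ⟨e, k⟩
      · exact absurd hw (adj_ll _ _)
      · rw [adj_lr] at hw
        obtain ⟨hk, hw⟩ := hw
        have hk' : k = ⟨d + 2, Nat.lt_succ_self _⟩ := Fin.ext hk
        subst hk'
        obtain ⟨a, b, c, -, -, -, H⟩ := LR_three j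
        rw [H] at m1 m2 m3 hw
        have : e = e1 ∨ e = e2 ∨ e = e3 := by grind
        rcases this with rfl | rfl | rfl
        · left; rfl
        · right; left; rfl
        · right; right; rfl
    · rintro (rfl | rfl | rfl) <;> exact Sym2.mem_mk_left _ _
  · exfalso
    exact n12 ((LR_pend _ _ m1).trans (LR_pend _ _ m2).symm)

theorem lg_adj {V : Type*} (G : SimpleGraph V) (x y : G.edgeSet) :
    G.lineGraph.Adj x y ↔ LA x.1 y.1 := by
  rw [SimpleGraph.lineGraph_adj_iff_exists]
  simp [LA, Subtype.ext_iff]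

/-- **Connecting triangles map to connecting triangles.** For `d, n, n' ≥ 3`, every
graph homomorphism `L(G_{n,d}) → L(G_{n',d})` maps each connecting triangle onto a
connecting triangle. -/
theorem hom_maps_connTriangle_to_connTriangle (d n n' : ℕ)
    (hd : 3 ≤ d) (hn : 3 ≤ n) (hn' : 3 ≤ n')
    (f : (sunletIndicator n d).lineGraph →g (sunletIndicator n' d).lineGraph)
    (i : Fin n) :
    ∃ j : Fin n', ⇑f '' connTriangle n d i = connTriangle n' d j := by
  classical
  let g : Sym2 (VV n d) → Sym2 (VV n' d) := fun s =>
    if h : s ∈ ES n d then (f ⟨s, h⟩).1 else s(Sum.inl (Sum.inl ⟨0, by omega⟩), Sum.inl (Sum.inl ⟨0, by omega⟩))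
  have hg : ∀ s (h : s ∈ ES n d), g s = (f ⟨s, h⟩).1 := fun s h => by simp only [g, dif_pos h]
  have hg1 : ∀ s ∈ ES n d, g s ∈ ES n' d := fun s h => by rw [hg s h]; exact (f ⟨s, h⟩).2
  have hg2 : ∀ s ∈ ES n d, ∀ t ∈ ES n d, LA s t → LA (g s) (g t) := by
    intro s hs t ht h
    rw [hg s hs, hg t ht]
    exact (lg_adj _ _ _).1 (f.map_rel ((lg_adj _ ⟨s, hs⟩ ⟨t, ht⟩).2 h))
  have hq : ∀ e, LR (Sum.inl i) e → s(Sum.inl (Sum.inl i), cv e) ∈ ES n d := by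
    intro e he
    simp only [ES, SimpleGraph.mem_edgeSet, cv, adj_lr]
    exact ⟨trivial, he⟩
  have hQT : ∀ e, LR (Sum.inl i) e → QT (g s(Sum.inl (Sum.inl i), cv e)) := by
    intro e he
    obtain ⟨e', h⟩ := p_map hd g hg1 hg2 e
    have mp : s(bv e, cv e) ∈ ES n d := by
      simp only [ES, SimpleGraph.mem_edgeSet, bv, cv, adj_rr, IA, true_and]; simp
    have := hg2 _ (hq e he) _ mp ⟨by simp [bv, cv], cv e, Sym2.mem_mk_right _ _,
      Sym2.mem_mk_right _ _⟩
    rw [h] at this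
    rcases q_map e' _ (hg1 _ (hq e he)) this with h | h
    · exact Or.inl ⟨e', h⟩
    · exact Or.inr ⟨e', h⟩
  have hLA : ∀ e e', LR (Sum.inl i) e → LR (Sum.inl i) e' → e ≠ e' →
      LA (g s(Sum.inl (Sum.inl i), cv e)) (g s(Sum.inl (Sum.inl i), cv e')) := by
    intro e e' he he' hne
    refine hg2 _ (hq e he) _ (hq e' he') ⟨?_, _, Sym2.mem_mk_left _ _, Sym2.mem_mk_left _ _⟩
    simpa [cv] using hne
  obtain ⟨a, b, c, hab, hac, hbc, H⟩ := LR_three i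
  have hac := hac (by omega)
  have ha := (H a).2 (by simp)
  have hb := (H b).2 (by simp)
  have hc := (H c).2 (by simp)
  obtain ⟨j, hj⟩ := image_tri hd (hQT a ha) (hQT b hb) (hQT c hc) (hg1 _ (hq a ha))
    (hg1 _ (hq b hb)) (hg1 _ (hq c hc)) (hLA a b ha hb hab) (hLA a c ha hc hac) (hLA b c hb hc hbc)
  refine ⟨j, ?_⟩
  ext w
  constructor
  · rintro ⟨⟨s, hs⟩, hi, rfl⟩
    refine (hj _ (f ⟨s, hs⟩).2).2 ?_
    rw [← hg s hs]
    change Sum.inl (Sum.inl i) ∈ s at hi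
    obtain ⟨r, rfl⟩ := hi
    have hs' := hs
    simp only [SimpleGraph.mem_edgeSet] at hs'
    rcases r with r | ⟨e, k⟩
    · exact absurd hs' (adj_ll _ _)
    · rw [adj_lr, H] at hs'
      obtain ⟨hk, h⟩ := hs'
      have hk' : k = ⟨d + 2, Nat.lt_succ_self _⟩ := Fin.ext hk
      subst hk'
      rcases h with rfl | rfl | rfl
      · left; rfl
      · right; left; rfl
      · right; right; rfl
  · intro hw
    have fin : ∀ e, LR (Sum.inl i) e → w.1 = g s(Sum.inl (Sum.inl i), cv e) →
        w ∈ f '' connTriangle n d i := by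
      intro e he h
      refine ⟨⟨_, hq e he⟩, Sym2.mem_mk_left _ _, ?_⟩
      apply Subtype.ext
      rw [h, hg _ (hq e he)]
    rcases (hj _ w.2).1 hw with h | h | h
    · exact fin a ha h
    · exact fin b hb h
    · exact fin c hc h
end

section
/- For every d ≥ 3 and all finite nonempty sets A and B of positive integers, there exists a graph homomorphism from the disjoint union of the graphs L(G_{3a,d}) over a ∈ A to the disjoint union of the graphs L(G_{3b,d}) over b ∈ B if and only if for every a ∈ A there exists b ∈ B such that b divides a. -/
open SimpleGraph

namespace LGH

abbrev WT (m d : ℕ) := (Fin m ⊕ Fin m) ⊕ ((Fin m × Fin 2) × Fin (d + 3))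

def V {m d : ℕ} (e : Fin m × Fin 2) (k : ℕ) : WT m d :=
  Sum.inr (e, ⟨k % (d+3), Nat.mod_lt _ (by omega)⟩)

def nadj (d k l : ℕ) : Prop :=
  k ≠ l ∧ ((k ≤ d ∧ l ≤ d ∧ ¬(k = 0 ∧ l = d) ∧ ¬(k = d ∧ l = 0)) ∨
    (k = d+1 ∧ (l = 0 ∨ l = d ∨ l = d+2)) ∨ (l = d+1 ∧ (k = 0 ∨ k = d ∨ k = d+2)))

instance (d k l : ℕ) : Decidable (nadj d k l) := by unfold nadj; infer_instance

def inc {m : ℕ} (x : Fin m ⊕ Fin m) (e : Fin m × Fin 2) : Prop :=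
  x = Sum.inl e.1 ∨
         (e.2.val = 0 ∧ ∃ j : Fin m, j.val = (e.1.val + 1) % m ∧ x = Sum.inl j) ∨
         (e.2.val = 1 ∧ x = Sum.inr e.1)

theorem V_inj {m d : ℕ} {e e' : Fin m × Fin 2} {k l : ℕ} (hk : k < d+3) (hl : l < d+3) :
    (V e k : WT m d) = V e' l ↔ e = e' ∧ k = l := by
  simp [V, Nat.mod_eq_of_lt hk, Nat.mod_eq_of_lt hl]

theorem V_ne_inl {m d : ℕ} {e : Fin m × Fin 2} {k : ℕ} {x} :
    (V e k : WT m d) ≠ Sum.inl x := by simp [V]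

theorem cases_W {m d : ℕ} (w : WT m d) :
    (∃ x, w = Sum.inl x) ∨ ∃ e k, k < d+3 ∧ w = V e k := by
  rcases w with x | ⟨e, k⟩
  · exact Or.inl ⟨x, rfl⟩
  · right; refine ⟨e, k, k.2, ?_⟩
    simp [V, Nat.mod_eq_of_lt k.2]

theorem nadj_symm {d k l : ℕ} (h : nadj d k l) : nadj d l k := by
  unfold nadj at *; omega

theorem nadj_lt {d k l : ℕ} (h : nadj d k l) : k < d+3 ∧ l < d+3 := by
  unfold nadj at *; omega

theorem adj_VV {m d : ℕ} {e e' : Fin m × Fin 2} {k l : ℕ} (hk : k < d+3) (hl : l < d+3) :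
    (sunletIndicator m d).Adj (V e k) (V e' l) ↔ e = e' ∧ nadj d k l := by
  have h := V_inj (e := e) (e' := e') hk hl
  simp only [sunletIndicator, SimpleGraph.fromRel_adj, ne_eq, h]
  simp only [V, Nat.mod_eq_of_lt hk, Nat.mod_eq_of_lt hl, indicatorInternalRel, dragonRel]
  constructor
  · rintro ⟨h1, (⟨rfl, h2⟩ | ⟨rfl, h2⟩)⟩ <;> refine ⟨rfl, ?_⟩ <;> unfold nadj <;> simp at h1 <;> omega
  · rintro ⟨rfl, h1⟩
    unfold nadj at h1
    refine ⟨by simp; omega, ?_⟩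
    simp only [true_and]
    omega

theorem adj_IV {m d : ℕ} {e : Fin m × Fin 2} {k : ℕ} {x} (hk : k < d+3) :
    (sunletIndicator m d).Adj (Sum.inl x) (V e k) ↔ k = d+2 ∧ inc x e := by
  simp only [sunletIndicator, SimpleGraph.fromRel_adj, V, Nat.mod_eq_of_lt hk, inc]
  simp

theorem adj_II {m d : ℕ} {x y} : ¬ (sunletIndicator m d).Adj (Sum.inl x) (Sum.inl y) := by
  simp [sunletIndicator]

/-- line adjacency -/
def LA {W : Type*} (p q : Sym2 W) : Prop := p ≠ q ∧ ∃ x, x ∈ p ∧ x ∈ q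

theorem LA.symm {W : Type*} {p q : Sym2 W} (h : LA p q) : LA q p :=
  ⟨h.1.symm, h.2.imp fun _ h => h.symm⟩

/-- neighbours of a core or dragon-tip vertex -/
theorem adj_V_le {m d : ℕ} {e : Fin m × Fin 2} {k : ℕ} (hk : k ≤ d+1) {w : WT m d}
    (h : (sunletIndicator m d).Adj (V e k) w) : ∃ l, nadj d k l ∧ w = V e l := by
  rcases cases_W w with ⟨x, rfl⟩ | ⟨e', l, hl, rfl⟩
  · have := (adj_IV (by omega)).1 h.symm
    omega
  · obtain ⟨rfl, h'⟩ := (adj_VV (by omega) hl).1 h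
    exact ⟨l, h', rfl⟩

theorem adj_V_c {m d : ℕ} {e : Fin m × Fin 2} {w : WT m d}
    (h : (sunletIndicator m d).Adj (V e (d+2)) w) :
    w = V e (d+1) ∨ ∃ x, inc x e ∧ w = Sum.inl x := by
  rcases cases_W w with ⟨x, rfl⟩ | ⟨e', l, hl, rfl⟩
  · have := (adj_IV (by omega)).1 h.symm
    exact Or.inr ⟨x, this.2, rfl⟩
  · obtain ⟨rfl, h'⟩ := (adj_VV (by omega) hl).1 h
    left; congr 1; unfold nadj at h'; omega

theorem adj_inl {m d : ℕ} {x} {w : WT m d}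
    (h : (sunletIndicator m d).Adj (Sum.inl x) w) :
    ∃ e, inc x e ∧ w = V e (d+2) := by
  rcases cases_W w with ⟨x, rfl⟩ | ⟨e', l, hl, rfl⟩
  · exact absurd h adj_II
  · obtain ⟨rfl, h'⟩ := (adj_IV hl).1 h
    exact ⟨e', h', rfl⟩

/-- at most two ends -/
theorem inc_two {m : ℕ} {x y z : Fin m ⊕ Fin m} {e} (hx : inc x e) (hy : inc y e) (hz : inc z e)
    (h1 : x ≠ y) (h2 : x ≠ z) (h3 : y ≠ z) : False := by
  obtain ⟨i, s⟩ := e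
  unfold inc at *
  have : ∀ j j' : Fin m, j.val = (i.val+1) % m → j'.val = (i.val+1)%m → j = j' := by
    intro j j' h h'; exact Fin.ext (by omega)
  grind

theorem succ_inj {m a b : ℕ} (ha : a < m) (hb : b < m) (h : (a+1) % m = (b+1) % m) : a = b := by
  have : (a + 1) ≡ (b+1) [MOD m] := h
  have := Nat.ModEq.add_right_cancel' 1 this
  exact Nat.ModEq.eq_of_lt_of_lt this ha hb

theorem inc_pend {m : ℕ} {i : Fin m} {e} (h : inc (Sum.inr i) e) : e = (i, 1) := by
  obtain ⟨j, s⟩ := e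
  unfold inc at h
  simp at h
  ext
  · simp [h.2]
  · simp [h.1]

theorem inc_cyc {m : ℕ} {i : Fin m} {e} (h : inc (Sum.inl i) e) :
    e = (i, 1) ∨ e = (i, 0) ∨ (e.2 = 0 ∧ (e.1.val+1) % m = i.val) := by
  obtain ⟨j, s⟩ := e
  unfold inc at h
  simp at h
  rcases h with rfl | ⟨h, h'⟩
  · fin_cases s <;> simp
  · right; right; constructor
    · exact h
    · exact h'.symm

theorem inc_three {m : ℕ} {x : Fin m ⊕ Fin m} {e1 e2 e3 e4} (h1 : inc x e1) (h2 : inc x e2)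
    (h3 : inc x e3) (h4 : inc x e4) (h12 : e1 ≠ e2) (h13 : e1 ≠ e3) (h14 : e1 ≠ e4)
    (h23 : e2 ≠ e3) (h24 : e2 ≠ e4) (h34 : e3 ≠ e4) : False := by
  rcases x with i | i
  · have key : ∀ e e' : Fin m × Fin 2, (e.2 = 0 ∧ (e.1.val+1) % m = i.val) →
        (e'.2 = 0 ∧ (e'.1.val+1) % m = i.val) → e = e' := by
      rintro ⟨a, s⟩ ⟨b, t⟩ ⟨h, h'⟩ ⟨h'', h'''⟩
      ext
      · exact succ_inj a.2 b.2 (h'.trans h'''.symm)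
      · simp at *; simp [h, h'']
    have := inc_cyc h1
    have := inc_cyc h2
    have := inc_cyc h3
    have := inc_cyc h4
    grind
  · exact h12 ((inc_pend h1).trans (inc_pend h2).symm)

/-- a vertex that is not a core vertex -/
theorem low_deg {m d : ℕ} {x : WT m d} (hx : ∀ e k, k ≤ d → x ≠ V e k) {a b c f : WT m d}
    (ha : (sunletIndicator m d).Adj x a) (hb : (sunletIndicator m d).Adj x b)
    (hc : (sunletIndicator m d).Adj x c) (hf : (sunletIndicator m d).Adj x f)
    (h12 : a ≠ b) (h13 : a ≠ c) (h14 : a ≠ f)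
    (h23 : b ≠ c) (h24 : b ≠ f) (h34 : c ≠ f) : False := by
  rcases cases_W x with ⟨x, rfl⟩ | ⟨e, k, hk, rfl⟩
  · obtain ⟨e1, i1, rfl⟩ := adj_inl ha
    obtain ⟨e2, i2, rfl⟩ := adj_inl hb
    obtain ⟨e3, i3, rfl⟩ := adj_inl hc
    obtain ⟨e4, i4, rfl⟩ := adj_inl hf
    apply inc_three i1 i2 i3 i4 <;> rintro rfl <;> contradiction
  · have hk' : ¬ k ≤ d := fun h => hx e k h rfl
    obtain rfl | rfl : k = d+1 ∨ k = d+2 := by omega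
    · obtain ⟨e1, i1, rfl⟩ := adj_V_le (by omega) ha
      obtain ⟨e2, i2, rfl⟩ := adj_V_le (by omega) hb
      obtain ⟨e3, i3, rfl⟩ := adj_V_le (by omega) hc
      obtain ⟨e4, i4, rfl⟩ := adj_V_le (by omega) hf
      have : e1 ≠ e2 := by rintro rfl; contradiction
      have : e1 ≠ e3 := by rintro rfl; contradiction
      have : e1 ≠ e4 := by rintro rfl; contradiction
      have : e2 ≠ e3 := by rintro rfl; contradiction
      have : e2 ≠ e4 := by rintro rfl; contradiction
      have : e3 ≠ e4 := by rintro rfl; contradiction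
      unfold nadj at *
      omega
    · have key : ∀ x y z : WT m d, (∃ u, inc u e ∧ x = Sum.inl u) → (∃ u, inc u e ∧ y = Sum.inl u) →
        (∃ u, inc u e ∧ z = Sum.inl u) → x ≠ y → x ≠ z → y ≠ z → False := by
        rintro _ _ _ ⟨u, hu, rfl⟩ ⟨v, hv, rfl⟩ ⟨w, hw, rfl⟩ h1 h2 h3
        apply inc_two hu hv hw <;> rintro rfl <;> contradiction
      have k1 := key a b c
      have k2 := key a b f
      have k3 := key a c f
      have k4 := key b c f
      clear key
      rcases adj_V_c ha with h1 | h1 <;> rcases adj_V_c hb with h2 | h2 <;>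
        rcases adj_V_c hc with h3 | h3 <;> rcases adj_V_c hf with h4 | h4 <;>
        first
        | exact h12 (h1.trans h2.symm)
        | exact h13 (h1.trans h3.symm)
        | exact h14 (h1.trans h4.symm)
        | exact h23 (h2.trans h3.symm)
        | exact h24 (h2.trans h4.symm)
        | exact h34 (h3.trans h4.symm)
        | exact k1 h1 h2 h3 h12 h13 h23
        | exact k2 h1 h2 h4 h12 h14 h24
        | exact k3 h1 h3 h4 h13 h14 h34
        | exact k4 h2 h3 h4 h23 h24 h34

theorem low_indep {m d : ℕ} (hd : 3 ≤ d) {x : WT m d} (hx : ∀ e k, k ≤ d → x ≠ V e k) {a b : WT m d}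
    (ha : (sunletIndicator m d).Adj x a) (hb : (sunletIndicator m d).Adj x b) :
    ¬ (sunletIndicator m d).Adj a b := by
  intro hab
  rcases cases_W x with ⟨x, rfl⟩ | ⟨e, k, hk, rfl⟩
  · obtain ⟨e1, i1, rfl⟩ := adj_inl ha
    obtain ⟨e2, i2, rfl⟩ := adj_inl hb
    have := ((adj_VV (by omega) (by omega)).1 hab).2
    unfold nadj at this; omega
  · have hk' : ¬ k ≤ d := fun h => hx e k h rfl
    obtain rfl | rfl : k = d+1 ∨ k = d+2 := by omega
    · obtain ⟨e1, i1, rfl⟩ := adj_V_le (by omega) ha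
      obtain ⟨e2, i2, rfl⟩ := adj_V_le (by omega) hb
      have := ((adj_VV (nadj_lt i1).2 (nadj_lt i2).2).1 hab).2
      unfold nadj at *; omega
    · rcases adj_V_c ha with rfl | ⟨u, hu, rfl⟩ <;> rcases adj_V_c hb with rfl | ⟨v, hv, rfl⟩
      · exact hab.ne rfl
      · have := (adj_IV (by omega)).1 hab.symm
        omega
      · have := (adj_IV (by omega)).1 hab
        omega
      · exact adj_II hab


theorem common_aux {W : Type*} {p q r s : Sym2 W} {x : W} (h1 : LA p q) (h2 : LA p r) (h3 : LA q r)
    (h4 : LA p s) (h5 : LA q s) (h6 : LA r s) (hp : x ∈ p) (hq : x ∈ q) : x ∈ r := by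
  obtain ⟨a, rfl⟩ := Sym2.mem_iff_exists.1 hp
  obtain ⟨b, rfl⟩ := Sym2.mem_iff_exists.1 hq
  induction r with | _ r1 r2
  induction s with | _ s1 s2
  simp only [LA, Sym2.mem_iff, ne_eq, Sym2.eq_iff] at *
  grind

theorem common {W : Type*} (F : ℕ → Sym2 W) (S : Finset ℕ) (hS : 4 ≤ S.card)
    (hF : ∀ i ∈ S, ∀ j ∈ S, i ≠ j → LA (F i) (F j)) : ∃ x, ∀ i ∈ S, x ∈ F i := by
  obtain ⟨i, hi, j, hj, hij⟩ := Finset.one_lt_card.1 (by omega : 1 < S.card)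
  obtain ⟨x, hx, hx'⟩ := (hF i hi j hj hij).2
  refine ⟨x, fun k hk => ?_⟩
  by_cases h1 : k = i
  · rwa [h1]
  by_cases h2 : k = j
  · rwa [h2]
  have : ∃ l ∈ S, l ∉ ({i, j, k} : Finset ℕ) := by
    by_contra hcon
    push Not at hcon
    have := Finset.card_le_card (show S ⊆ {i,j,k} from hcon)
    have := Finset.card_le_three (a := i) (b := j) (c := k)
    omega
  obtain ⟨l, hl, hl'⟩ := this
  simp only [Finset.mem_insert, Finset.mem_singleton, not_or] at hl'
  exact common_aux (hF i hi j hj hij) (hF i hi k hk (Ne.symm h1)) (hF j hj k hk (Ne.symm h2))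
    (hF i hi l hl (Ne.symm hl'.1)) (hF j hj l hl (Ne.symm hl'.2.1)) (hF k hk l hl (Ne.symm hl'.2.2)) hx hx'

def rho (d u v : ℕ) : ℕ := if (u = 0 ∧ v = d) ∨ (u = d ∧ v = 0) then d+1 else v

def Nb (d u : ℕ) : Finset ℕ := (Finset.range (d+3)).filter (nadj d u)

theorem mem_Nb {d u v : ℕ} : v ∈ Nb d u ↔ nadj d u v := by
  simp only [Nb, Finset.mem_filter, Finset.mem_range, and_iff_right_iff_imp]
  exact fun h => (nadj_lt h).2

theorem nadj_rho {d u v : ℕ} (hd : 3 ≤ d) (hu : u ≤ d) (hv : v ≤ d) (h : u ≠ v) :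
    nadj d u (rho d u v) := by
  unfold nadj rho; split_ifs <;> omega

theorem rho_inj {d u v v' : ℕ} (hd : 3 ≤ d) (hu : u ≤ d) (hv : v ≤ d) (hv' : v' ≤ d)
    (h : rho d u v = rho d u v') : v = v' := by
  unfold rho at h; split_ifs at h <;> omega

theorem card_Nb {d u : ℕ} (hd : 3 ≤ d) (hu : u ≤ d) : (Nb d u).card = d := by
  have : Nb d u = ((Finset.range (d+1)).erase u).image (rho d u) := by
    ext v
    simp only [mem_Nb, Finset.mem_image, Finset.mem_erase, Finset.mem_range]
    constructor
    · intro h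
      by_cases hv : v = d+1
      · refine ⟨d - u, ?_, ?_⟩
        · unfold nadj at h; omega
        · unfold nadj at h; unfold rho; split_ifs <;> omega
      · refine ⟨v, ?_, ?_⟩
        · unfold nadj at h; omega
        · unfold nadj at h; unfold rho; split_ifs <;> omega
    · rintro ⟨w, hw, rfl⟩
      exact nadj_rho hd hu (by omega) (by omega)
  rw [this, Finset.card_image_of_injOn, Finset.card_erase_of_mem] <;> simp
  · omega
  · intro v hv v' hv' h
    simp at hv hv'
    exact rho_inj hd hu (by omega) (by omega) h

theorem z2 (z : ZMod 2) : z = 0 ∨ z = 1 := by revert z; decide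

open Classical in
theorem parity {T : Type*} {d : ℕ} (hd : 3 ≤ d) (q E : ℕ → ℕ → T) (φ : ℕ → ℕ)
    (qs : ∀ u v, q u v = q v u) 
    (qi : ∀ u v v', nadj d u v → nadj d u v' → q u v = q u v' → v = v')
    (hφ : ∀ u ≤ d, φ u ≤ d)
    (hin : ∀ u v, u ≤ d → nadj d u v → ∃ l, nadj d (φ u) l ∧ q u v = E (φ u) l)
    (hsurj : ∀ u l, u ≤ d → nadj d (φ u) l → ∃ v, nadj d u v ∧ q u v = E (φ u) l)
    (Es : ∀ u v, E u v = E v u)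
    (Ei : ∀ w w' z z', nadj d w w' → nadj d z z' → E w w' = E z z' →
      (w = z ∧ w' = z') ∨ (w = z' ∧ w' = z)) 
    (hne : q 0 (d+1) ≠ q d (d+1)) :
    (q 0 (d+1) = E 0 (d+1) ∧ q d (d+1) = E d (d+1)) ∨
    (q 0 (d+1) = E d (d+1) ∧ q d (d+1) = E 0 (d+1)) := by
  set x : ℕ → ZMod 2 := fun w => ∑ u ∈ Finset.range (d+1), if φ u = w then 1 else 0 with hx
  have hA : ∀ w w', w ≤ d+1 → w' ≤ d+1 → nadj d w w' → x w + x w' =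
      (if q 0 (d+1) = E w w' then 1 else 0) + (if q d (d+1) = E w w' then 1 else 0) := by
    intro w w' hw hw' hww
    have hpt : ∀ u ∈ Finset.range (d+1), ((if φ u = w then 1 else 0) + (if φ u = w' then 1 else 0) : ZMod 2)
        = ∑ v ∈ Finset.range (d+3), if nadj d u v ∧ q u v = E w w' then 1 else 0 := by
      intro u hu
      have hu : u ≤ d := by simpa [Nat.lt_succ_iff] using hu
      have hnew : w ≠ w' := hww.1
      by_cases h : φ u = w ∨ φ u = w'
      · have h1 : ((if φ u = w then 1 else 0) + (if φ u = w' then 1 else 0) : ZMod 2) = 1 := by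
          rcases h with h | h
          · rw [if_pos h, if_neg (by rw [h]; exact hnew), add_zero]
          · rw [if_pos h, if_neg (by rw [h]; exact hnew.symm), zero_add]
        have h2 : ∃ v, nadj d u v ∧ q u v = E w w' := by
          rcases h with h | h
          · have := hsurj u w' hu (by rwa [h])
            rwa [h] at this
          · have := hsurj u w hu (by rw [h]; exact nadj_symm hww)
            rwa [h, Es] at this
        obtain ⟨v, hv, hv'⟩ := h2
        rw [h1, Finset.sum_eq_single v]
        · rw [if_pos ⟨hv, hv'⟩]
        · intro b _ hb
          rw [if_neg]
          rintro ⟨h3, h4⟩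
          exact hb (qi u b v h3 hv (h4.trans hv'.symm))
        · intro h; exact absurd (Finset.mem_range.2 (nadj_lt hv).2) h
      · push Not at h
        rw [if_neg h.1, if_neg h.2, Finset.sum_eq_zero, add_zero]
        intro v _
        rw [if_neg]
        rintro ⟨h3, h4⟩
        obtain ⟨l, hl, hl'⟩ := hin u v hu h3
        rcases Ei _ _ _ _ hl hww (hl'.symm.trans h4) with h5 | h5
        · exact h.1 h5.1
        · exact h.2 h5.1
    simp only [hx]
    rw [← Finset.sum_add_distrib, Finset.sum_congr rfl hpt]
    simp only [Finset.sum_range_succ _ (d+2), Finset.sum_range_succ _ (d+1), Finset.sum_add_distrib (s := Finset.range (d+1))]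
    have s1 : ∑ u ∈ Finset.range (d+1), ∑ v ∈ Finset.range (d+1),
        (if nadj d u v ∧ q u v = E w w' then 1 else 0 : ZMod 2) = 0 := by
      rw [← Finset.sum_product']
      apply Finset.sum_involution (fun p _ => (p.2, p.1))
      · rintro ⟨u, v⟩ -
        have : (nadj d u v ∧ q u v = E w w') ↔ (nadj d v u ∧ q v u = E w w') := by
          rw [qs u v]
          exact ⟨fun h => ⟨nadj_symm h.1, h.2⟩, fun h => ⟨nadj_symm h.1, h.2⟩⟩
        simp only [this]
        split_ifs
        · decide
        · simp
      · rintro ⟨u, v⟩ - h1 h2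
        simp only [Prod.mk.injEq] at h2
        apply h1
        simp only
        rw [if_neg]
        rintro ⟨h3, -⟩
        exact h3.1 h2.2
      · rintro ⟨u, v⟩ h
        simp only [Finset.mem_product] at h ⊢
        exact h.symm
      · intro a _; rfl
    have s2 : ∑ u ∈ Finset.range (d+1),
        (if nadj d u (d+2) ∧ q u (d+2) = E w w' then 1 else 0 : ZMod 2) = 0 := by
      apply Finset.sum_eq_zero
      intro u hu
      rw [if_neg]
      rintro ⟨h, -⟩
      simp at hu
      unfold nadj at h; omega
    have s3 : ∑ u ∈ Finset.range (d+1),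
        (if nadj d u (d+1) ∧ q u (d+1) = E w w' then 1 else 0 : ZMod 2) = 
        (if q 0 (d+1) = E w w' then 1 else 0) + (if q d (d+1) = E w w' then 1 else 0) := by
      rw [Finset.sum_eq_add 0 d (by omega)]
      · have h0 : nadj d 0 (d+1) := by unfold nadj; omega
        have h1 : nadj d d (d+1) := by unfold nadj; omega
        simp [h0, h1]
      · intro c hc hc'
        rw [if_neg]
        rintro ⟨h, -⟩
        simp at hc
        unfold nadj at h; omega
      · simp
      · simp
    rw [s1, s2, s3]; simp
  have xd : x (d+1) = 0 := by
    simp only [hx]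
    apply Finset.sum_eq_zero
    intro u hu
    simp at hu
    have := hφ u (by omega)
    rw [if_neg (by omega)]
  have hB : ∀ w w', w ≤ d+1 → w' ≤ d+1 → nadj d w w' → x w = 1 → x w' = 0 → 
      E w w' = q 0 (d+1) ∨ E w w' = q d (d+1) := by
    intro w w' h1 h2 h3 h4 h5
    have := hA w w' h1 h2 h3
    rw [h4, h5] at this
    by_contra hcon
    push Not at hcon
    rw [if_neg hcon.1.symm, if_neg hcon.2.symm] at this
    revert this; decide
  have hone : ∃ a, a ≤ d ∧ x a = 1 := by
    have h0 : nadj d 0 (d+1) := by unfold nadj; omega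
    obtain ⟨l, hl, hl'⟩ := hin 0 (d+1) (by omega) h0
    have hp := hφ 0 (by omega)
    have hld : l ≤ d + 1 := by unfold nadj at hl; omega
    have := hA _ _ (by omega) hld hl
    rw [if_pos hl', if_neg (by rw [← hl']; exact hne.symm)] at this
    rcases z2 (x (φ 0)) with h | h
    · refine ⟨l, ?_, ?_⟩
      · by_contra hcon
        obtain rfl : l = d+1 := by omega
        rw [h, xd] at this
        revert this; decide
      · rw [h] at this; simpa using this
    · exact ⟨_, hp, h⟩
  obtain ⟨a, ha, xa⟩ := hone
  by_cases hall : ∀ b ≤ d, x b = 1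
  · have n0 : nadj d 0 (d+1) := by unfold nadj; omega
    have nd : nadj d d (d+1) := by unfold nadj; omega
    have h1 := hB 0 (d+1) (by omega) (by omega) n0 (hall _ (by omega)) xd
    have h2 := hB d (d+1) (by omega) (by omega) nd (hall _ (by omega)) xd
    have h3 : E 0 (d+1) ≠ E d (d+1) := by
      intro h
      have := Ei _ _ _ _ n0 nd h
      omega
    grind
  · exfalso
    push Not at hall
    obtain ⟨b, hb, xb⟩ := hall
    replace xb : x b = 0 := (z2 (x b)).resolve_right xb
    have hab : a ≠ b := by rintro rfl; rw [xa] at xb; revert xb; decide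
    have hbeta : ∀ a b, a ≤ d → b ≤ d → x a = 1 → x b = 0 → 
      E a (rho d a b) = q 0 (d+1) ∨ E a (rho d a b) = q d (d+1) := by
      intro a b ha hb xa xb
      have hab : a ≠ b := by rintro rfl; rw [xa] at xb; revert xb; decide
      apply hB _ _ (by omega) _ (nadj_rho hd ha hb hab) xa
      · unfold rho; split_ifs
        · exact xd
        · exact xb
      · unfold rho; split_ifs <;> omega
    have binj : ∀ a b a' b', a ≤ d → b ≤ d → a' ≤ d → b' ≤ d → x a = 1 → x b = 0 → x a' = 1 → x b' = 0 →
      E a (rho d a b) = E a' (rho d a' b') → a = a' ∧ b = b' := by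
      intro a b a' b' ha hb ha' hb' xa xb xa' xb' h
      have hab : a ≠ b := by rintro rfl; rw [xa] at xb; revert xb; decide
      have hab' : a' ≠ b' := by rintro rfl; rw [xa'] at xb'; revert xb'; decide
      have hr : x (rho d a' b') = 0 := by
        unfold rho; split_ifs
        · exact xd
        · exact xb'
      rcases Ei _ _ _ _ (nadj_rho hd ha hb hab) (nadj_rho hd ha' hb' hab') h with ⟨h1, h2⟩ | ⟨h1, h2⟩
      · subst h1
        exact ⟨rfl, rho_inj hd ha hb hb' h2⟩
      · rw [← h1, xa] at hr; exact absurd hr (by decide)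
    obtain ⟨c, c', hc, hc', hcc, h1, h2, h3, h4⟩ : ∃ c c', c ≤ d ∧ c' ≤ d ∧ c ≠ c' ∧ c ≠ a ∧ c ≠ b ∧ c' ≠ a ∧ c' ≠ b := by
      have : ∃ l ∈ Finset.range (d+1), l ∉ ({a, b} : Finset ℕ) := by
        by_contra hcon
        push Not at hcon
        have h1 := Finset.card_le_card (show Finset.range (d+1) ⊆ {a,b} from hcon)
        have := Finset.card_le_two (a := a) (b := b)
        simp at h1
        omega
      obtain ⟨c, hc, hc'⟩ := this
      have : ∃ l ∈ Finset.range (d+1), l ∉ ({a, b, c} : Finset ℕ) := by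
        by_contra hcon
        push Not at hcon
        have h1 := Finset.card_le_card (show Finset.range (d+1) ⊆ {a,b,c} from hcon)
        have := Finset.card_le_three (a := a) (b := b) (c := c)
        simp at h1
        omega
      obtain ⟨c', hc2, hc2'⟩ := this
      simp at hc hc' hc2 hc2'
      exact ⟨c, c', by omega, by omega, by omega, by omega, by omega, by omega, by omega⟩
    have pick : ∀ c, c ≤ d → ∃ a' b', a' ≤ d ∧ b' ≤ d ∧ x a' = 1 ∧ x b' = 0 ∧ 
       ((a' = c ∧ b' = b) ∨ (a' = a ∧ b' = c)) := by
      intro c hc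
      rcases z2 (x c) with h | h
      · exact ⟨a, c, ha, hc, xa, h, Or.inr ⟨rfl, rfl⟩⟩
      · exact ⟨c, b, hc, hb, h, xb, Or.inl ⟨rfl, rfl⟩⟩
    obtain ⟨a1, b1, ha1, hb1, xa1, xb1, h5⟩ := pick c hc
    obtain ⟨a2, b2, ha2, hb2, xa2, xb2, h6⟩ := pick c' hc'
    have t0 := hbeta a b ha hb xa xb
    have t1 := hbeta a1 b1 ha1 hb1 xa1 xb1
    have t2 := hbeta a2 b2 ha2 hb2 xa2 xb2
    have i01 := binj a b a1 b1 ha hb ha1 hb1 xa xb xa1 xb1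
    have i02 := binj a b a2 b2 ha hb ha2 hb2 xa xb xa2 xb2
    have i12 := binj a1 b1 a2 b2 ha1 hb1 ha2 hb2 xa1 xb1 xa2 xb2
    have e01 : E a (rho d a b) ≠ E a1 (rho d a1 b1) := fun h => by have := i01 h; omega
    have e02 : E a (rho d a b) ≠ E a2 (rho d a2 b2) := fun h => by have := i02 h; omega
    have e12 : E a1 (rho d a1 b1) ≠ E a2 (rho d a2 b2) := fun h => by have := i12 h; omega
    clear hA hB hbeta binj pick i01 i02 i12
    rcases t0 with t0 | t0 <;> rcases t1 with t1 | t1 <;> rcases t2 with t2 | t2 <;>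
      rw [t0, t1] at e01 <;> rw [t0, t2] at e02 <;> rw [t1, t2] at e12 <;> contradiction


structure Good {m d : ℕ} (q : ℕ → ℕ → Sym2 (WT m d)) : Prop where
  edge : ∀ k l, nadj d k l → q k l ∈ (sunletIndicator m d).edgeSet
  sym : ∀ k l, q k l = q l k
  la : ∀ k l l', nadj d k l → nadj d k l' → l ≠ l' → LA (q k l) (q k l')

def Concl {m d : ℕ} (q : ℕ → ℕ → Sym2 (WT m d)) (e : Fin m × Fin 2) : Prop :=
    (q 0 (d+1) = s(V e 0, V e (d+1)) ∧ q d (d+1) = s(V e d, V e (d+1))) ∨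
    (q 0 (d+1) = s(V e d, V e (d+1)) ∧ q d (d+1) = s(V e 0, V e (d+1)))

theorem edge_mem {m d : ℕ} {p : Sym2 (WT m d)} (hp : p ∈ (sunletIndicator m d).edgeSet) {x}
    (hx : x ∈ p) : ∃ a, p = s(x, a) ∧ (sunletIndicator m d).Adj x a := by
  obtain ⟨a, rfl⟩ := Sym2.mem_iff_exists.1 hx
  exact ⟨a, rfl, hp⟩

theorem E_inj {m d : ℕ} {e : Fin m × Fin 2} (w w' z z' : ℕ) (h1 : nadj d w w') (h2 : nadj d z z')
    (h : (s(V e w, V e w') : Sym2 (WT m d)) = s(V e z, V e z')) :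
      (w = z ∧ w' = z') ∨ (w = z' ∧ w' = z) := by
  have a1 := nadj_lt h1
  have a2 := nadj_lt h2
  rw [Sym2.eq_iff, V_inj a1.1 a2.1, V_inj a1.2 a2.2, V_inj a1.1 a2.2, V_inj a1.2 a2.1] at h
  tauto

theorem dragon4 {m d : ℕ} (hd : 4 ≤ d) (q : ℕ → ℕ → Sym2 (WT m d)) (hq : Good q) :
    ∃ e, Concl q e := by
  classical
  have hd3 : 3 ≤ d := by omega
  have A : ∀ u, ∃ e k, u ≤ d → k ≤ d ∧ ∀ v, nadj d u v → V e k ∈ q u v := by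
    intro u
    by_cases hu : u ≤ d
    swap
    · obtain ⟨x, hx⟩ : ∃ x, x ∈ q 0 (d+1) := ⟨_, Sym2.out_fst_mem _⟩
      have h := edge_mem (hq.edge 0 (d+1) (by unfold nadj; omega)) hx
      have hm : Nonempty (Fin m) := by
        rcases x with (i | i) | ⟨i, _⟩
        exacts [⟨i⟩, ⟨i⟩, ⟨i.1⟩]
      exact ⟨(hm.some, 0), 0, fun h => absurd h hu⟩
    have hcard := card_Nb hd3 hu
    obtain ⟨x, hx⟩ := common (q u) (Nb d u) (by omega) (by
      intro i hi j hj hij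
      exact hq.la u i j (mem_Nb.1 hi) (mem_Nb.1 hj) hij)
    by_cases hcore : ∃ e k, k ≤ d ∧ x = V e k
    · obtain ⟨e, k, hk, rfl⟩ := hcore
      exact ⟨e, k, fun _ => ⟨hk, fun v hv => hx v (mem_Nb.2 hv)⟩⟩
    · exfalso
      have hcore' : ∀ e k, k ≤ d → x ≠ V e k := fun e k hk h => hcore ⟨e, k, hk, h⟩
      let t := (Nb d u).orderEmbOfCardLe (by omega : 4 ≤ _)
      have ht : ∀ i, t i ∈ Nb d u := fun i => Finset.orderEmbOfCardLe_mem _ _ i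
      have hi : ∀ i, ∃ a, q u (t i) = s(x, a) ∧ (sunletIndicator m d).Adj x a := fun i =>
        edge_mem (hq.edge _ _ (mem_Nb.1 (ht i))) (hx _ (ht i))
      choose a ha ha' using hi
      have hne : ∀ i j, i ≠ j → a i ≠ a j := by
        intro i j hij h
        have := (hq.la u (t i) (t j) (mem_Nb.1 (ht i)) (mem_Nb.1 (ht j)) (fun h => hij (t.injective h))).1
        rw [ha, ha, h] at this
        exact this rfl
      exact low_deg hcore' (ha' 0) (ha' 1) (ha' 2) (ha' 3) (hne _ _ (by decide)) (hne _ _ (by decide))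
        (hne _ _ (by decide)) (hne _ _ (by decide)) (hne _ _ (by decide)) (hne _ _ (by decide))
  choose e φ hA using A
  have B : ∀ u v, u ≤ d → v ≤ d → nadj d u v → e u = e v := by
    intro u v hu hv h
    have h1 := (hA u hu).2 v h
    have h2 := (hA v hv).2 u (nadj_symm h)
    rw [hq.sym] at h2
    have ku := (hA u hu).1
    have kv := (hA v hv).1
    obtain ⟨a, ha, ha'⟩ := edge_mem (hq.edge u v h) h1
    rw [ha] at h2
    rcases Sym2.mem_iff.1 h2 with h3 | h3
    · exact ((V_inj (by omega) (by omega)).1 h3).1.symm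
    · rw [← h3, adj_VV (by omega) (by omega)] at ha'
      exact ha'.1
  have C : ∀ u ≤ d, e u = e 1 := by
    intro u hu
    by_cases h : u = 1
    · rw [h]
    · exact B u 1 hu (by omega) (by unfold nadj; omega)
  set e0 := e 1 with he0
  have D : ∀ u v, u ≤ d → nadj d u v → V e0 (φ u) ∈ q u v := by
    intro u v hu h
    have := (hA u hu).2 v h
    rwa [C u hu] at this
  have qi : ∀ u v v', nadj d u v → nadj d u v' → q u v = q u v' → v = v' := by
    intro u v v' h1 h2 h
    by_contra hne
    exact (hq.la u v v' h1 h2 hne).1 h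
  have hin : ∀ u v, u ≤ d → nadj d u v → ∃ l, nadj d (φ u) l ∧ q u v = s(V e0 (φ u), V e0 l) := by
    intro u v hu h
    obtain ⟨a, ha, ha'⟩ := edge_mem (hq.edge u v h) (D u v hu h)
    obtain ⟨l, hl, rfl⟩ := adj_V_le (by have := (hA u hu).1; omega) ha'
    exact ⟨l, hl, ha⟩
  refine ⟨e0, parity hd3 q (fun k l => s(V e0 k, V e0 l)) φ hq.sym qi (fun u hu => (hA u hu).1) hin ?_
    (fun u v => Sym2.eq_swap) E_inj ?_⟩
  · intro u l hu hl
    have hφu := (hA u hu).1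
    have hsub : (Nb d u).image (q u) ⊆ (Nb d (φ u)).image (fun l => s(V e0 (φ u), V e0 l)) := by
      intro p hp
      obtain ⟨v, hv, rfl⟩ := Finset.mem_image.1 hp
      obtain ⟨l, hl, hl'⟩ := hin u v hu (mem_Nb.1 hv)
      exact Finset.mem_image.2 ⟨l, mem_Nb.2 hl, hl'.symm⟩
    have heq := Finset.eq_of_subset_of_card_le hsub (by
      rw [Finset.card_image_of_injOn (s := Nb d u), card_Nb hd3 hu]
      · exact Finset.card_image_le.trans (card_Nb hd3 hφu).le
      · intro v hv v' hv' h
        exact qi u v v' (mem_Nb.1 hv) (mem_Nb.1 hv') h)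
    have : (s(V e0 (φ u), V e0 l) : Sym2 (WT m d)) ∈ (Nb d u).image (q u) := by
      rw [heq]; exact Finset.mem_image.2 ⟨l, mem_Nb.2 hl, rfl⟩
    obtain ⟨v, hv, hv'⟩ := Finset.mem_image.1 this
    exact ⟨v, mem_Nb.1 hv, hv'⟩
  · rw [hq.sym 0, hq.sym d]
    exact (hq.la (d+1) 0 d (by unfold nadj; omega) (by unfold nadj; omega) (by omega)).1

/-- the eight edges for `d = 3` -/
def e8 : Fin 8 → ℕ × ℕ := ![(0,1), (0,2), (1,2), (1,3), (2,3), (0,4), (3,4), (4,5)]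

def a8 (c c' : Fin 8) : Bool := c ≠ c' && ((e8 c).1 = (e8 c').1 || (e8 c).1 = (e8 c').2 || 
  (e8 c).2 = (e8 c').1 || (e8 c).2 = (e8 c').2)

set_option maxRecDepth 10000 in
theorem fin8 : ∀ A B C : Fin 8, a8 A B → a8 A C → a8 B C → ∀ P, a8 P A → a8 P C →
    ∀ Q, a8 Q B → a8 Q C → a8 Q P → ∀ R, a8 R A → a8 R B → ∀ S, a8 S P → a8 S Q → a8 S R → 
    (R = 5 ∧ S = 6) ∨ (R = 6 ∧ S = 5) := by
  decide

def X {m : ℕ} (e : Fin m × Fin 2) (c : Fin 8) : Sym2 (WT m 3) := s(V e (e8 c).1, V e (e8 c).2)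

theorem e8_lt : ∀ c, (e8 c).1 < 6 ∧ (e8 c).2 < 6 := by decide

theorem nadj_e8 {k l : ℕ} (h : nadj 3 k l) : ∃ c, e8 c = (k, l) ∨ e8 c = (l, k) := by
  obtain ⟨h1, h2⟩ := nadj_lt h
  have : ∀ k < 6, ∀ l < 6, nadj 3 k l → ∃ c, e8 c = (k, l) ∨ e8 c = (l, k) := by decide
  exact this k h1 l h2 h

theorem X_of_nadj {m k l : ℕ} (e : Fin m × Fin 2) (h : nadj 3 k l) : 
    ∃ c, (s(V e k, V e l) : Sym2 (WT m 3)) = X e c := by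
  obtain ⟨c, h | h⟩ := nadj_e8 h <;> refine ⟨c, ?_⟩ <;> rw [X, h]
  exact Sym2.eq_swap

theorem X_adj {m : ℕ} {e e' : Fin m × Fin 2} {c c' : Fin 8} (h : LA (X e c) (X e' c')) : e = e' ∧ a8 c c' := by
  obtain ⟨h1, x, h2, h3⟩ := h
  have l1 := e8_lt c
  have l2 := e8_lt c'
  rw [X, Sym2.mem_iff] at h2 h3
  have : e = e' := by
    rcases h2 with rfl | rfl <;> rcases h3 with h3 | h3 <;>
    exact ((V_inj (by omega) (by omega)).1 h3).1
  subst this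
  refine ⟨rfl, ?_⟩
  have hne : c ≠ c' := by rintro rfl; exact h1 rfl
  simp only [a8, ne_eq, hne, not_false_eq_true, decide_true, Bool.true_and, Bool.or_eq_true, decide_eq_true_eq]
  rcases h2 with rfl | rfl <;> rcases h3 with h3 | h3 <;>
    have := ((V_inj (by omega) (by omega)).1 h3).2 <;> omega

theorem core_X {m : ℕ} {p : Sym2 (WT m 3)} (hp : p ∈ (sunletIndicator m 3).edgeSet) {e k} (hk : k ≤ 4)
    (hx : V e k ∈ p) : ∃ c, p = X e c := by
  obtain ⟨a, rfl, ha⟩ := edge_mem hp hx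
  obtain ⟨l, hl, rfl⟩ := adj_V_le (by omega) ha
  exact X_of_nadj e hl

/-- closure under common neighbours -/
theorem X_close {m : ℕ} {p : Sym2 (WT m 3)} (hp : p ∈ (sunletIndicator m 3).edgeSet) {e c c'}
    (h : a8 c c') (h1 : LA p (X e c)) (h2 : LA p (X e c')) : ∃ c'', p = X e c'' := by
  obtain ⟨-, x, hx, hx'⟩ := h1
  obtain ⟨-, y, hy, hy'⟩ := h2
  have l1 := e8_lt c
  have l2 := e8_lt c'
  obtain ⟨k, hk, rfl⟩ : ∃ k, (k = (e8 c).1 ∨ k = (e8 c).2) ∧ x = V e k := by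
    rw [X, Sym2.mem_iff] at hx'
    rcases hx' with h | h
    exacts [⟨_, Or.inl rfl, h⟩, ⟨_, Or.inr rfl, h⟩]
  obtain ⟨k', hk', rfl⟩ : ∃ k, (k = (e8 c').1 ∨ k = (e8 c').2) ∧ y = V e k := by
    rw [X, Sym2.mem_iff] at hy'
    rcases hy' with h | h
    exacts [⟨_, Or.inl rfl, h⟩, ⟨_, Or.inr rfl, h⟩]
  by_cases h4 : k ≤ 4
  · exact core_X hp h4 hx
  by_cases h5 : k' ≤ 4
  · exact core_X hp h5 hy
  exfalso
  have : ∀ c c', a8 c c' → ((e8 c).1 ≤ 4 ∧ (e8 c).2 ≤ 4) ∨ ((e8 c').1 ≤ 4 ∧ (e8 c').2 ≤ 4) := by decide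
  have := this c c' h
  omega

theorem tri {W : Type*} {A B C : Sym2 W} (h1 : LA A B) (h2 : LA A C) (h3 : LA B C) :
    (∃ x, x ∈ A ∧ x ∈ B ∧ x ∈ C) ∨ ∃ x y z, A = s(x,y) ∧ B = s(x,z) ∧ C = s(y,z) := by
  obtain ⟨-, x, hx, hx'⟩ := h1
  obtain ⟨-, y, hy, hy'⟩ := h2
  obtain ⟨-, z, hz, hz'⟩ := h3
  by_cases hxC : x ∈ C
  · exact Or.inl ⟨x, hx, hx', hxC⟩
  by_cases hyB : y ∈ B
  · exact Or.inl ⟨y, hy, hyB, hy'⟩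
  by_cases hzA : z ∈ A
  · exact Or.inl ⟨z, hzA, hz, hz'⟩
  right
  refine ⟨x, y, z, ?_, ?_, ?_⟩ 
  · exact ((Sym2.mem_and_mem_iff (by rintro rfl; contradiction)).1 ⟨hx, hy⟩)
  · exact ((Sym2.mem_and_mem_iff (by rintro rfl; contradiction)).1 ⟨hx', hz⟩)
  · exact ((Sym2.mem_and_mem_iff (by rintro rfl; contradiction)).1 ⟨hy', hz'⟩)

theorem low_unique {m d : ℕ} (hd : 3 ≤ d) {x : WT m d} (hx : ∀ e k, k ≤ d → x ≠ V e k) {A B C Z : Sym2 (WT m d)}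
    (hA : A ∈ (sunletIndicator m d).edgeSet) (hB : B ∈ (sunletIndicator m d).edgeSet)
    (hC : C ∈ (sunletIndicator m d).edgeSet) (hZ : Z ∈ (sunletIndicator m d).edgeSet)
    (xA : x ∈ A) (xB : x ∈ B) (xC : x ∈ C) (hAB : LA A B) (hAC : LA A C) (hBC : LA B C)
    (h1 : LA Z A) (h2 : LA Z B) : Z = C := by
  obtain ⟨a, rfl, ha⟩ := edge_mem hA xA
  obtain ⟨b, rfl, hb⟩ := edge_mem hB xB
  obtain ⟨c, rfl, hc⟩ := edge_mem hC xC
  have hab : a ≠ b := by rintro rfl; exact hAB.1 rfl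
  have hac : a ≠ c := by rintro rfl; exact hAC.1 rfl
  have hbc : b ≠ c := by rintro rfl; exact hBC.1 rfl
  by_cases xZ : x ∈ Z
  · obtain ⟨z, rfl, hz⟩ := edge_mem hZ xZ
    have hza : z ≠ a := by rintro rfl; exact h1.1 rfl
    have hzb : z ≠ b := by rintro rfl; exact h2.1 rfl
    by_contra hne
    have hzc : z ≠ c := by rintro rfl; exact hne rfl
    exact low_deg hx ha hb hc hz hab hac hza.symm hbc hzb.symm hzc.symm
  · exfalso
    obtain ⟨-, u, hu, hu'⟩ := h1
    obtain ⟨-, v, hv, hv'⟩ := h2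
    have hua : u = a := (Sym2.mem_iff.1 hu').resolve_left (by rintro rfl; contradiction)
    have hvb : v = b := (Sym2.mem_iff.1 hv').resolve_left (by rintro rfl; contradiction)
    subst hua hvb
    have := (Sym2.mem_and_mem_iff hab).1 ⟨hu, hv⟩
    rw [this] at hZ
    exact low_indep hd hx ha hb hZ

theorem dragon3 {m : ℕ} (q : ℕ → ℕ → Sym2 (WT m 3)) (hq : Good q) :
    ∃ e, Concl q e := by
  have la' : ∀ k l l', nadj 3 l k → nadj 3 l' k → l ≠ l' → LA (q l k) (q l' k) := by
    intro k l l' h1 h2 h3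
    have := hq.la k l l' (nadj_symm h1) (nadj_symm h2) h3
    rwa [hq.sym k l, hq.sym k l'] at this
  have la'' : ∀ k l l', nadj 3 l k → nadj 3 k l' → l ≠ l' → LA (q l k) (q k l') := by
    intro k l l' h1 h2 h3
    have := hq.la k l l' (nadj_symm h1) h2 h3
    rwa [hq.sym k l] at this
  have eA := hq.edge 0 1 (by decide)
  have eB := hq.edge 0 2 (by decide)
  have eC := hq.edge 1 2 (by decide)
  have eP := hq.edge 1 3 (by decide)
  have eQ := hq.edge 2 3 (by decide)
  have eR := hq.edge 0 4 (by decide)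
  have eS := hq.edge 3 4 (by decide)
  have AB : LA (q 0 1) (q 0 2) := hq.la _ _ _ (by decide) (by decide) (by decide)
  have AC : LA (q 0 1) (q 1 2) := la'' _ _ _ (by decide) (by decide) (by decide)
  have BC : LA (q 0 2) (q 1 2) := la' _ _ _ (by decide) (by decide) (by decide)
  have AP : LA (q 0 1) (q 1 3) := la'' _ _ _ (by decide) (by decide) (by decide)
  have CP : LA (q 1 2) (q 1 3) := hq.la _ _ _ (by decide) (by decide) (by decide)
  have BQ : LA (q 0 2) (q 2 3) := la'' _ _ _ (by decide) (by decide) (by decide)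
  have CQ : LA (q 1 2) (q 2 3) := la'' _ _ _ (by decide) (by decide) (by decide)
  have PQ : LA (q 1 3) (q 2 3) := la' _ _ _ (by decide) (by decide) (by decide)
  have AR : LA (q 0 1) (q 0 4) := hq.la _ _ _ (by decide) (by decide) (by decide)
  have BR : LA (q 0 2) (q 0 4) := hq.la _ _ _ (by decide) (by decide) (by decide)
  have PS : LA (q 1 3) (q 3 4) := la'' _ _ _ (by decide) (by decide) (by decide)
  have QS : LA (q 2 3) (q 3 4) := la'' _ _ _ (by decide) (by decide) (by decide)
  have RS : LA (q 0 4) (q 3 4) := la' _ _ _ (by decide) (by decide) (by decide)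
  simp only [Concl]
  generalize q 0 1 = A at *
  generalize q 0 2 = B at *
  generalize q 1 2 = C at *
  generalize q 1 3 = P at *
  generalize q 2 3 = Q at *
  generalize q 0 (3+1) = R at *
  generalize q 3 (3+1) = S at *
  clear hq la' la''
  have main : ∃ e a b c, A = X e a ∧ B = X e b ∧ C = X e c := by
    rcases tri AB AC BC with ⟨x, xA, xB, xC⟩ | ⟨x, y, z, rfl, rfl, rfl⟩
    · by_cases hx : ∀ e k, k ≤ 3 → x ≠ V e k
      · exfalso
        have hP : P = B := low_unique (by omega) hx eA eC eB eP xA xC xB AC AB BC.symm AP.symm CP.symm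
        have hQ : Q = A := low_unique (by omega) hx eB eC eA eQ xB xC xA BC AB.symm AC.symm BQ.symm CQ.symm
        have hR : R = C := low_unique (by omega) hx eA eB eC eR xA xB xC AB AC BC AR.symm BR.symm
        subst hP hQ hR
        have hS := low_unique (by omega) hx eB eA eC eS xB xA xC AB.symm BC AC PS.symm QS.symm
        exact RS.1 hS.symm
      · push Not at hx
        obtain ⟨e, k, hk, rfl⟩ := hx
        obtain ⟨a, ha⟩ := core_X eA (by omega) xA
        obtain ⟨b, hb⟩ := core_X eB (by omega) xB
        obtain ⟨c, hc⟩ := core_X eC (by omega) xC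
        exact ⟨e, a, b, c, ha, hb, hc⟩
    · by_cases hx : ∀ e k, k ≤ 3 → x ≠ V e k
      · exact absurd eC (low_indep (by omega) hx eA eB)
      · push Not at hx
        obtain ⟨e, k, hk, rfl⟩ := hx
        obtain ⟨l, hl, rfl⟩ := adj_V_le (by omega) eA
        obtain ⟨l', hl', rfl⟩ := adj_V_le (by omega) eB
        obtain ⟨-, hll⟩ := (adj_VV (nadj_lt hl).2 (nadj_lt hl').2).1 eC
        obtain ⟨a, ha⟩ := X_of_nadj e hl
        obtain ⟨b, hb⟩ := X_of_nadj e hl'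
        obtain ⟨c, hc⟩ := X_of_nadj e hll
        exact ⟨e, a, b, c, ha, hb, hc⟩
  obtain ⟨e, a, b, c, rfl, rfl, rfl⟩ := main
  have ab := (X_adj AB).2
  have ac := (X_adj AC).2
  have bc := (X_adj BC).2
  obtain ⟨p, rfl⟩ := X_close eP ac AP.symm CP.symm
  obtain ⟨r, rfl⟩ := X_close eQ bc BQ.symm CQ.symm
  obtain ⟨s, rfl⟩ := X_close eR ab AR.symm BR.symm
  obtain ⟨t, rfl⟩ := X_close eS (X_adj PQ).2 PS.symm QS.symm
  refine ⟨e, ?_⟩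
  rcases fin8 a b c ab ac bc p (X_adj AP.symm).2 (X_adj CP.symm).2 r (X_adj BQ.symm).2 (X_adj CQ.symm).2 (X_adj PQ.symm).2 s (X_adj AR.symm).2 (X_adj BR.symm).2
    t (X_adj PS.symm).2 (X_adj QS.symm).2 (X_adj RS.symm).2 with ⟨rfl, rfl⟩ | ⟨rfl, rfl⟩
  · left; exact ⟨rfl, rfl⟩
  · right; exact ⟨rfl, rfl⟩

theorem dragon_map {m d : ℕ} (hd : 3 ≤ d) (q : ℕ → ℕ → Sym2 (WT m d)) (hq : Good q) :
    ∃ e, Concl q e := by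
  rcases hd.eq_or_lt with rfl | h
  · exact dragon3 q hq
  · exact dragon4 h q hq


theorem mid_edge {m d : ℕ} (hd : 3 ≤ d) {e : Fin m × Fin 2} {Z : Sym2 (WT m d)}
    (hZ : Z ∈ (sunletIndicator m d).edgeSet)
    (h1 : LA Z s(V e 0, V e (d+1))) (h2 : LA Z s(V e d, V e (d+1))) : Z = s(V e (d+2), V e (d+1)) := by
  by_cases h : V e (d+1) ∈ Z
  · obtain ⟨a, rfl, ha⟩ := edge_mem hZ h
    obtain ⟨l, hl, rfl⟩ := adj_V_le (by omega) ha
    obtain rfl | rfl | rfl : l = 0 ∨ l = d ∨ l = d+2 := by unfold nadj at hl; omega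
    · exact absurd Sym2.eq_swap h1.1
    · exact absurd Sym2.eq_swap h2.1
    · exact Sym2.eq_swap
  · exfalso
    obtain ⟨-, u, hu, hu'⟩ := h1
    obtain ⟨-, v, hv, hv'⟩ := h2
    have hua : u = V e 0 := (Sym2.mem_iff.1 hu').resolve_right (by rintro rfl; contradiction)
    have hvb : v = V e d := (Sym2.mem_iff.1 hv').resolve_right (by rintro rfl; contradiction)
    subst hua hvb
    have hne : (V e 0 : WT m d) ≠ V e d := by
      rw [ne_eq, V_inj (by omega) (by omega)]; omega
    have := (Sym2.mem_and_mem_iff hne).1 ⟨hu, hv⟩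
    rw [this, SimpleGraph.mem_edgeSet, adj_VV (by omega) (by omega)] at hZ
    have := hZ.2
    unfold nadj at this; omega

def LR {m d : ℕ} (e : Fin m × Fin 2) (Z : Sym2 (WT m d)) : Prop :=
  Z = s(V e 0, V e (d+1)) ∨ Z = s(V e d, V e (d+1))

def TT {m d : ℕ} (e : Fin m × Fin 2) (Z : Sym2 (WT m d)) : Prop :=
  LR e Z ∨ ∃ x, inc x e ∧ Z = s(V e (d+2), Sum.inl x)

theorem spoke_TT {m d : ℕ} {e : Fin m × Fin 2} {Z : Sym2 (WT m d)}
    (hZ : Z ∈ (sunletIndicator m d).edgeSet)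
    (h1 : LA Z s(V e (d+2), V e (d+1))) : TT e Z := by
  obtain ⟨hne, u, hu, hu'⟩ := h1
  obtain ⟨a, rfl, ha⟩ := edge_mem hZ hu
  rcases Sym2.mem_iff.1 hu' with rfl | rfl
  · rcases adj_V_c ha with rfl | ⟨x, hx, rfl⟩
    · exact absurd rfl hne
    · exact Or.inr ⟨x, hx, rfl⟩
  · obtain ⟨l, hl, rfl⟩ := adj_V_le (by omega) ha
    obtain rfl | rfl | rfl : l = 0 ∨ l = d ∨ l = d+2 := by unfold nadj at hl; omega
    · exact Or.inl (Or.inl Sym2.eq_swap)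
    · exact Or.inl (Or.inr Sym2.eq_swap)
    · exact absurd Sym2.eq_swap hne

theorem LR_closed {m d : ℕ} {e e' : Fin m × Fin 2} {Z Z' : Sym2 (WT m d)} (h : LR e Z)
    (h' : TT e' Z') (hl : LA Z Z') : LR e Z' := by
  obtain ⟨-, u, hu, hu'⟩ := hl
  have : ∃ k, k ≤ d+1 ∧ u = V e k := by
    rcases h with rfl | rfl <;> rcases Sym2.mem_iff.1 hu with rfl | rfl <;>
      exact ⟨_, by omega, rfl⟩
  obtain ⟨k, hk, rfl⟩ := this
  rcases h' with h' | ⟨x, hx, rfl⟩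
  · have : e = e' := by
      rcases h' with rfl | rfl <;> rcases Sym2.mem_iff.1 hu' with h | h <;>
        exact ((V_inj (by omega) (by omega)).1 h).1
    rwa [this]
  · exfalso
    rcases Sym2.mem_iff.1 hu' with h | h
    · have := ((V_inj (by omega) (by omega)).1 h).2
      omega
    · exact V_ne_inl h

theorem is_spoke {m d : ℕ} {e1 e2 e3 : Fin m × Fin 2} {Z1 Z2 Z3 : Sym2 (WT m d)}
    (t1 : TT e1 Z1) (t2 : TT e2 Z2) (t3 : TT e3 Z3) (h12 : LA Z1 Z2) (h13 : LA Z1 Z3) (h23 : LA Z2 Z3) :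
    ∃ x, inc x e1 ∧ Z1 = s(V e1 (d+2), Sum.inl x) := by
  rcases t1 with h1 | h
  · exfalso
    have h2 := LR_closed h1 t2 h12
    have h3 := LR_closed h1 t3 h13
    have := h12.1
    have := h13.1
    have := h23.1
    unfold LR at *
    grind
  · exact h

theorem spoke_LA {m d : ℕ} {e1 e2 : Fin m × Fin 2} {x1 x2 : Fin m ⊕ Fin m}
    (h : LA (s(V e1 (d+2), Sum.inl x1) : Sym2 (WT m d)) s(V e2 (d+2), Sum.inl x2)) :
    (e1 = e2 ∧ x1 ≠ x2) ∨ (e1 ≠ e2 ∧ x1 = x2) := by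
  obtain ⟨hne, u, hu, hu'⟩ := h
  have hne' : ¬ (e1 = e2 ∧ x1 = x2) := by rintro ⟨rfl, rfl⟩; exact hne rfl
  rcases Sym2.mem_iff.1 hu with rfl | rfl <;> rcases Sym2.mem_iff.1 hu' with h | h
  · have := ((V_inj (by omega) (by omega)).1 h).1
    tauto
  · exact absurd h V_ne_inl
  · exact absurd h.symm V_ne_inl
  · have := Sum.inl.inj h
    tauto

theorem three_spokes {m d : ℕ} {e1 e2 e3 : Fin m × Fin 2} {Z1 Z2 Z3 : Sym2 (WT m d)}
    (t1 : TT e1 Z1) (t2 : TT e2 Z2) (t3 : TT e3 Z3) (h12 : LA Z1 Z2) (h13 : LA Z1 Z3) (h23 : LA Z2 Z3) :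
    ∃ y, inc (Sum.inl y) e1 ∧ inc (Sum.inl y) e2 ∧ e1 ≠ e2 ∧ Z1 = s(V e1 (d+2), Sum.inl (Sum.inl y)) ∧
      Z2 = s(V e2 (d+2), Sum.inl (Sum.inl y)) := by
  obtain ⟨x1, i1, rfl⟩ := is_spoke t1 t2 t3 h12 h13 h23
  obtain ⟨x2, i2, rfl⟩ := is_spoke t2 t1 t3 h12.symm h23 h13
  obtain ⟨x3, i3, rfl⟩ := is_spoke t3 t1 t2 h13.symm h23.symm h12
  have a12 := spoke_LA h12
  have a13 := spoke_LA h13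
  have a23 := spoke_LA h23
  have : x1 = x2 ∧ e1 ≠ e2 := by
    rcases a12 with ⟨rfl, h⟩ | h
    · exfalso
      rcases a13 with ⟨rfl, h'⟩ | h'
      · rcases a23 with ⟨-, h''⟩ | h''
        · exact inc_two i1 i2 i3 h h' h''
        · exact h''.1 rfl
      · rcases a23 with ⟨h3, h''⟩ | h''
        · exact h'.1 (by assumption)
        · exact h (h'.2.trans h''.2.symm)
    · tauto
  obtain ⟨rfl, hne⟩ := this
  rcases x1 with y | y
  · exact ⟨y, i1, i2, hne, rfl, rfl⟩
  · exact absurd ((inc_pend i1).trans (inc_pend i2).symm) hne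

theorem walk {m n : ℕ} (y κ : ℕ → ZMod m)
    (h1 : ∀ t, (y t = κ t ∧ y (t+1) = κ t + 1) ∨ (y t = κ t + 1 ∧ y (t+1) = κ t))
    (h2 : ∀ t, κ (t+1) ≠ κ t) (hy : y n = y 0) : m ∣ n := by
  rcases h1 0 with h0 | h0
  · have H : ∀ t, y t = κ t ∧ y (t+1) = κ t + 1 ∧ y t = y 0 + t := by
      intro t
      induction t with
      | zero => exact ⟨h0.1, h0.2, by simp⟩
      | succ t ih =>
        have hy : y (t+1) = y 0 + (t+1 : ℕ) := by
          rw [ih.2.1, ← ih.1, ih.2.2]; push_cast; ring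
        rcases h1 (t+1) with h | h
        · exact ⟨h.1, h.2, hy⟩
        · exact absurd (add_right_cancel (h.1.symm.trans ih.2.1)) (h2 t)
    have := (H n).2.2
    rw [hy] at this
    have : (n : ZMod m) = 0 := by simpa using this
    exact (ZMod.natCast_eq_zero_iff n m).1 this
  · have H : ∀ t, y t = κ t + 1 ∧ y (t+1) = κ t ∧ y t = y 0 - t := by
      intro t
      induction t with
      | zero => exact ⟨h0.1, h0.2, by simp⟩
      | succ t ih =>
        have hy : y (t+1) = y 0 - (t+1 : ℕ) := by
          rw [ih.2.1, ← add_sub_cancel_right (κ t) 1, ← ih.1, ih.2.2]; push_cast; ring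
        rcases h1 (t+1) with h | h
        · exact absurd (h.1.symm.trans ih.2.1) (h2 t)
        · exact ⟨h.1, h.2, hy⟩
    have := (H n).2.2
    rw [hy] at this
    have : (n : ZMod m) = 0 := by linear_combination this
    exact (ZMod.natCast_eq_zero_iff n m).1 this

theorem cast_inj {m : ℕ} {a b : Fin m} (h : ((a : ℕ) : ZMod m) = (b : ℕ)) : a = b := by
  rw [ZMod.natCast_eq_natCast_iff'] at h
  rw [Nat.mod_eq_of_lt a.2, Nat.mod_eq_of_lt b.2] at h
  exact Fin.ext h

theorem cyc_edge {m : ℕ} {a b : Fin m} {E : Fin m × Fin 2} (ha : inc (Sum.inl a) E)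
    (hb : inc (Sum.inl b) E) (hab : a ≠ b) : E.2 = 0 ∧
    ((((a : ℕ) : ZMod m) = (E.1 : ℕ) ∧ ((b : ℕ) : ZMod m) = (E.1 : ℕ) + 1) ∨
     (((a : ℕ) : ZMod m) = (E.1 : ℕ) + 1 ∧ ((b : ℕ) : ZMod m) = (E.1 : ℕ))) := by
  obtain ⟨i, s⟩ := E
  have cs : ∀ c : Fin m, (c : ℕ) = ((i : ℕ) + 1) % m → ((c : ℕ) : ZMod m) = (i : ℕ) + 1 := by
    intro c hc; rw [hc]; simp
  simp only [inc, Sum.inl.injEq, exists_eq_right', reduceCtorEq, and_false, or_false] at ha hb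
  rcases ha with rfl | ⟨hs, ha⟩
  · rcases hb with rfl | ⟨hs, hb⟩
    · exact absurd rfl hab
    · exact ⟨Fin.ext hs, Or.inl ⟨rfl, cs b hb⟩⟩
  · rcases hb with rfl | ⟨-, hb⟩
    · exact ⟨Fin.ext hs, Or.inr ⟨cs a ha, rfl⟩⟩
    · exact absurd (Fin.ext (ha.trans hb.symm)) hab

theorem hom_to_fun {n m d : ℕ} (hm : 0 < m)
    (f : (sunletIndicator n d).lineGraph →g (sunletIndicator m d).lineGraph) :
    ∃ g : WT n d → WT n d → Sym2 (WT m d),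
      (∀ u v, (sunletIndicator n d).Adj u v → g u v ∈ (sunletIndicator m d).edgeSet) ∧
      (∀ u v, g u v = g v u) ∧
      (∀ u v w, (sunletIndicator n d).Adj u v → (sunletIndicator n d).Adj u w → v ≠ w →
        LA (g u v) (g u w)) := by
  classical
  let z : WT m d := Sum.inl (Sum.inl ⟨0, hm⟩)
  let g : Sym2 (WT n d) → Sym2 (WT m d) := fun p =>
    if h : p ∈ (sunletIndicator n d).edgeSet then (f ⟨p, h⟩).1 else s(z, z)
  have hg : ∀ p (h : p ∈ (sunletIndicator n d).edgeSet), g p = (f ⟨p, h⟩).1 := fun p h => dif_pos h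
  refine ⟨fun u v => g s(u, v), ?_, ?_, ?_⟩
  · intro u v h
    simp only
    rw [hg _ ((SimpleGraph.mem_edgeSet _).2 h)]
    exact (f _).2
  · intro u v
    simp only [Sym2.eq_swap]
  · intro u v w hv hw hvw
    simp only
    rw [hg _ ((SimpleGraph.mem_edgeSet _).2 hv), hg _ ((SimpleGraph.mem_edgeSet _).2 hw)]
    have : (sunletIndicator n d).lineGraph.Adj ⟨s(u,v), hv⟩ ⟨s(u,w), hw⟩ := by
      rw [SimpleGraph.lineGraph_adj_iff_exists]
      refine ⟨?_, u, by simp, by simp⟩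
      intro h
      have := Subtype.mk.inj h
      rw [Sym2.eq_iff] at this
      rcases this with h | h
      · exact hvw h.2
      · exact hvw (h.2.trans h.1)
    have := f.map_adj this
    rw [SimpleGraph.lineGraph_adj_iff_exists] at this
    exact ⟨fun h => this.1 (Subtype.ext h), this.2⟩

theorem hom_dvd {n m d : ℕ} (hd : 3 ≤ d) (hn : 3 ≤ n) (hm : 3 ≤ m)
    (f : (sunletIndicator n d).lineGraph →g (sunletIndicator m d).lineGraph) : m ∣ n := by
  obtain ⟨g, gE, gs, gA⟩ := hom_to_fun (by omega) f
  have hgood : ∀ e : Fin n × Fin 2, Good (fun k l => g (V e k) (V e l)) := by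
    intro e
    refine ⟨?_, ?_, ?_⟩
    · intro k l h
      exact gE _ _ ((adj_VV (nadj_lt h).1 (nadj_lt h).2).2 ⟨rfl, h⟩)
    · intro k l; exact gs _ _
    · intro k l l' h h' hne
      refine gA _ _ _ ((adj_VV (nadj_lt h).1 (nadj_lt h).2).2 ⟨rfl, h⟩)
        ((adj_VV (nadj_lt h').1 (nadj_lt h').2).2 ⟨rfl, h'⟩) ?_
      rw [ne_eq, V_inj (nadj_lt h).2 (nadj_lt h').2]
      tauto
  choose ψ hψ using fun e => dragon_map hd _ (hgood e)
  have hmid : ∀ e, g (V e (d+2)) (V e (d+1)) = s(V (ψ e) (d+2), V (ψ e) (d+1)) := by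
    intro e
    have n2 : nadj d (d+1) (d+2) := by unfold nadj; omega
    have n0 : nadj d (d+1) 0 := by unfold nadj; omega
    have nd : nadj d (d+1) d := by unfold nadj; omega
    have a0 := (hgood e).la _ _ _ n2 n0 (by omega)
    have ad := (hgood e).la _ _ _ n2 nd (by omega)
    have eZ := (hgood e).edge _ _ n2
    rw [gs _ (V e 0)] at a0
    rw [gs _ (V e d)] at ad
    rw [gs]
    have := hψ e
    simp only [Concl] at this
    rcases this with ⟨h1, h2⟩ | ⟨h1, h2⟩
    · rw [h1] at a0; rw [h2] at ad
      exact mid_edge hd eZ a0 ad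
    · rw [h1] at a0; rw [h2] at ad
      exact mid_edge hd eZ ad a0
  have adjc : ∀ x (e : Fin n × Fin 2), inc x e → (sunletIndicator n d).Adj (V e (d+2)) (Sum.inl x) :=
    fun x e h => ((adj_IV (by omega)).2 ⟨rfl, h⟩).symm
  have hTT : ∀ x e, inc x e → TT (ψ e) (g (V e (d+2)) (Sum.inl x)) := by
    intro x e hx
    apply spoke_TT (gE _ _ (adjc x e hx))
    rw [← hmid]
    apply gA _ _ _ (adjc x e hx)
    · rw [adj_VV (by omega) (by omega)]
      refine ⟨rfl, ?_⟩
      unfold nadj; omega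
    · exact V_ne_inl.symm
  have hstar : ∀ x e e', inc x e → inc x e' → e ≠ e' →
      LA (g (V e (d+2)) (Sum.inl x)) (g (V e' (d+2)) (Sum.inl x)) := by
    intro x e e' h h' hne
    rw [gs, gs (V e' (d+2))]
    apply gA _ _ _ (adjc x e h).symm (adjc x e' h').symm
    rw [ne_eq, V_inj (by omega) (by omega)]
    tauto
  let nx : Fin n → Fin n := fun i => ⟨(i.val + 1) % n, Nat.mod_lt _ (by omega)⟩
  have nx_ne : ∀ i, i ≠ nx i := by
    intro i h
    have h := congrArg Fin.val h
    simp only [nx] at h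
    have hi := i.2
    rcases Nat.lt_or_ge (i.val+1) n with h' | h'
    · rw [Nat.mod_eq_of_lt h'] at h; omega
    · have : i.val + 1 = n := by omega
      rw [this, Nat.mod_self] at h; omega
  have inc0 : ∀ i : Fin n, inc (Sum.inl (nx i)) (i, 0) := fun i =>
    Or.inr (Or.inl ⟨rfl, nx i, rfl, rfl⟩)
  have incS : ∀ (i : Fin n) s, inc (Sum.inl i) (i, s) := fun i s => Or.inl rfl
  have key : ∀ i : Fin n, ∃ y : Fin m, inc (Sum.inl y) (ψ (i, 0)) ∧ inc (Sum.inl y) (ψ (nx i, 0)) ∧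
      ψ (i,0) ≠ ψ (nx i, 0) ∧
      g (V (i,0) (d+2)) (Sum.inl (Sum.inl (nx i))) = s(V (ψ (i,0)) (d+2), Sum.inl (Sum.inl y)) ∧
      g (V (nx i,0) (d+2)) (Sum.inl (Sum.inl (nx i))) = s(V (ψ (nx i,0)) (d+2), Sum.inl (Sum.inl y)) := by
    intro i
    have h1 : ((i, 0) : Fin n × Fin 2) ≠ (nx i, 0) := fun h => nx_ne i (Prod.mk.inj h).1
    have h2 : ((i, 0) : Fin n × Fin 2) ≠ (nx i, 1) := fun h => nx_ne i (Prod.mk.inj h).1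
    have h3 : ((nx i, 0) : Fin n × Fin 2) ≠ (nx i, 1) := fun h => absurd (Prod.mk.inj h).2 (by decide)
    exact three_spokes (hTT _ _ (inc0 i)) (hTT _ _ (incS (nx i) 0)) (hTT _ _ (incS (nx i) 1))
      (hstar _ _ _ (inc0 i) (incS _ _) h1) (hstar _ _ _ (inc0 i) (incS _ _) h2)
      (hstar _ _ _ (incS _ _) (incS _ _) h3)
  choose Y y1 y2 y3 y4 y5 using key
  have hYne : ∀ i, Y i ≠ Y (nx i) := by
    intro i h
    have := (gA _ _ _ (adjc _ _ (incS (nx i) 0)) (adjc _ _ (inc0 (nx i))) (by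
      intro h'
      exact nx_ne (nx i) (Sum.inl.inj (Sum.inl.inj h')))).1
    rw [y5, y4, h] at this
    exact this rfl
  let I : ℕ → Fin n := fun t => ⟨t % n, Nat.mod_lt _ (by omega)⟩
  have hI : ∀ t, I (t+1) = nx (I t) := by
    intro t; apply Fin.ext; simp [I, nx]
  have ce := fun i => cyc_edge (y2 i) (y1 (nx i)) (hYne i)
  apply walk (n := n) (fun t => ((Y (I t) : ℕ) : ZMod m)) (fun t => (((ψ (I (t+1), 0)).1 : ℕ) : ZMod m))
  · intro t
    have := (ce (I t)).2
    rw [← hI] at this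
    exact this
  · intro t h
    have h := cast_inj h
    apply y3 (I (t+1))
    rw [← hI]
    have a := (ce (I t)).1
    have b := (ce (I (t+1))).1
    rw [← hI] at a b
    exact Prod.ext h.symm (a.trans b.symm)
  · have : I n = I 0 := by apply Fin.ext; simp [I]
    simp only [this]


theorem line_reach {W : Type*} {G : SimpleGraph W} {u v : W} (p : G.Walk u v) :
    ∀ e1 e2 : G.edgeSet, u ∈ e1.1 → v ∈ e2.1 → G.lineGraph.Reachable e1 e2 := by
  have base : ∀ (u : W) (e1 e2 : G.edgeSet), u ∈ e1.1 → u ∈ e2.1 → G.lineGraph.Reachable e1 e2 := by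
    intro u e1 e2 h1 h2
    by_cases h : e1 = e2
    · rw [h]
    · exact SimpleGraph.Adj.reachable (SimpleGraph.lineGraph_adj_iff_exists.2 ⟨h, u, h1, h2⟩)
  induction p with
  | nil => exact base _
  | cons h p ih =>
    intro e1 e2 h1 h2
    exact (base _ e1 ⟨s(_, _), h⟩ h1 (by simp)).trans (ih _ e2 (by simp) h2)

theorem conn {n d : ℕ} (hd : 3 ≤ d) (hn : 0 < n) (u : WT n d) :
    (sunletIndicator n d).Reachable u (Sum.inl (Sum.inl ⟨0, hn⟩)) := by
  have adjc : ∀ x (e : Fin n × Fin 2), inc x e → (sunletIndicator n d).Adj (V e (d+2)) (Sum.inl x) :=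
    fun x e h => ((adj_IV (by omega)).2 ⟨rfl, h⟩).symm
  have h1 : ∀ i (hi : i < n), (sunletIndicator n d).Reachable (Sum.inl (Sum.inl ⟨i, hi⟩)) (Sum.inl (Sum.inl ⟨0, hn⟩)) := by
    intro i
    induction i with
    | zero => intro hi; exact SimpleGraph.Reachable.refl _
    | succ i ih =>
      intro hi
      refine SimpleGraph.Reachable.trans ?_ (ih (by omega))
      refine (adjc (Sum.inl ⟨i+1, hi⟩) (⟨i, by omega⟩, 0) ?_).symm.reachable.trans 
        (adjc (Sum.inl ⟨i, _⟩) (⟨i, by omega⟩, 0) (Or.inl rfl)).reachable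
      exact Or.inr (Or.inl ⟨rfl, ⟨i+1, hi⟩, (Nat.mod_eq_of_lt hi).symm, rfl⟩)
  have h2 : ∀ e, (sunletIndicator n d).Reachable (V e (d+2)) (Sum.inl (Sum.inl ⟨0, hn⟩)) := by
    intro e
    exact (adjc (Sum.inl e.1) e (Or.inl rfl)).reachable.trans (h1 _ _)
  have step : ∀ (e : Fin n × Fin 2) k l, nadj d k l → (sunletIndicator n d).Reachable (V e l) (Sum.inl (Sum.inl ⟨0, hn⟩)) →
      (sunletIndicator n d).Reachable (V e k) (Sum.inl (Sum.inl ⟨0, hn⟩)) := by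
    intro e k l h h'
    exact ((adj_VV (nadj_lt h).1 (nadj_lt h).2).2 ⟨rfl, h⟩).reachable.trans h'
  have h3 : ∀ e, (sunletIndicator n d).Reachable (V e (d+1)) (Sum.inl (Sum.inl ⟨0, hn⟩)) := fun e =>
    step e _ (d+2) (by unfold nadj; omega) (h2 e)
  have h4 : ∀ e, (sunletIndicator n d).Reachable (V e 0) (Sum.inl (Sum.inl ⟨0, hn⟩)) := fun e =>
    step e _ (d+1) (by unfold nadj; omega) (h3 e)
  rcases cases_W u with ⟨x, rfl⟩ | ⟨e, k, hk, rfl⟩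
  · rcases x with i | i
    · exact h1 i i.2
    · exact (adjc (Sum.inr i) (i, 1) (Or.inr (Or.inr ⟨rfl, rfl⟩))).symm.reachable.trans (h2 _)
  · by_cases h : k = d+2
    · rw [h]; exact h2 e
    by_cases h : k = d+1
    · rw [h]; exact h3 e
    by_cases h : k = 0
    · rw [h]; exact h4 e
    by_cases h : k = d
    · exact step e _ (d+1) (by unfold nadj; omega) (h3 e)
    · exact step e _ 0 (by unfold nadj; omega) (h4 e)

theorem line_preconn {n d : ℕ} (hd : 3 ≤ d) (hn : 0 < n) (e1 e2 : (sunletIndicator n d).edgeSet) :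
    (sunletIndicator n d).lineGraph.Reachable e1 e2 := by
  obtain ⟨p⟩ := (conn hd hn e1.1.out.1).trans (conn hd hn e2.1.out.1).symm
  exact line_reach p e1 e2 (Sym2.out_fst_mem _) (Sym2.out_fst_mem _)

/-! covering maps -/

def pf {n m : ℕ} (hm : 0 < m) (i : Fin n) : Fin m := ⟨i.val % m, Nat.mod_lt _ hm⟩
def pe {n m : ℕ} (hm : 0 < m) (e : Fin n × Fin 2) : Fin m × Fin 2 := (pf hm e.1, e.2)
def px {n m : ℕ} (hm : 0 < m) (x : Fin n ⊕ Fin n) : Fin m ⊕ Fin m := Sum.map (pf hm) (pf hm) x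
def pw {n m d : ℕ} (hm : 0 < m) (w : WT n d) : WT m d :=
  Sum.map (px hm) (fun p => (pe hm p.1, p.2)) w

theorem pw_V {n m d : ℕ} (hm : 0 < m) (e : Fin n × Fin 2) (k : ℕ) :
    (pw hm (V e k) : WT m d) = V (pe hm e) k := rfl

theorem pw_inl {n m d : ℕ} (hm : 0 < m) (x : Fin n ⊕ Fin n) :
    (pw hm (Sum.inl x) : WT m d) = Sum.inl (px hm x) := rfl

theorem pinc {n m : ℕ} (hm : 0 < m) (hmn : m ∣ n) {x : Fin n ⊕ Fin n} {e} (h : inc x e) :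
    inc (px hm x) (pe hm e) := by
  rcases h with rfl | ⟨h, j, hj, rfl⟩ | ⟨h, rfl⟩
  · exact Or.inl rfl
  · refine Or.inr (Or.inl ⟨h, pf hm j, ?_, rfl⟩)
    simp [pf, pe, hj, Nat.mod_mod_of_dvd _ hmn]
  · exact Or.inr (Or.inr ⟨h, rfl⟩)

theorem not_succ {m a : ℕ} (hm : 2 ≤ m) : (a+1) % m ≠ a % m := by
  intro h
  have : a ≡ a + 1 [MOD m] := h.symm
  have := (Nat.modEq_iff_dvd' (by omega)).1 this
  simp at this
  omega

theorem loc1 {n m : ℕ} (hm : 0 < m) (hm2 : 2 ≤ m) (hmn : m ∣ n) {x : Fin n ⊕ Fin n} {e e'} (h : inc x e)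
    (h' : inc x e') (hp : pe hm e = pe hm e') : e = e' := by
  rcases x with i | i
  · obtain ⟨a, s⟩ := e
    obtain ⟨b, t⟩ := e'
    simp only [pe, pf, Prod.mk.injEq, Fin.mk.injEq] at hp
    obtain ⟨hp, rfl⟩ := hp
    have key : ∀ a b : Fin n, (a.val + 1) % n = b.val → a.val % m ≠ b.val % m := by
      intro a b h h'
      rw [← h, Nat.mod_mod_of_dvd _ hmn] at h'
      exact not_succ hm2 h'.symm
    have c1 := inc_cyc h
    have c2 := inc_cyc h'
    have s0 : ((1 : Fin 2) = 0) ↔ False := by decide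
    simp only [Prod.mk.injEq] at c1 c2
    have goal : a = b := by
      rcases c1 with ⟨rfl, rfl⟩ | ⟨rfl, rfl⟩ | ⟨rfl, c1⟩ <;>
      rcases c2 with ⟨rfl, c2⟩ | ⟨rfl, c2⟩ | ⟨c2, c3⟩ <;> try rfl
      · exact absurd c2 (by decide)
      · exact absurd hp.symm (key _ _ c3)
      · exact absurd c2 (by decide)
      · exact absurd hp (key _ _ c1)
      · exact Fin.ext (succ_inj a.2 b.2 (c1.trans c3.symm))
    rw [goal]
  · exact (inc_pend h).trans (inc_pend h').symm

theorem loc2 {n m : ℕ} (hm : 0 < m) (hm2 : 2 ≤ m) (hmn : m ∣ n) {x y : Fin n ⊕ Fin n} {e} (h : inc x e)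
    (h' : inc y e) (hp : px hm x = px hm y) : x = y := by
  have key : ∀ a b : Fin n, b.val = (a.val + 1) % n → pf hm a ≠ pf hm b := by
    intro a b h h'
    have h' := congrArg Fin.val h'
    simp only [pf] at h'
    rw [h, Nat.mod_mod_of_dvd _ hmn] at h'
    exact not_succ hm2 h'.symm
  rcases h with rfl | ⟨h, j, hj, rfl⟩ | ⟨h, rfl⟩ <;> rcases h' with rfl | ⟨h', j', hj', rfl⟩ | ⟨h', rfl⟩ <;>
    simp only [px, Sum.map_inl, Sum.map_inr, Sum.inl.injEq, reduceCtorEq] at hp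
  · rfl
  · exact absurd hp (key _ _ hj')
  · exact absurd hp.symm (key _ _ hj)
  · rw [Fin.ext (hj.trans hj'.symm)]
  · rfl

theorem pw_adj {n m d : ℕ} (hm : 0 < m) (hmn : m ∣ n) {u v : WT n d}
    (h : (sunletIndicator n d).Adj u v) : (sunletIndicator m d).Adj (pw hm u) (pw hm v) := by
  have IV : ∀ (x) (w : WT n d), (sunletIndicator n d).Adj (Sum.inl x) w →
      (sunletIndicator m d).Adj (pw hm (Sum.inl x)) (pw hm w) := by
    intro x w h
    obtain ⟨e, he, rfl⟩ := adj_inl h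
    rw [pw_inl, pw_V, adj_IV (by omega)]
    exact ⟨rfl, pinc hm hmn he⟩
  rcases cases_W u with ⟨x, rfl⟩ | ⟨e, k, hk, rfl⟩
  · exact IV _ _ h
  · rcases cases_W v with ⟨x, rfl⟩ | ⟨e', l, hl, rfl⟩
    · exact (IV _ _ h.symm).symm
    · rw [adj_VV hk hl] at h
      rw [pw_V, pw_V, adj_VV hk hl, h.1]
      exact ⟨rfl, h.2⟩

theorem pw_loc {n m d : ℕ} (hm : 0 < m) (hm2 : 2 ≤ m) (hmn : m ∣ n) {u v w : WT n d}
    (h : (sunletIndicator n d).Adj u v) (h' : (sunletIndicator n d).Adj u w)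
    (hp : (pw hm v : WT m d) = pw hm w) : v = w := by
  rcases cases_W u with ⟨x, rfl⟩ | ⟨e, k, hk, rfl⟩
  · obtain ⟨e, he, rfl⟩ := adj_inl h
    obtain ⟨e', he', rfl⟩ := adj_inl h'
    rw [pw_V, pw_V, V_inj (by omega) (by omega)] at hp
    rw [loc1 hm hm2 hmn he he' hp.1]
  · rcases cases_W v with ⟨x, rfl⟩ | ⟨e1, l, hl, rfl⟩ <;> rcases cases_W w with ⟨y, rfl⟩ | ⟨e2, l', hl', rfl⟩
    · have hx := ((adj_IV hk).1 h.symm).2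
      have hy := ((adj_IV hk).1 h'.symm).2
      rw [loc2 hm hm2 hmn hx hy (Sum.inl.inj hp)]
    · exact absurd hp.symm V_ne_inl
    · exact absurd hp V_ne_inl
    · rw [pw_V, pw_V, V_inj hl hl'] at hp
      rw [← ((adj_VV hk hl).1 h).1, ← ((adj_VV hk hl').1 h').1, hp.2]

theorem line_cover {n m d : ℕ} (hm : 2 ≤ m) (hmn : m ∣ n) :
    Nonempty ((sunletIndicator n d).lineGraph →g (sunletIndicator m d).lineGraph) := by
  have hm0 : 0 < m := by omega
  let φ : (sunletIndicator n d) →g (sunletIndicator m d) := ⟨pw hm0, fun h => pw_adj hm0 hmn h⟩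
  refine ⟨⟨φ.mapEdgeSet, ?_⟩⟩
  intro a b h
  rw [SimpleGraph.lineGraph_adj_iff_exists] at h ⊢
  obtain ⟨hne, x, hx, hx'⟩ := h
  obtain ⟨a, ha⟩ := a
  obtain ⟨b, hb⟩ := b
  obtain ⟨y, rfl, hy⟩ := edge_mem ha hx
  obtain ⟨z, rfl, hz⟩ := edge_mem hb hx'
  refine ⟨?_, pw hm0 x, ?_, ?_⟩
  · intro h
    have h := congrArg Subtype.val h
    have h : s(pw hm0 x, pw hm0 y) = (s(pw hm0 x, pw hm0 z) : Sym2 (WT m d)) := h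
    have h2 : (pw hm0 y : WT m d) = pw hm0 z := by
      rw [Sym2.eq_iff] at h
      rcases h with h | h
      · exact h.2
      · exact h.2.trans h.1
    exact hne (by simp [pw_loc hm0 hm hmn hy hz h2])
  · exact Sym2.mem_mk_left _ _
  · exact Sym2.mem_mk_left _ _

theorem sigma_adj {ι : Type*} {W : ι → Type*} {G : ∀ i, SimpleGraph (W i)} {i : ι} {u v : W i} :
    (sigmaGraph G).Adj ⟨i, u⟩ ⟨i, v⟩ ↔ (G i).Adj u v := by
  rw [sigmaGraph, SimpleGraph.fromRel_adj]
  constructor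
  · rintro ⟨-, (⟨j, a, b, h, h1, h2⟩ | ⟨j, a, b, h, h1, h2⟩)⟩
    · obtain ⟨rfl, h1⟩ := Sigma.mk.inj h1
      rw [eq_of_heq h1, eq_of_heq (Sigma.mk.inj h2).2]; exact h
    · obtain ⟨rfl, h1⟩ := Sigma.mk.inj h1
      rw [eq_of_heq h1, eq_of_heq (Sigma.mk.inj h2).2]; exact h.symm
  · intro h
    refine ⟨?_, Or.inl ⟨i, u, v, h, rfl, rfl⟩⟩
    intro h'
    exact h.ne (eq_of_heq (Sigma.mk.inj h').2)

theorem sigma_adj_fst {ι : Type*} {W : ι → Type*} {G : ∀ i, SimpleGraph (W i)} {x y : Σ i, W i}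
    (h : (sigmaGraph G).Adj x y) : x.1 = y.1 := by
  rw [sigmaGraph, SimpleGraph.fromRel_adj] at h
  obtain ⟨-, (⟨j, a, b, h, rfl, rfl⟩ | ⟨j, a, b, h, rfl, rfl⟩)⟩ := h <;> rfl

theorem main (d : ℕ) (hd : 3 ≤ d) (A B : Finset ℕ+) :
    Nonempty
      (sigmaGraph (fun a : A => (sunletIndicator (3 * ((a : ℕ+) : ℕ)) d).lineGraph) →g
       sigmaGraph (fun b : B => (sunletIndicator (3 * ((b : ℕ+) : ℕ)) d).lineGraph)) ↔
      ∀ a ∈ A, ∃ b ∈ B, b ∣ a := by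
  constructor
  · rintro ⟨f⟩ a ha
    have hn : 3 ≤ 3 * (a : ℕ) := by have := a.pos; omega
    let fa : (sunletIndicator (3 * (a : ℕ)) d).edgeSet → _ := fun x => f ⟨⟨a, ha⟩, x⟩
    have hfa : ∀ x y, (sunletIndicator (3 * (a : ℕ)) d).lineGraph.Adj x y → 
        (sigmaGraph (fun b : B => (sunletIndicator (3 * ((b : ℕ+) : ℕ)) d).lineGraph)).Adj (fa x) (fa y) := by
      intro x y h
      exact f.map_adj (sigma_adj.2 h)
    have hconst : ∀ x y, (fa x).1 = (fa y).1 := by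
      intro x y
      obtain ⟨p⟩ := line_preconn hd (by omega) x y
      induction p with
      | nil => rfl
      | cons h p ih => exact (sigma_adj_fst (hfa _ _ h)).trans ih
    have hadj : (sunletIndicator (3 * (a : ℕ)) d).Adj (V (⟨0, by omega⟩, 0) (d+1)) (V (⟨0, by omega⟩, 0) 0) := by
      rw [adj_VV (by omega) (by omega)]
      refine ⟨rfl, ?_⟩
      unfold nadj; omega
    let x0 : (sunletIndicator (3 * (a : ℕ)) d).edgeSet := ⟨s(_, _), hadj⟩
    obtain ⟨b, hb⟩ : ∃ b, (fa x0).1 = b := ⟨_, rfl⟩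
    have hy : ∀ x, ∃ y, fa x = ⟨b, y⟩ := by
      intro x
      have := (hconst x x0).trans hb
      rcases hfx : fa x with ⟨c, y⟩
      rw [hfx] at this
      obtain rfl : c = b := this
      exact ⟨y, rfl⟩
    choose y hy using hy
    have hdvd := hom_dvd hd hn (m := 3 * ((b : ℕ+) : ℕ)) (by have := (b : ℕ+).pos; omega) ⟨y, by
      intro u v h
      have := hfa u v h
      rw [hy, hy, sigma_adj] at this
      exact this⟩
    refine ⟨b, b.2, ?_⟩
    rw [PNat.dvd_iff]
    exact Nat.dvd_of_mul_dvd_mul_left (by omega) hdvd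
  · intro h
    have : ∀ a : A, ∃ b : B, Nonempty ((sunletIndicator (3 * ((a : ℕ+) : ℕ)) d).lineGraph →g 
        (sunletIndicator (3 * ((b : ℕ+) : ℕ)) d).lineGraph) := by
      intro a
      obtain ⟨b, hb, hab⟩ := h a a.2
      refine ⟨⟨b, hb⟩, line_cover (by have := b.pos; simp only; omega) ?_⟩
      exact Nat.mul_dvd_mul_left 3 (PNat.dvd_iff.1 hab)
    choose b φ using this
    have φ := fun a => (φ a).some
    refine ⟨⟨fun x => ⟨b x.1, φ x.1 x.2⟩, ?_⟩⟩
    rintro ⟨a, u⟩ ⟨a', v⟩ h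
    obtain rfl : a = a' := sigma_adj_fst h
    rw [sigma_adj] at h ⊢
    exact (φ a).map_adj h

end LGH

/-- **The embedding of the universal order into line graphs.** For `d ≥ 3` and finite
nonempty sets `A`, `B` of positive integers, there is a graph homomorphism from the
disjoint union of the `L(G_{3a,d})`, `a ∈ A`, to the disjoint union of the
`L(G_{3b,d})`, `b ∈ B`, iff every `a ∈ A` is divisible by some `b ∈ B`. -/
theorem disjUnion_lineGraph_hom_iff (d : ℕ) (hd : 3 ≤ d)
    (A B : Finset ℕ+) (hA : A.Nonempty) (hB : B.Nonempty) :
    Nonempty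
      (sigmaGraph (fun a : A => (sunletIndicator (3 * ((a : ℕ+) : ℕ)) d).lineGraph) →g
       sigmaGraph (fun b : B => (sunletIndicator (3 * ((b : ℕ+) : ℕ)) d).lineGraph)) ↔
      ∀ a ∈ A, ∃ b ∈ B, b ∣ a := by
  exact LGH.main d hd A B
end
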